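/- (Schauder estimate for the parabolic Landau equation) Let γ ∈ [-3,-2], T > 0, α ∈ (0,1), λ, Λ > 0, v₀ ∈ ℝ³ and 0 < R ≤ (1/2)⟨v₀⟩. Let ā : Q_R(v₀) → symmetric 3×3 matrices satisfy λ⟨v⟩^γ |ξ|² ≤ ⟨ā(t,v)ξ, ξ⟩ ≤ Λ⟨v⟩^{γ+2} |ξ|² for all (t,v) ∈ Q_R(v₀) and ξ ∈ ℝ³, and let c̄ : Q_R(v₀) → ℝ. Let u : Q_R(v₀) → ℝ be C¹ in time and C² in velocity, solving ∂_t u = ā : ∇²u + c̄ u on Q_R(v₀). If u is C^{2+α} on Q_R(v₀), then [u]*_{2+α,Q_R(v₀)} ≤ C_{α,λ,Λ} ( [u₀]*_{2+α,Σ_R(v₀)} + 𝒱(v₀) ‖u‖_{L^∞(Q_R(v₀))} ), where u₀ = u(0,·), C_{α,λ,Λ} depends only on α, λ, Λ, and 𝒱(v₀) = (1 + [ā]*_{α,Q_R(v₀)})^{1+2/α} ⟨v₀⟩^{(2−γ)(1+2/α)} + [c̄]^★_α ⟨v₀⟩^{−γ} + (1 + ‖d² c̄‖_{L^∞(Q_R(v₀))})^{1+α/2}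 ⟨v₀⟩^{−γ(1+α/2)}. -/

import Mathlib

noncomputable section

open MeasureTheory Real
open scoped ENNReal RealInnerProductSpace

/-- The velocity space ℝ³. -/
abbrev V3 : Type := EuclideanSpace ℝ (Fin 3)

/-- 3×3 real matrices. -/
abbrev Mat3 : Type := Matrix (Fin 3) (Fin 3) ℝ

/-- Japanese bracket ⟨v⟩ = √(1+|v|²). -/
def jap (v : V3) : ℝ := Real.sqrt (1 + ‖v‖ ^ 2)

/-- `i`-th basis vector of ℝ³. -/
def esingle (i : Fin 3) : V3 := EuclideanSpace.single i (1 : ℝ)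

/-- Orthogonal projection Π(z) onto z^⊥. -/
def proj (z : V3) : Mat3 := fun i j =>
  (if i = j then (1 : ℝ) else 0) - (z i / ‖z‖) * (z j / ‖z‖)

/-- Landau kernel a(z) = |z|^{γ+2} Π(z). -/
def landauKernel (γ : ℝ) (z : V3) : Mat3 := fun i j => ‖z‖ ^ (γ + 2) * proj z i j

/-- Cut-off kernel ã(z) = ⟨z⟩^γ |z|² Π(z). -/
def cutoffKernel (γ : ℝ) (z : V3) : Mat3 := fun i j => jap z ^ γ * ‖z‖ ^ 2 * proj z i j

/-- Bilinear form ⟨A w, z⟩. -/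
def bilin (A : Mat3) (w z : V3) : ℝ := ∑ i, ∑ j, A i j * w i * z j

/-- Quadratic form A : w^{⊗2}. -/
def quadForm (A : Mat3) (w : V3) : ℝ := bilin A w w

/-- Matrix dot product A : B. -/
def matDot (A B : Mat3) : ℝ := ∑ i, ∑ j, A i j * B i j

/-- (Frobenius) norm of a 3×3 matrix. -/
def matNorm (A : Mat3) : ℝ := Real.sqrt (∑ i, ∑ j, (A i j) ^ 2)

/-- Entropy H(f) = ∫ f ln f. -/
def entropy (f : V3 → ℝ) : ℝ := ∫ v, f v * Real.log (f v)

/-- Relative entropy H(f|g) = ∫ ((f/g) ln(f/g) − f/g + 1) g ∈ [0,∞]. -/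
def relEntropy (f g : V3 → ℝ) : ℝ≥0∞ :=
  ∫⁻ v, ENNReal.ofReal ((f v / g v * Real.log (f v / g v) - f v / g v + 1) * g v)

/-- Hessian matrix of a function on ℝ³. -/
def hess (φ : V3 → ℝ) (v : V3) : Mat3 := fun i j =>
  iteratedFDeriv ℝ 2 φ v ![esingle i, esingle j]

/-- Hessian matrix within a set. -/
def hessW (φ : V3 → ℝ) (s : Set V3) (v : V3) : Mat3 := fun i j =>
  iteratedFDerivWithin ℝ 2 φ s v ![esingle i, esingle j]

/-- Gradient of the logarithm, ∇ ln φ. -/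
def logGrad (φ : V3 → ℝ) (v : V3) : V3 := gradient (fun w => Real.log (φ w)) v

/-- Hessian of the logarithm, ∇² ln φ. -/
def logHess (φ : V3 → ℝ) (v : V3) : Mat3 := hess (fun w => Real.log (φ w)) v

/-- `G` is the weak gradient of `F` on ℝ⁶ ≃ ℝ³ × ℝ³. -/
def IsWeakGrad6 (F : V3 × V3 → ℝ) (G : V3 × V3 → V3 × V3) : Prop :=
  ∀ φ : V3 × V3 → ℝ, ContDiff ℝ (⊤ : ℕ∞) φ → HasCompactSupport φ →
    ∀ e : V3 × V3,
      (∫ p : V3 × V3, F p * fderiv ℝ φ p e) =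
        - ∫ p : V3 × V3, (⟪(G p).1, e.1⟫ + ⟪(G p).2, e.2⟫) * φ p

/-- `G` is the weak gradient of `F` on ℝ³. -/
def IsWeakGrad3 (F : V3 → ℝ) (G : V3 → V3) : Prop :=
  ∀ φ : V3 → ℝ, ContDiff ℝ (⊤ : ℕ∞) φ → HasCompactSupport φ →
    ∀ e : V3, (∫ v, F v * fderiv ℝ φ v e) = - ∫ v, ⟪G v, e⟫ * φ v

/-- Entropy production functional associated with a weak gradient of √(f f'). -/
def dissipation (γ : ℝ) (G : V3 × V3 → V3 × V3) : ℝ≥0∞ :=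
  ∫⁻ p : V3 × V3,
    ENNReal.ofReal (quadForm (landauKernel γ (p.1 - p.2)) ((G p).1 - (G p).2))

/-- Villani's H-solutions of the Landau equation on [0,T], with weak gradient data
`fGrad s` for √(f_s f_s'). -/
structure IsHSolution (γ T : ℝ) (f : ℝ → V3 → ℝ) (fGrad : ℝ → V3 × V3 → V3 × V3) : Prop where
  nonneg : ∀ t ∈ Set.Icc 0 T, ∀ v, 0 ≤ f t v
  integrable : ∀ t ∈ Set.Icc 0 T, Integrable (f t)
  entIntegrable : ∀ t ∈ Set.Icc 0 T, Integrable (fun v => f t v * Real.log (f t v))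
  contDistrib : ∀ φ : V3 → ℝ, ContDiff ℝ (⊤ : ℕ∞) φ → HasCompactSupport φ →
    ContinuousOn (fun t => ∫ v, φ v * f t v) (Set.Icc 0 T)
  mass : ∀ t ∈ Set.Icc 0 T, (∫ v, f t v) = 1
  momentumIntegrable : ∀ t ∈ Set.Icc 0 T, Integrable (fun v => f t v • v)
  momentum : ∀ t ∈ Set.Icc 0 T, (∫ v, f t v • v) = ∫ v, f 0 v • v
  energyIntegrable : ∀ t ∈ Set.Icc 0 T, Integrable (fun v => ‖v‖ ^ 2 * f t v)
  energy : ∀ t ∈ Set.Icc 0 T, (∫ v, ‖v‖ ^ 2 * f t v) = ∫ v, ‖v‖ ^ 2 * f 0 v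
  weakGrad : ∀ᵐ s ∂(volume.restrict (Set.Icc 0 T)),
    IsWeakGrad6 (fun p => Real.sqrt (f s p.1 * f s p.2)) (fGrad s)
  dissipationFinite : ∀ t ∈ Set.Icc 0 T,
    (∫⁻ s in Set.Ioc (0 : ℝ) t, dissipation γ (fGrad s)) < ⊤
  entropyProd : ∀ t ∈ Set.Icc 0 T,
    entropy (f t) + 2 * (∫⁻ s in Set.Ioc (0 : ℝ) t, dissipation γ (fGrad s)).toReal ≤
      entropy (f 0)
  weakForm : ∀ φ : ℝ → V3 → ℝ,
    ContDiff ℝ 2 (fun q : ℝ × V3 => φ q.1 q.2) →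
    HasCompactSupport (fun q : ℝ × V3 => φ q.1 q.2) →
    ∀ t ∈ Set.Icc 0 T,
      (∫ v, φ t v * f t v) - (∫ v, φ 0 v * f 0 v) =
        (∫ s in (0 : ℝ)..t, ∫ v, deriv (fun r => φ r v) s * f s v) -
          ∫ s in (0 : ℝ)..t, ∫ p : V3 × V3,
            bilin (landauKernel γ (p.1 - p.2))
              (gradient (φ s) p.1 - gradient (φ s) p.2)
              ((fGrad s p).1 - (fGrad s p).2) * Real.sqrt (f s p.1 * f s p.2)

/-- Convolved Landau matrix ā = a ⋆ f. -/
def abar (γ : ℝ) (f : V3 → ℝ) (v : V3) : Mat3 := fun i j =>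
  ∫ w, landauKernel γ (v - w) i j * f w

/-- Zero order coefficient c̄ of the Landau equation in nondivergence form. -/
def cbar (γ : ℝ) (f : V3 → ℝ) (v : V3) : ℝ :=
  if γ = -3 then 8 * Real.pi * f v else 2 * (γ + 3) * ∫ w, ‖v - w‖ ^ γ * f w

/-- Convolution of the cut-off kernel with a density. -/
def cutoffConv (γ : ℝ) (f : V3 → ℝ) (v : V3) : Mat3 := fun i j =>
  ∫ w, cutoffKernel γ (v - w) i j * f w

/-- Classical solution of the Landau equation on a time set `I`
(in nondivergence parabolic form ∂_t g = ā : ∇²g + c̄ g). -/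
structure IsClassicalSolution (γ : ℝ) (I : Set ℝ) (g : ℝ → V3 → ℝ) : Prop where
  pos : ∀ t ∈ I, ∀ v, 0 < g t v
  timeC1 : ∀ v, ContDiffOn ℝ 1 (fun t => g t v) I
  velC2 : ∀ t ∈ I, ContDiff ℝ 2 (g t)
  eqn : ∀ t ∈ I, ∀ v,
    derivWithin (fun s => g s v) I t =
      matDot (abar γ (g t) v) (hess (g t) v) + cbar γ (g t) v * g t v

/-- The moment exponent ρ = max(2κ, 2κ+2γ+4, 2ζ, ν). -/
def rhoExp (γ κ ζ ν : ℝ) : ℝ := max (max (2 * κ) (2 * κ + 2 * γ + 4)) (max (2 * ζ) ν)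

/-- Setting (⋆) of the paper. -/
structure Setting (γ T : ℝ) where
  f : ℝ → V3 → ℝ
  fGrad : ℝ → V3 × V3 → V3 × V3
  g : ℝ → V3 → ℝ
  κ : ℝ
  ν : ℝ
  ζ : ℝ
  K1 : ℝ → ℝ
  K2 : ℝ → ℝ
  K3 : ℝ → ℝ
  Mf : ℝ
  Mg : ℝ
  hγ : γ ∈ Set.Ico (-3 : ℝ) 0
  hT : 0 < T
  hf : IsHSolution γ T f fGrad
  hg : IsClassicalSolution γ (Set.Icc 0 T) g
  hκ : 1 ≤ κ
  hν : 1 ≤ ν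
  hζ : 0 ≤ ζ
  K1nonneg : ∀ t, 0 ≤ K1 t
  K2nonneg : ∀ t, 0 ≤ K2 t
  K3nonneg : ∀ t, 0 ≤ K3 t
  K1meas : Measurable K1
  K2meas : Measurable K2
  K3meas : Measurable K3
  K1bound : ∀ t ∈ Set.Icc 0 T, ∀ v, ‖logGrad (g t) v‖ ≤ K1 t * jap v ^ κ
  K2bound : ∀ t ∈ Set.Icc 0 T, ∀ v,
    |derivWithin (fun s => Real.log (g s v)) (Set.Icc 0 T) t| ≤ K2 t * jap v ^ ν
  K3bound : ∀ t ∈ Set.Icc 0 T, ∀ v, matNorm (logHess (g t) v) ≤ K3 t * jap v ^ ζ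
  Kint : IntegrableOn (fun t => K2 t + K1 t ^ 2 + K3 t ^ 2) (Set.Icc 0 T)
  fMomentInt : ∀ t ∈ Set.Icc 0 T,
    Integrable (fun v => jap v ^ (rhoExp γ κ ζ ν - γ) * f t v)
  fMoment : ∀ t ∈ Set.Icc 0 T, (∫ v, jap v ^ (rhoExp γ κ ζ ν - γ) * f t v) ≤ Mf
  gMomentInt : ∀ t ∈ Set.Icc 0 T,
    Integrable (fun v => jap v ^ (rhoExp γ κ ζ ν - γ) * g t v)
  gMoment : ∀ t ∈ Set.Icc 0 T, (∫ v, jap v ^ (rhoExp γ κ ζ ν - γ) * g t v) ≤ Mg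

/-- The good term 𝒢_s. -/
def goodTerm (γ : ℝ) (f g : ℝ → V3 → ℝ) (fGrad : ℝ → V3 × V3 → V3 × V3) (s : ℝ) : ℝ :=
  2 * ∫ p : V3 × V3,
    quadForm (landauKernel γ (p.1 - p.2))
      (((fGrad s p).1 - (fGrad s p).2) -
        Real.sqrt (f s p.1 * f s p.2) • (logGrad (g s) p.1 - logGrad (g s) p.2))

/-- The vector field a(v−v')(∇−∇')(g g'). -/
def landauFlux (γ : ℝ) (g : V3 → ℝ) (v w : V3) : Fin 3 → ℝ := fun i =>
  ∑ j, landauKernel γ (v - w) i j * (g w * (gradient g v) j - g v * (gradient g w) j)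

/-- (∇−∇')·[a(v−v')(∇−∇')(g g')]. -/
def divDiffFlux (γ : ℝ) (g : V3 → ℝ) (v w : V3) : ℝ :=
  ∑ i, (fderiv ℝ (fun z => landauFlux γ g z w i) v (esingle i) -
        fderiv ℝ (fun z => landauFlux γ g v z i) w (esingle i))

/-- The bad term ℬ_s. -/
def badTerm (γ : ℝ) (f g : ℝ → V3 → ℝ) (s : ℝ) : ℝ :=
  (1 / 2) * ∫ p : V3 × V3,
    (f s p.1 - g s p.1) * (f s p.2 - g s p.2) / (g s p.1 * g s p.2) *
      divDiffFlux γ (g s) p.1 p.2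

/-- Weighted relative Fisher information ∫ |2∇√f − √f ∇ln g|² ⟨v⟩^γ dv. -/
def relFisher (γ : ℝ) (f g : V3 → ℝ) (fGrad3 : V3 → V3) : ℝ :=
  ∫ v, ‖(2 : ℝ) • fGrad3 v - Real.sqrt (f v) • logGrad g v‖ ^ 2 * jap v ^ γ

/-- ‖⟨v⟩^{−κ} ∇ ln g_s‖_{L^∞(ℝ³)} ∈ [0,∞]. -/
def gradLogSup (g : ℝ → V3 → ℝ) (κ s : ℝ) : ℝ≥0∞ :=
  ⨆ v : V3, ENNReal.ofReal (jap v ^ (-κ) * ‖logGrad (g s) v‖)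

/-- ‖⟨v⟩^{−ν} ∂_s ln g_s‖_{L^∞(ℝ³)} ∈ [0,∞]. -/
def dtLogSup (g : ℝ → V3 → ℝ) (T ν s : ℝ) : ℝ≥0∞ :=
  ⨆ v : V3, ENNReal.ofReal
    (jap v ^ (-ν) * |derivWithin (fun r => Real.log (g r v)) (Set.Icc 0 T) s|)

/-- ‖⟨v⟩^{−ζ} ∇² ln g_s‖_{L^∞(ℝ³)} ∈ [0,∞]. -/
def hessLogSup (g : ℝ → V3 → ℝ) (ζ s : ℝ) : ℝ≥0∞ :=
  ⨆ v : V3, ENNReal.ofReal (jap v ^ (-ζ) * matNorm (logHess (g s) v))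

/-- Open cube Σ_R(v₀) = v₀ + (−R,R)³. -/
def cube (v₀ : V3) (R : ℝ) : Set V3 := {v | ∀ i, |v i - v₀ i| < R}

/-- Closed cube v₀ + [−R,R]³ centered at the origin. -/
def ccube (R : ℝ) : Set V3 := {v | ∀ i, |v i| ≤ R}

/-- Distance to the boundary of the cube Σ_R(v₀). -/
def dCube (v₀ : V3) (R : ℝ) (v : V3) : ℝ :=
  Finset.univ.inf' (Finset.univ_nonempty) fun i : Fin 3 => R - |v i - v₀ i|

/-- The moment exponent k(γ,ℓ,δ) of Theorem 2. -/
def kExp (γ ℓ δ : ℝ) : ℝ := 8 * (max (2 + (ℓ - 2) / (2 + δ)) 1 + (2 - γ) / (2 * δ)) - γ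

section
open Filter Topology

def D3 (f : V3 → ℝ) (x h k l : V3) : ℝ :=
  f (x + h + k + l) - f (x + h + k - l) - f (x + h - k + l) + f (x + h - k - l)
  - f (x - h + k + l) + f (x - h + k - l) + f (x - h - k + l) - f (x - h - k - l)

lemma D3_swap12 (f : V3 → ℝ) (x h k l : V3) : D3 f x h k l = D3 f x k h l := by
  unfold D3
  rw [show x + k + h + l = x + h + k + l by abel, show x + k + h - l = x + h + k - l by abel,
    show x + k - h + l = x - h + k + l by abel, show x + k - h - l = x - h + k - l by abel,
    show x - k + h + l = x + h - k + l by abel, show x - k + h - l = x + h - k - l by abel,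
    show x - k - h + l = x - h - k + l by abel, show x - k - h - l = x - h - k - l by abel]
  ring

lemma D3_swap23 (f : V3 → ℝ) (x h k l : V3) : D3 f x h k l = D3 f x h l k := by
  unfold D3
  rw [show x + h + l + k = x + h + k + l by abel, show x + h + l - k = x + h - k + l by abel,
    show x + h - l + k = x + h + k - l by abel, show x + h - l - k = x + h - k - l by abel,
    show x - h + l + k = x - h + k + l by abel, show x - h + l - k = x - h - k + l by abel,
    show x - h - l + k = x - h + k - l by abel, show x - h - l - k = x - h - k - l by abel]
  ring

lemma D3_abs_le (f : V3 → ℝ) (x h k l : V3) (B : ℝ)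
    (hB : ∀ y, ‖y - x‖ ≤ ‖h‖ + ‖k‖ + ‖l‖ → |f y| ≤ B) : |D3 f x h k l| ≤ 8 * B := by
  have key : ∀ a b c : V3, ‖a‖ = ‖h‖ → ‖b‖ = ‖k‖ → ‖c‖ = ‖l‖ → |f (x + a + b + c)| ≤ B := by
    intro a b c ha hb hc
    apply hB
    rw [show x + a + b + c - x = a + b + c by abel, ← ha, ← hb, ← hc]
    exact norm_add₃_le
  have h1 := abs_le.1 (key h k l rfl rfl rfl)
  have h2 := abs_le.1 (key h k (-l) rfl rfl (norm_neg _))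
  have h3 := abs_le.1 (key h (-k) l rfl (norm_neg _) rfl)
  have h4 := abs_le.1 (key h (-k) (-l) rfl (norm_neg _) (norm_neg _))
  have h5 := abs_le.1 (key (-h) k l (norm_neg _) rfl rfl)
  have h6 := abs_le.1 (key (-h) k (-l) (norm_neg _) rfl (norm_neg _))
  have h7 := abs_le.1 (key (-h) (-k) l (norm_neg _) (norm_neg _) rfl)
  have h8 := abs_le.1 (key (-h) (-k) (-l) (norm_neg _) (norm_neg _) (norm_neg _))
  simp only [← sub_eq_add_neg] at *
  unfold D3
  rw [abs_le]
  constructor <;> linarith [h1.1, h1.2, h2.1, h2.2, h3.1, h3.2, h4.1, h4.2, h5.1, h5.2, h6.1, h6.2, h7.1, h7.2, h8.1, h8.2]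

lemma D3_diff_le (f : V3 → ℝ) (x h k l : V3) (B : ℝ)
    (hB : ∀ y z, ‖y - x‖ ≤ ‖h‖ + ‖k‖ + ‖l‖ → ‖z - x‖ ≤ ‖h‖ + ‖k‖ + ‖l‖ → ‖y - z‖ = 2 * ‖h‖ →
      |f y - f z| ≤ B) : |D3 f x h k l| ≤ 4 * B := by
  have key : ∀ b c : V3, ‖b‖ = ‖k‖ → ‖c‖ = ‖l‖ → |f (x + h + b + c) - f (x - h + b + c)| ≤ B := by
    intro b c hb hc
    apply hB
    · rw [show x + h + b + c - x = h + b + c by abel, ← hb, ← hc]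
      exact norm_add₃_le
    · rw [show x - h + b + c - x = -h + b + c by abel, ← hb, ← hc, ← norm_neg h]
      exact norm_add₃_le
    · rw [show x + h + b + c - (x - h + b + c) = (2:ℝ) • h by rw [two_smul]; abel, norm_smul]
      simp
  have h1 := abs_le.1 (key k l rfl rfl)
  have h2 := abs_le.1 (key k (-l) rfl (norm_neg _))
  have h3 := abs_le.1 (key (-k) l (norm_neg _) rfl)
  have h4 := abs_le.1 (key (-k) (-l) (norm_neg _) (norm_neg _))
  simp only [← sub_eq_add_neg] at *
  unfold D3
  rw [abs_le]
  constructor <;> linarith [h1.1, h1.2, h2.1, h2.2, h3.1, h3.2, h4.1, h4.2]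

lemma D3_add (f g : V3 → ℝ) (x h k l : V3) :
    D3 (fun y => f y + g y) x h k l = D3 f x h k l + D3 g x h k l := by
  unfold D3; ring

lemma D3_neg (f : V3 → ℝ) (x h k l : V3) :
    D3 (fun y => - f y) x h k l = - D3 f x h k l := by
  unfold D3; ring

lemma D3_smul (a : ℝ) (f : V3 → ℝ) (x h k l : V3) :
    D3 (fun y => a * f y) x h k l = a * D3 f x h k l := by
  unfold D3; ring

lemma D3_sum {ι : Type*} (s : Finset ι) (f : ι → V3 → ℝ) (x h k l : V3) :
    D3 (fun y => ∑ i ∈ s, f i y) x h k l = ∑ i ∈ s, D3 (f i) x h k l := by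
  classical
  induction s using Finset.induction_on with
  | empty => simp [D3]
  | insert a s ha ih =>
    simp only [Finset.sum_insert ha]
    rw [D3_add, ih]

lemma D3_tendsto {ι : Type*} {L : Filter ι} (q : ι → V3 → ℝ) (f : V3 → ℝ) (x h k l : V3)
    (hq : ∀ y, ‖y - x‖ ≤ ‖h‖ + ‖k‖ + ‖l‖ → Tendsto (fun s => q s y) L (𝓝 (f y))) :
    Tendsto (fun s => D3 (q s) x h k l) L (𝓝 (D3 f x h k l)) := by
  have key : ∀ a b c : V3, ‖a‖ = ‖h‖ → ‖b‖ = ‖k‖ → ‖c‖ = ‖l‖ →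
      Tendsto (fun s => q s (x + a + b + c)) L (𝓝 (f (x + a + b + c))) := by
    intro a b c ha hb hc
    apply hq
    rw [show x + a + b + c - x = a + b + c by abel, ← ha, ← hb, ← hc]
    exact norm_add₃_le
  have h1 := (key h k l rfl rfl rfl)
  have h2 := (key h k (-l) rfl rfl (norm_neg _))
  have h3 := (key h (-k) l rfl (norm_neg _) rfl)
  have h4 := (key h (-k) (-l) rfl (norm_neg _) (norm_neg _))
  have h5 := (key (-h) k l (norm_neg _) rfl rfl)
  have h6 := (key (-h) k (-l) (norm_neg _) rfl (norm_neg _))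
  have h7 := (key (-h) (-k) l (norm_neg _) (norm_neg _) rfl)
  have h8 := (key (-h) (-k) (-l) (norm_neg _) (norm_neg _) (norm_neg _))
  simp only [← sub_eq_add_neg] at *
  unfold D3
  exact ((((((h1.sub h2).sub h3).add h4).sub h5).add h6).add h7).sub h8

/-- time derivative of D3 -/
lemma D3_hasDeriv (u : ℝ → V3 → ℝ) (f : V3 → ℝ) (x h k l : V3) (I : Set ℝ) (t : ℝ)
    (hq : ∀ y, ‖y - x‖ ≤ ‖h‖ + ‖k‖ + ‖l‖ → HasDerivWithinAt (fun s => u s y) (f y) I t) :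
    HasDerivWithinAt (fun s => D3 (u s) x h k l) (D3 f x h k l) I t := by
  have key : ∀ a b c : V3, ‖a‖ = ‖h‖ → ‖b‖ = ‖k‖ → ‖c‖ = ‖l‖ →
      HasDerivWithinAt (fun s => u s (x + a + b + c)) (f (x + a + b + c)) I t := by
    intro a b c ha hb hc
    apply hq
    rw [show x + a + b + c - x = a + b + c by abel, ← ha, ← hb, ← hc]
    exact norm_add₃_le
  have h1 := (key h k l rfl rfl rfl)
  have h2 := (key h k (-l) rfl rfl (norm_neg _))
  have h3 := (key h (-k) l rfl (norm_neg _) rfl)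
  have h4 := (key h (-k) (-l) rfl (norm_neg _) (norm_neg _))
  have h5 := (key (-h) k l (norm_neg _) rfl rfl)
  have h6 := (key (-h) k (-l) (norm_neg _) rfl (norm_neg _))
  have h7 := (key (-h) (-k) l (norm_neg _) (norm_neg _) rfl)
  have h8 := (key (-h) (-k) (-l) (norm_neg _) (norm_neg _) (norm_neg _))
  simp only [← sub_eq_add_neg] at *
  unfold D3
  exact ((((((h1.sub h2).sub h3).add h4).sub h5).add h6).add h7).sub h8

/-- symmetric second difference -/
lemma symdiff {q q1 : ℝ → ℝ} {a q2 : ℝ} (h1 : ∀ᶠ s in 𝓝 a, HasDerivAt q (q1 s) s)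
    (h2 : HasDerivAt q1 q2 a) :
    Tendsto (fun s => (q (a + s) + q (a - s) - 2 * q a) / s ^ 2) (𝓝[>] 0) (𝓝 q2) := by
  have hp : Tendsto (fun s : ℝ => a + s) (𝓝 0) (𝓝 a) := by
    have : Tendsto (fun s : ℝ => a + s) (𝓝 0) (𝓝 (a + 0)) := by
      apply Continuous.tendsto; fun_prop
    simpa using this
  have hm : Tendsto (fun s : ℝ => a - s) (𝓝 0) (𝓝 a) := by
    have : Tendsto (fun s : ℝ => a - s) (𝓝 0) (𝓝 (a - 0)) := by
      apply Continuous.tendsto; fun_prop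
    simpa using this
  have hqc : ContinuousAt q a := h1.self_of_nhds.continuousAt
  refine HasDerivAt.lhopital_zero_nhdsGT (f' := fun s => q1 (a + s) - q1 (a - s))
    (g' := fun s => 2 * s) ?_ ?_ ?_ ?_ ?_ ?_
  · have e1 := hp.eventually h1
    have e2 := hm.eventually h1
    filter_upwards [mem_nhdsWithin_of_mem_nhds e1, mem_nhdsWithin_of_mem_nhds e2] with s hs1 hs2
    have d1 : HasDerivAt (fun s => q (a + s)) (q1 (a + s)) s := by
      simpa using hs1.comp_const_add a s
    have d2 : HasDerivAt (fun s => q (a - s)) (-q1 (a - s)) s := by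
      simpa using hs2.comp_const_sub a s
    have := (d1.add d2).sub_const (2 * q a)
    simpa [sub_eq_add_neg] using this
  · filter_upwards with s
    simpa using (hasDerivAt_pow 2 s)
  · filter_upwards [self_mem_nhdsWithin] with s hs
    have : (0:ℝ) < s := hs
    positivity
  · have := ((hqc.tendsto.comp hp).add (hqc.tendsto.comp hm)).sub_const (2 * q a)
    have h0 : q a + q a - 2 * q a = 0 := by ring
    rw [h0] at this
    exact this.mono_left nhdsWithin_le_nhds
  · have : Tendsto (fun s : ℝ => s ^ 2) (𝓝 0) (𝓝 (0 ^ 2)) := by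
      apply Continuous.tendsto; fun_prop
    simp at this
    exact this.mono_left nhdsWithin_le_nhds
  · have hs : HasDerivAt (fun s => q1 (a + s) - q1 (a - s)) (q2 + q2) 0 := by
      have d1 : HasDerivAt (fun s => q1 (a + s)) q2 0 := by
        have : HasDerivAt q1 q2 (a + 0) := by simpa using h2
        simpa using this.comp_const_add a 0
      have d2 : HasDerivAt (fun s => q1 (a - s)) (-q2) 0 := by
        have : HasDerivAt q1 q2 (a - 0) := by simpa using h2
        simpa using this.comp_const_sub a 0
      have h5 := d1.sub d2
      rw [sub_neg_eq_add] at h5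
      exact h5
    have h3 := (hasDerivAt_iff_tendsto_slope.1 hs)
    have h4 : Tendsto (fun s => slope (fun s => q1 (a + s) - q1 (a - s)) 0 s / 2) (𝓝[>] 0)
        (𝓝 ((q2 + q2)/2)) := by
      refine (h3.mono_left ?_).div_const 2
      exact nhdsWithin_mono _ (fun s hs => ne_of_gt hs)
    rw [show (q2 + q2)/2 = q2 by ring] at h4
    refine h4.congr' ?_
    filter_upwards [self_mem_nhdsWithin] with s hs
    have : (0:ℝ) < s := hs
    simp [slope_def_field]
    field_simp

/-- C² data on an open set. -/
structure C2D (Ω : Set V3) (f : V3 → ℝ) (G1 : V3 → V3 →L[ℝ] ℝ) (G2 : V3 → V3 →L[ℝ] V3 →L[ℝ] ℝ)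
    (H : V3 → Mat3) : Prop where
  op : IsOpen Ω
  d1 : ∀ y ∈ Ω, HasFDerivAt f (G1 y) y
  d2 : ∀ y ∈ Ω, HasFDerivAt G1 (G2 y) y
  eq : ∀ y ∈ Ω, ∀ i j, H y i j = G2 y (esingle i) (esingle j)

lemma C2D_of {Ω : Set V3} (hΩ : IsOpen Ω) {f : V3 → ℝ} (hf : ContDiffOn ℝ 2 f Ω) :
    C2D Ω f (fderiv ℝ f) (fderiv ℝ (fderiv ℝ f)) (hessW f Ω) where
  op := hΩ
  d1 := fun y hy => ((hf.differentiableOn (by norm_num)).differentiableAt (hΩ.mem_nhds hy)).hasFDerivAt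
  d2 := fun y hy => by
    have : ContDiffOn ℝ 1 (fderiv ℝ f) Ω := hf.fderiv_of_isOpen hΩ (by norm_num)
    exact ((this.differentiableOn (by norm_num)).differentiableAt (hΩ.mem_nhds hy)).hasFDerivAt
  eq := fun y hy i j => by
    unfold hessW
    rw [iteratedFDerivWithin_of_isOpen 2 hΩ hy, iteratedFDeriv_two_apply]
    simp

lemma vec_sum (b : V3) : b = ∑ i, b i • esingle i := by
  ext j
  simp [esingle, Finset.sum_apply, Pi.single_apply]

lemma C2D.quad {Ω f G1 G2 H} (h : C2D Ω f G1 G2 H) {y : V3} (hy : y ∈ Ω) (b : V3) :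
    G2 y b b = quadForm (H y) b := by
  conv_lhs => rw [vec_sum b]
  simp only [map_sum, map_smul, sum_apply, smul_apply,
    quadForm, bilin, h.eq y hy, smul_eq_mul, Finset.mul_sum]
  rw [Finset.sum_comm]
  apply Finset.sum_congr rfl
  intro i _
  apply Finset.sum_congr rfl
  intro j _
  ring

lemma C2D.line {Ω f G1 G2 H} (h : C2D Ω f G1 G2 H) (y b : V3) (s : ℝ) (hy : y + s • b ∈ Ω) :
    HasDerivAt (fun s : ℝ => f (y + s • b)) (G1 (y + s • b) b) s := by
  have hl : HasDerivAt (fun s : ℝ => y + s • b) b s := by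
    simpa using ((hasDerivAt_id s).smul_const b).const_add y
  exact (h.d1 _ hy).comp_hasDerivAt s hl

lemma C2D.line2 {Ω f G1 G2 H} (h : C2D Ω f G1 G2 H) (y b b' : V3) (s : ℝ) (hy : y + s • b ∈ Ω) :
    HasDerivAt (fun s : ℝ => G1 (y + s • b) b') (G2 (y + s • b) b b') s := by
  have hl : HasDerivAt (fun s : ℝ => y + s • b) b s := by
    simpa using ((hasDerivAt_id s).smul_const b).const_add y
  have h1 := (h.d2 _ hy).comp_hasDerivAt s hl
  simpa using h1.clm_apply (hasDerivAt_const s b')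

lemma C2D.sec {Ω f G1 G2 H} (h : C2D Ω f G1 G2 H) {y : V3} (hy : y ∈ Ω) (b : V3) :
    Tendsto (fun s : ℝ => (f (y + s • b) + f (y - s • b) - 2 * f y) / s ^ 2) (𝓝[>] 0)
      (𝓝 (quadForm (H y) b)) := by
  rw [← h.quad hy]
  have hc : Tendsto (fun s : ℝ => y + s • b) (𝓝 0) (𝓝 y) := by
    have : Tendsto (fun s : ℝ => y + s • b) (𝓝 0) (𝓝 (y + (0:ℝ) • b)) := by
      apply Continuous.tendsto; fun_prop
    simpa using this
  have h1 : ∀ᶠ s in 𝓝 (0:ℝ), HasDerivAt (fun s : ℝ => f (y + s • b)) (G1 (y + s • b) b) s := by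
    filter_upwards [hc.eventually (h.op.mem_nhds hy)] with s hs
    exact h.line y b s hs
  have h2 := h.line2 y b b 0 (by simpa using hy)
  have := symdiff h1 h2
  simpa [sub_eq_add_neg] using this

lemma norm_es (i : Fin 3) : ‖esingle i‖ = 1 := by simp [esingle]

lemma norm_smul_es (a : ℝ) (i : Fin 3) : ‖a • esingle i‖ = |a| := by
  rw [norm_smul, norm_es, mul_one, Real.norm_eq_abs]

lemma mvt {φ φ' : ℝ → ℝ} {a b : ℝ} (hab : a < b) (h : ∀ s ∈ Set.Icc a b, HasDerivAt φ (φ' s) s) :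
    ∃ c ∈ Set.Icc a b, φ b - φ a = (b - a) * φ' c := by
  obtain ⟨c, hc, he⟩ := exists_hasDerivAt_eq_slope φ φ' hab
    (fun s hs => (h s hs).continuousAt.continuousWithinAt) (fun s hs => h s ⟨hs.1.le, hs.2.le⟩)
  refine ⟨c, ⟨hc.1.le, hc.2.le⟩, ?_⟩
  rw [he]
  have : b - a ≠ 0 := by linarith
  field_simp

lemma C2D.dd {Ω f G1 G2 H} (h : C2D Ω f G1 G2 H) (y : V3) (a b : ℝ) (ha : 0 < a) (hb : 0 < b)
    (i j : Fin 3) (hΩ : ∀ z, ‖z - y‖ ≤ a + b → z ∈ Ω) :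
    ∃ z, ‖z - y‖ ≤ a + b ∧
      f (y + a • esingle i + b • esingle j) - f (y + a • esingle i - b • esingle j)
      - f (y - a • esingle i + b • esingle j) + f (y - a • esingle i - b • esingle j)
      = 4 * a * b * H z i j := by
  have hmem : ∀ s τ : ℝ, |s| ≤ a → |τ| ≤ b →
      ‖y + s • esingle i + τ • esingle j - y‖ ≤ a + b := by
    intro s τ hs ht
    rw [show y + s • esingle i + τ • esingle j - y = s • esingle i + τ • esingle j by abel]
    refine (norm_add_le _ _).trans ?_
    rw [norm_smul_es, norm_smul_es]
    linarith
  have hm' : ∀ s τ : ℝ, |s| ≤ a → |τ| ≤ b → y + s • esingle i + τ • esingle j ∈ Ω :=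
    fun s τ hs ht => hΩ _ (hmem s τ hs ht)
  obtain ⟨ξ, hξ, e1⟩ := mvt (φ := fun s : ℝ => f ((y + a • esingle i) + s • esingle j)
      - f ((y + (-a) • esingle i) + s • esingle j))
    (φ' := fun s => G1 ((y + a • esingle i) + s • esingle j) (esingle j)
      - G1 ((y + (-a) • esingle i) + s • esingle j) (esingle j)) (a := -b) (b := b) (by linarith)
    (fun s hs => (h.line _ _ _ (hm' a s (by rw [abs_of_pos ha]) (abs_le.2 hs))).sub
      (h.line _ _ _ (hm' (-a) s (by rw [abs_neg, abs_of_pos ha]) (abs_le.2 hs))))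
  have hsw : ∀ s : ℝ, y + ξ • esingle j + s • esingle i = y + s • esingle i + ξ • esingle j := by
    intro s; abel
  obtain ⟨η, hη, e2⟩ := mvt (φ := fun s : ℝ => G1 ((y + ξ • esingle j) + s • esingle i) (esingle j))
    (φ' := fun s => G2 ((y + ξ • esingle j) + s • esingle i) (esingle i) (esingle j))
    (a := -a) (b := a) (by linarith)
    (fun s hs => h.line2 _ _ _ _ (by rw [hsw]; exact hm' s ξ (abs_le.2 hs) (abs_le.2 hξ)))
  refine ⟨y + ξ • esingle j + η • esingle i, ?_, ?_⟩
  · rw [hsw]; exact hmem η ξ (abs_le.2 hη) (abs_le.2 hξ)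
  · rw [h.eq _ (by rw [hsw]; exact hm' η ξ (abs_le.2 hη) (abs_le.2 hξ))]
    simp only [hsw] at e2 ⊢
    simp only [neg_smul, ← sub_eq_add_neg] at e1 e2
    rw [e2] at e1
    linarith

lemma C2D.shift {Ω f G1 G2 H} (h : C2D Ω f G1 G2 H) (l : V3) :
    C2D {y | y + l ∈ Ω ∧ y - l ∈ Ω} (fun y => f (y + l) - f (y - l))
      (fun y => G1 (y + l) - G1 (y - l)) (fun y => G2 (y + l) - G2 (y - l))
      (fun y => H (y + l) - H (y - l)) where
  op := (h.op.preimage (by fun_prop : Continuous fun y : V3 => y + l)).inter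
    (h.op.preimage (by fun_prop : Continuous fun y : V3 => y - l))
  d1 := fun y hy => by
    have h1 := (h.d1 _ hy.1).comp y ((hasFDerivAt_id y).add_const l)
    have h2 := (h.d1 _ hy.2).comp y ((hasFDerivAt_id y).sub_const l)
    exact h1.sub h2
  d2 := fun y hy => by
    have h1 := (h.d2 _ hy.1).comp y ((hasFDerivAt_id y).add_const l)
    have h2 := (h.d2 _ hy.2).comp y ((hasFDerivAt_id y).sub_const l)
    exact h1.sub h2
  eq := fun y hy i j => by
    simp [h.eq _ hy.1, h.eq _ hy.2]

lemma C2D.D3eq {Ω f G1 G2 H} (h : C2D Ω f G1 G2 H) (x : V3) (a b : ℝ) (ha : 0 < a) (hb : 0 < b)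
    (l : V3) (i j : Fin 3) (hΩ : ∀ z, ‖z - x‖ ≤ a + b + ‖l‖ → z ∈ Ω) :
    ∃ z, ‖z - x‖ ≤ a + b ∧
      D3 f x (a • esingle i) (b • esingle j) l = 4 * a * b * (H (z + l) i j - H (z - l) i j) := by
  obtain ⟨z, hz, he⟩ := (h.shift l).dd x a b ha hb i j (by
    intro z hz
    constructor
    · apply hΩ
      rw [show z + l - x = (z - x) + l by abel]
      exact (norm_add_le _ _).trans (by linarith)
    · apply hΩ
      rw [show z - l - x = (z - x) - l by abel]
      exact (norm_sub_le _ _).trans (by linarith))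
  refine ⟨z, hz, ?_⟩
  simp only [Matrix.sub_apply] at he
  rw [← he]
  unfold D3
  ring

lemma abc_ineq {a b c α : ℝ} (ha : 0 < a) (hb : 0 < b) (hac : a ≤ c) (hbc : b ≤ c) (h1 : α < 1) :
    a * b * c ^ α ≤ (a * b * c) ^ ((2 + α) / 3) := by
  have hc : 0 < c := by linarith
  set β := (2 + α) / 3 with hβ
  have hβ1 : 0 ≤ 1 - β := by rw [hβ]; linarith
  have e : ∀ x : ℝ, 0 < x → x = x ^ β * x ^ (1 - β) := by
    intro x hx
    rw [← Real.rpow_add hx]; simp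
  have ia : a ≤ a ^ β * c ^ (1 - β) := by
    conv_lhs => rw [e a ha]
    gcongr
  have ib : b ≤ b ^ β * c ^ (1 - β) := by
    conv_lhs => rw [e b hb]
    gcongr
  rw [Real.mul_rpow (by positivity) hc.le, Real.mul_rpow ha.le hb.le]
  have ec : c ^ β = c ^ (1 - β) * c ^ (1 - β) * c ^ α := by
    rw [← Real.rpow_add hc, ← Real.rpow_add hc]; congr 1; rw [hβ]; ring
  calc a * b * c ^ α ≤ (a ^ β * c ^ (1 - β)) * (b ^ β * c ^ (1 - β)) * c ^ α := by gcongr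
    _ = a ^ β * b ^ β * c ^ β := by rw [ec]; ring

lemma C2D.D3le1 {Ω f G1 G2 H} (h : C2D Ω f G1 G2 H) (x : V3) (a b c N α ρ : ℝ) (ha : 0 < a)
    (hb : 0 < b) (hac : a ≤ c) (hbc : b ≤ c) (h0 : 0 < α) (h1 : α < 1) (i j k : Fin 3) (hρ : a + b + c ≤ ρ)
    (hN : 0 ≤ N)
    (hΩ : ∀ z, ‖z - x‖ ≤ ρ → z ∈ Ω)
    (hH : ∀ y z, ‖y - x‖ ≤ ρ → ‖z - x‖ ≤ ρ → ∀ i j, |H y i j - H z i j| ≤ N * ‖y - z‖ ^ α) :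
    |D3 f x (a • esingle i) (b • esingle j) (c • esingle k)| ≤ 8 * N * (a * b * c) ^ ((2 + α) / 3) := by
  have hc : 0 < c := by linarith
  have hcn : ‖c • esingle k‖ = c := by rw [norm_smul_es, abs_of_pos hc]
  obtain ⟨z, hz, he⟩ := h.D3eq x a b ha hb (c • esingle k) i j (fun z hz => hΩ z (by
    rw [hcn] at hz; linarith))
  rw [he, abs_mul, abs_of_pos (by positivity : 0 < 4 * a * b)]
  have h2 := hH (z + c • esingle k) (z - c • esingle k)
    (by rw [show z + c • esingle k - x = (z - x) + c • esingle k by abel]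
        exact (norm_add_le _ _).trans (by linarith))
    (by rw [show z - c • esingle k - x = (z - x) - c • esingle k by abel]
        exact (norm_sub_le _ _).trans (by linarith)) i j
  rw [show z + c • esingle k - (z - c • esingle k) = (2 * c) • esingle k by
    rw [mul_smul, two_smul]; abel, norm_smul_es, abs_of_pos (by positivity : 0 < 2 * c),
    Real.mul_rpow (by norm_num) hc.le] at h2
  have h3 : (2:ℝ) ^ α ≤ 2 := by
    calc (2:ℝ) ^ α ≤ 2 ^ (1:ℝ) := Real.rpow_le_rpow_of_exponent_le (by norm_num) h1.le
      _ = 2 := by simp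
  have h4 := abc_ineq ha hb hac hbc h1
  have hcα : 0 < c ^ α := by positivity
  calc 4 * a * b * |H (z + c • esingle k) i j - H (z - c • esingle k) i j|
      ≤ 4 * a * b * (N * (2 ^ α * c ^ α)) := by gcongr
    _ ≤ 4 * a * b * (N * (2 * c ^ α)) := by gcongr
    _ = 8 * N * (a * b * c ^ α) := by ring
    _ ≤ _ := by gcongr

lemma C2D.D3le {Ω f G1 G2 H} (h : C2D Ω f G1 G2 H) (x : V3) (a b c N α ρ : ℝ) (ha : 0 < a)
    (hb : 0 < b) (hc : 0 < c) (h0 : 0 < α) (h1 : α < 1) (i j k : Fin 3) (hρ : a + b + c ≤ ρ)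
    (hN : 0 ≤ N)
    (hΩ : ∀ z, ‖z - x‖ ≤ ρ → z ∈ Ω)
    (hH : ∀ y z, ‖y - x‖ ≤ ρ → ‖z - x‖ ≤ ρ → ∀ i j, |H y i j - H z i j| ≤ N * ‖y - z‖ ^ α) :
    |D3 f x (a • esingle i) (b • esingle j) (c • esingle k)| ≤ 8 * N * (a * b * c) ^ ((2 + α) / 3) := by
  by_cases hcm : a ≤ c ∧ b ≤ c
  · exact h.D3le1 x a b c N α ρ ha hb hcm.1 hcm.2 h0 h1 i j k hρ hN hΩ hH
  by_cases hbm : a ≤ b ∧ c ≤ b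
  · rw [D3_swap23, show a * b * c = a * c * b by ring]
    exact h.D3le1 x a c b N α ρ ha hc hbm.1 hbm.2 h0 h1 i k j (by linarith) hN hΩ hH
  · have hba : b ≤ a := by
      by_contra hh; push Not at hh hcm hbm
      have := hbm hh.le
      have := hcm (by linarith)
      linarith
    have hca : c ≤ a := by
      by_contra hh; push Not at hh hcm hbm
      have := hcm hh.le
      linarith
    rw [D3_swap12, D3_swap23, show a * b * c = b * c * a by ring]
    exact h.D3le1 x b c a N α ρ hb hc hba hca h0 h1 j k i (by linarith) hN hΩ hH

/-- interpolation for second derivatives -/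
lemma C2D.interp {Ω f G1 G2 H} (h : C2D Ω f G1 G2 H) (y : V3) (ε M N α : ℝ) (hε : 0 < ε)
    (h0 : 0 < α) (hN : 0 ≤ N) (hΩ : ∀ z, ‖z - y‖ ≤ 2 * ε → z ∈ Ω)
    (hM : ∀ z, ‖z - y‖ ≤ 2 * ε → |f z| ≤ M)
    (hH : ∀ z, ‖z - y‖ ≤ 2 * ε → ∀ i j, |H y i j - H z i j| ≤ N * ‖y - z‖ ^ α) (i j : Fin 3) :
    |H y i j| ≤ M / ε ^ 2 + N * (2 * ε) ^ α := by
  obtain ⟨z, hz, he⟩ := h.dd y ε ε hε hε i j (fun z hz => hΩ z (by linarith))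
  have hz' : ‖z - y‖ ≤ 2 * ε := by linarith
  have h1 := hH z hz' i j
  have h2 : N * ‖y - z‖ ^ α ≤ N * (2 * ε) ^ α := by
    rw [norm_sub_rev]; gcongr
  have key : ∀ a b : V3, ‖a‖ ≤ ε → ‖b‖ ≤ ε → |f (y + a + b)| ≤ M := by
    intro a b ha hb
    apply hM
    rw [show y + a + b - y = a + b by abel]
    exact (norm_add_le _ _).trans (by linarith)
  have n1 : ∀ i, ‖ε • esingle i‖ ≤ ε := fun i => by rw [norm_smul_es, abs_of_pos hε]
  have n2 : ∀ i, ‖-(ε • esingle i)‖ ≤ ε := fun i => by rw [norm_neg, norm_smul_es, abs_of_pos hε]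
  have k1 := abs_le.1 (key _ _ (n1 i) (n1 j))
  have k2 := abs_le.1 (key _ _ (n1 i) (n2 j))
  have k3 := abs_le.1 (key _ _ (n2 i) (n1 j))
  have k4 := abs_le.1 (key _ _ (n2 i) (n2 j))
  simp only [← sub_eq_add_neg] at k1 k2 k3 k4
  have h3 : |4 * ε * ε * H z i j| ≤ 4 * M := by
    rw [← he, abs_le]
    constructor <;> linarith [k1.1, k1.2, k2.1, k2.2, k3.1, k3.2, k4.1, k4.2]
  rw [abs_mul, abs_of_pos (by positivity : 0 < 4 * ε * ε)] at h3
  have h4 : |H z i j| ≤ M / ε ^ 2 := by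
    rw [le_div_iff₀ (by positivity)]
    nlinarith
  calc |H y i j| = |H z i j + (H y i j - H z i j)| := by congr 1; ring
    _ ≤ |H z i j| + |H y i j - H z i j| := abs_add_le _ _
    _ ≤ _ := by linarith

lemma abs_coord_le (b : V3) (i : Fin 3) : |b i| ≤ ‖b‖ := by
  simpa using PiLp.norm_apply_le b i

lemma quad_le (A : Mat3) (B : ℝ) (hA : ∀ i j, |A i j| ≤ B) (b : V3) : |quadForm A b| ≤ 9 * B * ‖b‖ ^ 2 := by
  have hB : 0 ≤ B := (abs_nonneg _).trans (hA 0 0)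
  unfold quadForm bilin
  calc |∑ i, ∑ j, A i j * b i * b j| ≤ ∑ i : Fin 3, ∑ j : Fin 3, B * ‖b‖ * ‖b‖ := by
        refine (Finset.abs_sum_le_sum_abs _ _).trans (Finset.sum_le_sum fun i _ => ?_)
        refine (Finset.abs_sum_le_sum_abs _ _).trans (Finset.sum_le_sum fun j _ => ?_)
        rw [abs_mul, abs_mul]
        have := abs_coord_le b i
        have := abs_coord_le b j
        have := hA i j
        gcongr
    _ = 9 * B * ‖b‖ ^ 2 := by simp; ring

/-- Hölder bound for f by interpolation -/
lemma C2D.holder {Ω f G1 G2 H} (h : C2D Ω f G1 G2 H) (x : V3) (ρ ε M Hb α : ℝ) (hε : 0 < ε)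
    (h0 : 0 < α) (h1 : α < 1) (hM0 : 0 ≤ M) (hHb0 : 0 ≤ Hb)
    (hΩ : ∀ z, ‖z - x‖ ≤ ρ + ε → z ∈ Ω)
    (hM : ∀ z, ‖z - x‖ ≤ ρ + ε → |f z| ≤ M)
    (hH : ∀ z, ‖z - x‖ ≤ ρ + ε → ∀ i j, |H z i j| ≤ Hb) (y z : V3) (hy : ‖y - x‖ ≤ ρ)
    (hz : ‖z - x‖ ≤ ρ) :
    |f y - f z| ≤ (2 * M * ε ^ (-α) + 9 * ε ^ (2 - α) * Hb) * ‖y - z‖ ^ α := by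
  have My := abs_le.1 (hM y (by linarith))
  have Mz := abs_le.1 (hM z (by linarith))
  have hεα : ε ^ (-α) * ε ^ α = 1 := by rw [← Real.rpow_add hε]; simp
  rcases le_or_gt ‖y - z‖ ε with hs | hs
  swap
  · have a1 : |f y - f z| ≤ 2 * M := by rw [abs_le]; constructor <;> linarith [My.1, My.2, Mz.1, Mz.2]
    have a2 : ε ^ α ≤ ‖y - z‖ ^ α := by gcongr
    have a3 : 1 ≤ ε ^ (-α) * ‖y - z‖ ^ α := by rw [← hεα]; gcongr
    have a4 : 0 ≤ 9 * ε ^ (2 - α) * Hb * ‖y - z‖ ^ α := by positivity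
    nlinarith
  rcases eq_or_ne y z with rfl | hne
  · simp; positivity
  set s := ‖y - z‖ with hsd
  have hs0 : 0 < s := by rw [hsd]; exact norm_pos_iff.2 (sub_ne_zero.2 hne)
  set b : V3 := s⁻¹ • (z - y) with hb
  have hbn : ‖b‖ = 1 := by
    rw [hb, norm_smul, norm_sub_rev, ← hsd, norm_inv, Real.norm_of_nonneg hs0.le, inv_mul_cancel₀ hs0.ne']
  have hzb : y + s • b = z := by
    rw [hb, smul_smul, mul_inv_cancel₀ hs0.ne', one_smul]; abel
  have hin : ∀ t ∈ Set.Icc (0:ℝ) ε, ‖y + t • b - x‖ ≤ ρ + ε := by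
    intro t ht
    rw [show y + t • b - x = (y - x) + t • b by abel]
    refine (norm_add_le _ _).trans ?_
    rw [norm_smul, hbn, Real.norm_of_nonneg ht.1]
    linarith [ht.2]
  have hl : ∀ t ∈ Set.Icc (0:ℝ) ε, HasDerivAt (fun s : ℝ => f (y + s • b)) (G1 (y + t • b) b) t :=
    fun t ht => h.line y b t (hΩ _ (hin t ht))
  have hl2 : ∀ t ∈ Set.Icc (0:ℝ) ε, HasDerivAt (fun s : ℝ => G1 (y + s • b) b) (G2 (y + t • b) b b) t :=
    fun t ht => h.line2 y b b t (hΩ _ (hin t ht))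
  have hq : ∀ t ∈ Set.Icc (0:ℝ) ε, |G2 (y + t • b) b b| ≤ 9 * Hb := by
    intro t ht
    rw [h.quad (hΩ _ (hin t ht))]
    have := quad_le _ Hb (hH _ (hin t ht)) b
    rwa [hbn, one_pow, mul_one] at this
  obtain ⟨ξ, hξ, e1⟩ := mvt hs0 (fun t ht => hl t ⟨ht.1, ht.2.trans hs⟩)
  obtain ⟨η, hη, e2⟩ := mvt hε hl
  have hξ' : ξ ∈ Set.Icc 0 ε := ⟨hξ.1, hξ.2.trans hs⟩
  have e3 : |G1 (y + ξ • b) b - G1 (y + η • b) b| ≤ 9 * Hb * |ξ - η| := by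
    have := Convex.norm_image_sub_le_of_norm_hasDerivWithin_le (𝕜 := ℝ) (C := 9 * Hb)
      (f := fun s : ℝ => G1 (y + s • b) b) (f' := fun t => G2 (y + t • b) b b)
      (s := Set.Icc 0 ε) (x := η) (y := ξ) (fun t ht => (hl2 t ht).hasDerivWithinAt)
      (fun t ht => by rw [Real.norm_eq_abs]; exact hq t ht) (convex_Icc _ _) hη hξ'
    simpa [Real.norm_eq_abs] using this
  have e4 : |ξ - η| ≤ ε := by rw [abs_le]; constructor <;> linarith [hξ'.1, hξ'.2, hη.1, hη.2]
  have Me := abs_le.1 (hM _ (hin ε ⟨hε.le, le_rfl⟩))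
  simp only [zero_smul, add_zero, hzb, sub_zero] at e1 e2
  have e5 : |G1 (y + η • b) b| ≤ 2 * M / ε := by
    rw [le_div_iff₀ hε, ← abs_of_pos hε, ← abs_mul, mul_comm, ← e2, abs_le]
    constructor <;> linarith [My.1, My.2, Me.1, Me.2]
  have e6 : |G1 (y + ξ • b) b| ≤ 2 * M / ε + 9 * Hb * ε := by
    calc |G1 (y + ξ • b) b| = |G1 (y + η • b) b + (G1 (y + ξ • b) b - G1 (y + η • b) b)| := by
          congr 1; ring
      _ ≤ |G1 (y + η • b) b| + |G1 (y + ξ • b) b - G1 (y + η • b) b| := abs_add_le _ _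
      _ ≤ 2 * M / ε + 9 * Hb * |ξ - η| := by linarith
      _ ≤ _ := by gcongr
  rw [abs_sub_comm, e1, abs_mul, abs_of_pos hs0]
  have e7 : s ≤ ε ^ (1 - α) * s ^ α := by
    calc s = s ^ (1 - α) * s ^ α := by rw [← Real.rpow_add hs0]; simp
      _ ≤ _ := by gcongr
  calc s * |G1 (y + ξ • b) b| ≤ (ε ^ (1 - α) * s ^ α) * (2 * M / ε + 9 * Hb * ε) := by gcongr
    _ = _ := by
      rw [show (2 - α) = (1 - α) + 1 by ring, show -α = (1 - α) - 1 by ring, Real.rpow_add hε,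
        Real.rpow_sub hε (1 - α) 1, Real.rpow_one]
      field_simp

def bar (β K S r : ℝ) (x1 x : V3) (a b c : ℝ) : ℝ :=
  (a * b * c) ^ β * (K + S * (‖x - x1‖ ^ 2 + a ^ 2 + b ^ 2 + c ^ 2) / r ^ 2)

lemma bar_swap12 (β K S r : ℝ) (x1 x : V3) (a b c : ℝ) :
    bar β K S r x1 x a b c = bar β K S r x1 x b a c := by
  unfold bar
  rw [show a * b * c = b * a * c by ring,
    show ‖x - x1‖ ^ 2 + a ^ 2 + b ^ 2 + c ^ 2 = ‖x - x1‖ ^ 2 + b ^ 2 + a ^ 2 + c ^ 2 by ring]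

lemma bar_swap23 (β K S r : ℝ) (x1 x : V3) (a b c : ℝ) :
    bar β K S r x1 x a b c = bar β K S r x1 x a c b := by
  unfold bar
  rw [show a * b * c = a * c * b by ring,
    show ‖x - x1‖ ^ 2 + a ^ 2 + b ^ 2 + c ^ 2 = ‖x - x1‖ ^ 2 + a ^ 2 + c ^ 2 + b ^ 2 by ring]

lemma psd_decomp (M : Mat3) (hs : M.IsSymm) (l0 : ℝ) (i : Fin 3) (hl : 0 ≤ l0)
    (hM : ∀ ξ : V3, l0 * ‖ξ‖ ^ 2 ≤ quadForm M ξ) :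
    ∃ (n : ℕ) (v : Fin n → V3), (∀ H : Mat3, matDot M H = l0 * H i i + ∑ m, quadForm H (v m)) ∧
      ∑ m, ‖v m‖ ^ 2 = M.trace - l0 := by
  set P : Mat3 := M - l0 • Matrix.single i i 1 with hP
  have hquad : ∀ ξ : V3, quadForm M ξ = ∑ a, ∑ b, M a b * ξ a * ξ b := fun ξ => rfl
  have hpsd : P.PosSemidef := by
    refine Matrix.PosSemidef.of_dotProduct_mulVec_nonneg ?_ ?_
    · rw [Matrix.IsHermitian, Matrix.conjTranspose_eq_transpose_of_trivial, hP, Matrix.transpose_sub,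
        hs.eq, Matrix.transpose_smul, Matrix.transpose_single]
    · intro x
      have h1 := hM (WithLp.toLp 2 x)
      rw [hquad] at h1
      rw [EuclideanSpace.norm_sq_eq] at h1
      have h2 : star x ⬝ᵥ P.mulVec x = (∑ a, ∑ b, M a b * x a * x b) - l0 * (x i) ^ 2 := by
        fin_cases i <;> simp [hP, dotProduct, Matrix.mulVec, Fin.sum_univ_three, Matrix.single] <;> ring
      rw [h2]
      have h3 : (x i) ^ 2 ≤ ∑ a, ‖(WithLp.toLp 2 x : V3) a‖ ^ 2 := by
        have := Finset.single_le_sum (f := fun a => ‖(WithLp.toLp 2 x : V3) a‖ ^ 2)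
          (fun a _ => by positivity) (Finset.mem_univ i)
        simpa using this
      have h4 := mul_le_mul_of_nonneg_left h3 hl
      simp only at h1
      linarith
  obtain ⟨n, v, hv⟩ := Matrix.posSemidef_iff_eq_sum_vecMulVec.1 hpsd
  have hMe : ∀ a b, M a b = l0 * (Matrix.single i i (1:ℝ) a b) + ∑ m, v m a * v m b := by
    intro a b
    have h1 : P a b = ∑ m, v m a * v m b := by
      rw [hv, Matrix.sum_apply]; simp [Matrix.vecMulVec_apply]
    rw [← h1, hP, Matrix.sub_apply, Matrix.smul_apply, smul_eq_mul]; ring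
  refine ⟨n, fun m => WithLp.toLp 2 (v m), ?_, ?_⟩
  · intro H
    unfold matDot quadForm bilin
    simp only [hMe, add_mul, Finset.sum_add_distrib, Finset.sum_mul]
    congr 1
    · fin_cases i <;> simp [Fin.sum_univ_three, Matrix.single]
    · rw [Finset.sum_congr rfl fun a _ => Finset.sum_comm, Finset.sum_comm]
      refine Finset.sum_congr rfl fun m _ => ?_
      refine Finset.sum_congr rfl fun a _ => Finset.sum_congr rfl fun b _ => ?_
      ring
  · have ht : M.trace = l0 + ∑ m, ∑ a, v m a * v m a := by
      rw [Finset.sum_comm, Matrix.trace]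
      simp only [Matrix.diag_apply, hMe, Finset.sum_add_distrib]
      congr 1
      fin_cases i <;> simp [Fin.sum_univ_three, Matrix.single]
    rw [ht, add_sub_cancel_left]
    refine Finset.sum_congr rfl fun m _ => ?_
    rw [EuclideanSpace.norm_sq_eq]
    simp [pow_two]

section core
variable (f : V3 → ℝ) (Hf : V3 → Mat3) (x0 x1 : V3) (β K S r a b c : ℝ) (i : Fin 3) (h2 h3 : V3)

lemma corex (b' : V3)
    (hsec : ∀ y, ‖y - x0‖ ≤ ‖a • esingle i‖ + ‖h2‖ + ‖h3‖ → ∀ b' : V3,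
      Tendsto (fun s : ℝ => (f (y + s • b') + f (y - s • b') - 2 * f y) / s ^ 2) (𝓝[>] 0)
      (𝓝 (quadForm (Hf y) b')))
    (hx : ∀ᶠ s in 𝓝[>] (0:ℝ),
      D3 f (x0 + s • b') (a • esingle i) h2 h3 - bar β K S r x1 (x0 + s • b') a b c ≤
        D3 f x0 (a • esingle i) h2 h3 - bar β K S r x1 x0 a b c ∧
      D3 f (x0 - s • b') (a • esingle i) h2 h3 - bar β K S r x1 (x0 - s • b') a b c ≤
        D3 f x0 (a • esingle i) h2 h3 - bar β K S r x1 x0 a b c) :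
    D3 (fun y => quadForm (Hf y) b') x0 (a • esingle i) h2 h3 ≤
      (a * b * c) ^ β * (2 * S / r ^ 2) * ‖b'‖ ^ 2 := by
  have ht := D3_tendsto (L := 𝓝[>] (0:ℝ))
    (fun s y => (f (y + s • b') + f (y - s • b') - 2 * f y) / s ^ 2) _ x0 _ _ _
    (fun y hy => hsec y hy b')
  refine le_of_tendsto ht ?_
  filter_upwards [hx, self_mem_nhdsWithin] with s hs hs0
  have hs0 : (0:ℝ) < s := hs0
  have e1 : D3 (fun y => (f (y + s • b') + f (y - s • b') - 2 * f y) / s ^ 2) x0 (a • esingle i) h2 h3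
      = (D3 f (x0 + s • b') (a • esingle i) h2 h3 + D3 f (x0 - s • b') (a • esingle i) h2 h3
        - 2 * D3 f x0 (a • esingle i) h2 h3) / s ^ 2 := by
    have e : ∀ p q w z : V3, x0 + p + q + w + z = x0 + z + p + q + w := by intros; abel
    unfold D3
    simp only [sub_eq_add_neg, e _ _ _ (s • b'), e _ _ _ (-(s • b'))]
    ring
  have e2 : bar β K S r x1 (x0 + s • b') a b c + bar β K S r x1 (x0 - s • b') a b c
      - 2 * bar β K S r x1 x0 a b c = (a * b * c) ^ β * (2 * S / r ^ 2) * ‖b'‖ ^ 2 * s ^ 2 := by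
    have p := parallelogram_law_with_norm ℝ (x0 - x1) (s • b')
    rw [norm_smul, Real.norm_of_nonneg hs0.le] at p
    unfold bar
    rw [show x0 + s • b' - x1 = x0 - x1 + s • b' by abel,
      show x0 - s • b' - x1 = x0 - x1 - s • b' by abel]
    have p' : ‖x0 - x1 + s • b'‖ ^ 2 = 2 * (‖x0 - x1‖ ^ 2 + (s * ‖b'‖) ^ 2)
      - ‖x0 - x1 - s • b'‖ ^ 2 := by linarith
    rw [p']
    ring
  rw [e1, div_le_iff₀ (by positivity), ← e2]
  linarith [hs.1, hs.2]

lemma corea (ha : 0 < a) (hb : 0 < b) (hc : 0 < c)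
    (hsec : ∀ y, ‖y - x0‖ ≤ ‖a • esingle i‖ + ‖h2‖ + ‖h3‖ → ∀ b' : V3,
      Tendsto (fun s : ℝ => (f (y + s • b') + f (y - s • b') - 2 * f y) / s ^ 2) (𝓝[>] 0)
      (𝓝 (quadForm (Hf y) b')))
    (hx : ∀ᶠ s in 𝓝[>] (0:ℝ),
      D3 f x0 ((a + s) • esingle i) h2 h3 - bar β K S r x1 x0 (a + s) b c ≤
        D3 f x0 (a • esingle i) h2 h3 - bar β K S r x1 x0 a b c ∧
      D3 f x0 ((a - s) • esingle i) h2 h3 - bar β K S r x1 x0 (a - s) b c ≤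
        D3 f x0 (a • esingle i) h2 h3 - bar β K S r x1 x0 a b c) :
    D3 (fun y => quadForm (Hf y) (esingle i)) x0 (a • esingle i) h2 h3 ≤
      (b * c) ^ β * ((K + S * (‖x0 - x1‖ ^ 2 + b ^ 2 + c ^ 2) / r ^ 2) * (β * ((β - 1) * a ^ (β - 2)))
        + S / r ^ 2 * ((β + 2) * ((β + 1) * a ^ β))) := by
  set K' := K + S * (‖x0 - x1‖ ^ 2 + b ^ 2 + c ^ 2) / r ^ 2 with hK'
  have ht := D3_tendsto (L := 𝓝[>] (0:ℝ))
    (fun s y => (f (y + s • esingle i) + f (y - s • esingle i) - 2 * f y) / s ^ 2) _ x0 _ _ _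
    (fun y hy => hsec y hy (esingle i))
  have hq : Tendsto (fun s => (bar β K S r x1 x0 (a + s) b c + bar β K S r x1 x0 (a - s) b c
      - 2 * bar β K S r x1 x0 a b c) / s ^ 2) (𝓝[>] 0)
      (𝓝 ((b * c) ^ β * (K' * (β * ((β - 1) * a ^ (β - 2)))
        + S / r ^ 2 * ((β + 2) * ((β + 1) * a ^ β))))) := by
    refine symdiff (q := fun a => bar β K S r x1 x0 a b c)
      (q1 := fun a => (b * c) ^ β * (K' * (β * a ^ (β - 1)) + S / r ^ 2 * ((β + 2) * a ^ (β + 1)))) ?_ ?_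
    · filter_upwards [lt_mem_nhds ha] with s hs
      have h1 : HasDerivAt (fun a : ℝ => (b * c) ^ β * (K' * a ^ β + S / r ^ 2 * a ^ (β + 2)))
          ((b * c) ^ β * (K' * (β * s ^ (β - 1)) + S / r ^ 2 * ((β + 2) * s ^ (β + 1)))) s := by
        have d1 := Real.hasDerivAt_rpow_const (x := s) (p := β) (Or.inl hs.ne')
        have d2 := Real.hasDerivAt_rpow_const (x := s) (p := β + 2) (Or.inl hs.ne')
        rw [show β + 2 - 1 = β + 1 by ring] at d2
        exact ((d1.const_mul K').add (d2.const_mul (S / r ^ 2))).const_mul _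
      refine h1.congr_of_eventuallyEq ?_
      filter_upwards [lt_mem_nhds hs] with z hz
      unfold bar
      rw [show z * b * c = (b * c) * z by ring, Real.mul_rpow (by positivity) hz.le,
        Real.rpow_add hz, hK', show (2:ℝ) = ((2:ℕ):ℝ) by norm_num, Real.rpow_natCast]
      ring
    · have d1 := Real.hasDerivAt_rpow_const (x := a) (p := β - 1) (Or.inl ha.ne')
      have d2 := Real.hasDerivAt_rpow_const (x := a) (p := β + 1) (Or.inl ha.ne')
      rw [show β + 1 - 1 = β by ring] at d2
      rw [show β - 1 - 1 = β - 2 by ring] at d1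
      exact (((d1.const_mul β).const_mul K').add ((d2.const_mul (β + 2)).const_mul (S / r ^ 2))).const_mul _
  refine le_of_tendsto_of_tendsto ht hq ?_
  filter_upwards [hx, self_mem_nhdsWithin] with s hs hs0
  have hs0 : (0:ℝ) < s := hs0
  have e1 : D3 (fun y => (f (y + s • esingle i) + f (y - s • esingle i) - 2 * f y) / s ^ 2) x0 (a • esingle i) h2 h3
      = (D3 f x0 ((a + s) • esingle i) h2 h3 + D3 f x0 ((a - s) • esingle i) h2 h3
        - 2 * D3 f x0 (a • esingle i) h2 h3) / s ^ 2 := by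
    have e : ∀ p q w z : V3, x0 + p + q + w + z = x0 + (p + z) + q + w := by intros; abel
    unfold D3
    simp only [sub_eq_add_neg, e _ _ _ (s • esingle i), e _ _ _ (-(s • esingle i)), add_smul, neg_smul, neg_add, neg_neg]
    ring
  show _ ≤ (bar β K S r x1 x0 (a + s) b c + bar β K S r x1 x0 (a - s) b c
      - 2 * bar β K S r x1 x0 a b c) / s ^ 2
  rw [e1]
  apply div_le_div_of_nonneg_right _ (by positivity)
  linarith [hs.1, hs.2]
end core

lemma final_real {a b c α β l0 L tr S K1 K' κ r Gm : ℝ} (hβ : β = (2 + α) / 3) (hα0 : 0 < α) (hα1 : α < 1)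
    (ha : 0 < a) (hab : a ≤ b) (hac : a ≤ c) (hκ : a ≤ κ * r) (hr : 0 < r) (hS : 0 ≤ S) (hK1 : 0 ≤ K1)
    (hK' : K1 ≤ K') (hl0 : 0 < l0) (hL : 0 ≤ L) (htr : tr ≤ 3 * L) (hGm : 0 ≤ Gm)
    (c1 : S * 6 * (l0 + L) * κ ^ 2 ≤ l0 * (β * (1 - β)) * K1 / 2)
    (c2 : Gm ≤ l0 * (β * (1 - β)) * K1 / 2) :
    l0 * ((b * c) ^ β * (K' * (β * ((β - 1) * a ^ (β - 2)))
        + S / r ^ 2 * ((β + 2) * ((β + 1) * a ^ β)))) + (a * b * c) ^ β * (2 * S / r ^ 2) * (tr - l0)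
      + Gm * a ^ α ≤ 0 := by
  have hb : 0 < b := by linarith
  have hc : 0 < c := by linarith
  have hβ0 : 0 < β := by rw [hβ]; linarith
  have hβ1 : β < 1 := by rw [hβ]; linarith
  have e1 : a ^ β = a ^ (β - 2) * a ^ 2 := by
    rw [← Real.rpow_natCast, ← Real.rpow_add ha]; congr 1; norm_num
  have e2 : (a * b * c) ^ β = (b * c) ^ β * (a ^ (β - 2) * a ^ 2) := by
    rw [show a * b * c = (b * c) * a by ring, Real.mul_rpow (by positivity) ha.le, e1]
  set E := (b * c) ^ β * a ^ (β - 2) with hE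
  have hE0 : 0 < E := by positivity
  have e3 : a ^ α ≤ E := by
    have : a ^ α = (a * a) ^ β * a ^ (β - 2) := by
      rw [Real.mul_rpow ha.le ha.le, ← Real.rpow_add ha, ← Real.rpow_add ha]; congr 1; rw [hβ]; ring
    rw [this, hE]
    gcongr
  have e4 : a ^ 2 / r ^ 2 ≤ κ ^ 2 := by
    rw [div_le_iff₀ (by positivity), ← mul_pow]
    gcongr
  rw [e2, e1]
  have e5 : l0 * ((b * c) ^ β * (K' * (β * ((β - 1) * a ^ (β - 2)))
        + S / r ^ 2 * ((β + 2) * ((β + 1) * (a ^ (β - 2) * a ^ 2))))) +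
        (b * c) ^ β * (a ^ (β - 2) * a ^ 2) * (2 * S / r ^ 2) * (tr - l0) + Gm * a ^ α
      = E * (-(l0 * (β * (1 - β)) * K') + S * (a ^ 2 / r ^ 2) * (l0 * ((β + 2) * (β + 1)) + 2 * (tr - l0)))
        + Gm * a ^ α := by
    rw [hE]; ring
  rw [e5]
  have f1 : l0 * ((β + 2) * (β + 1)) + 2 * (tr - l0) ≤ 6 * (l0 + L) := by
    have g1 : (β + 2) * (β + 1) ≤ 6 := by nlinarith
    have g2 := mul_le_mul_of_nonneg_left g1 hl0.le
    linarith
  have f2 : S * (a ^ 2 / r ^ 2) * (l0 * ((β + 2) * (β + 1)) + 2 * (tr - l0)) ≤ S * κ ^ 2 * (6 * (l0 + L)) := by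
    have : S * (a ^ 2 / r ^ 2) * (l0 * ((β + 2) * (β + 1)) + 2 * (tr - l0)) ≤
      S * (a ^ 2 / r ^ 2) * (6 * (l0 + L)) := by gcongr
    refine this.trans ?_
    gcongr
  have f3 : l0 * (β * (1 - β)) * K1 ≤ l0 * (β * (1 - β)) * K' := by
    have : 0 < 1 - β := by linarith
    gcongr
  have f4 : Gm * a ^ α ≤ Gm * E := by gcongr
  have f5 : -(l0 * (β * (1 - β)) * K') + S * (a ^ 2 / r ^ 2) * (l0 * ((β + 2) * (β + 1)) + 2 * (tr - l0)) + Gm ≤ 0 := by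
    nlinarith
  nlinarith

lemma quad_es (H : Mat3) (i : Fin 3) : quadForm H (esingle i) = H i i := by
  unfold quadForm bilin esingle
  fin_cases i <;> simp [Fin.sum_univ_three]

lemma matDot_split (A B H : Mat3) : matDot A H = matDot B H + matDot (A - B) H := by
  unfold matDot
  simp only [← Finset.sum_add_distrib, Matrix.sub_apply]
  refine Finset.sum_congr rfl fun i _ => Finset.sum_congr rfl fun j _ => ?_
  ring

lemma ev_pm {x0 : V3} {p : V3 → Prop} (h : ∀ᶠ x in 𝓝 x0, p x) (b : V3) :
    ∀ᶠ s in 𝓝[>] (0:ℝ), p (x0 + s • b) ∧ p (x0 - s • b) := by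
  have h1 : Tendsto (fun s : ℝ => x0 + s • b) (𝓝[>] 0) (𝓝 x0) := by
    have : Tendsto (fun s : ℝ => x0 + s • b) (𝓝 0) (𝓝 (x0 + (0:ℝ) • b)) := by
      apply Continuous.tendsto; fun_prop
    exact (by simpa using this : Tendsto (fun s : ℝ => x0 + s • b) (𝓝 0) (𝓝 x0)).mono_left
      nhdsWithin_le_nhds
  have h2 : Tendsto (fun s : ℝ => x0 - s • b) (𝓝[>] 0) (𝓝 x0) := by
    have : Tendsto (fun s : ℝ => x0 - s • b) (𝓝 0) (𝓝 (x0 - (0:ℝ) • b)) := by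
      apply Continuous.tendsto; fun_prop
    exact (by simpa using this : Tendsto (fun s : ℝ => x0 - s • b) (𝓝 0) (𝓝 x0)).mono_left
      nhdsWithin_le_nhds
  exact (h1.eventually h).and (h2.eventually h)

lemma ev_pm1 {x0 : ℝ} {p : ℝ → Prop} (h : ∀ᶠ x in 𝓝 x0, p x) :
    ∀ᶠ s in 𝓝[>] (0:ℝ), p (x0 + s) ∧ p (x0 - s) := by
  have h1 : Tendsto (fun s : ℝ => x0 + s) (𝓝[>] 0) (𝓝 x0) := by
    have : Tendsto (fun s : ℝ => x0 + s) (𝓝 0) (𝓝 (x0 + 0)) := by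
      apply Continuous.tendsto; fun_prop
    exact (by simpa using this : Tendsto (fun s : ℝ => x0 + s) (𝓝 0) (𝓝 x0)).mono_left
      nhdsWithin_le_nhds
  have h2 : Tendsto (fun s : ℝ => x0 - s) (𝓝[>] 0) (𝓝 x0) := by
    have : Tendsto (fun s : ℝ => x0 - s) (𝓝 0) (𝓝 (x0 - 0)) := by
      apply Continuous.tendsto; fun_prop
    exact (by simpa using this : Tendsto (fun s : ℝ => x0 - s) (𝓝 0) (𝓝 x0)).mono_left
      nhdsWithin_le_nhds
  exact (h1.eventually h).and (h2.eventually h)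

lemma finish {f g : V3 → ℝ} {A Hf : V3 → Mat3} {x0 x1 : V3} {α β l0 L S K1 κ r Gm a b c : ℝ}
    {i : Fin 3} {h2 h3 : V3} (hβ : β = (2 + α) / 3) (hα0 : 0 < α) (hα1 : α < 1)
    (ha : 0 < a) (hab : a ≤ b) (hac : a ≤ c) (hκ : a ≤ κ * r) (hr : 0 < r) (hS : 0 ≤ S) (hK1 : 0 ≤ K1)
    (hl0 : 0 < l0) (hL : 0 ≤ L) (hGm : 0 ≤ Gm)
    (c1 : S * 6 * (l0 + L) * κ ^ 2 ≤ l0 * (β * (1 - β)) * K1 / 2)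
    (c2 : Gm ≤ l0 * (β * (1 - β)) * K1 / 2)
    (hsym : (A x0).IsSymm) (hell : ∀ ξ : V3, l0 * ‖ξ‖ ^ 2 ≤ quadForm (A x0) ξ)
    (htr : (A x0).trace ≤ 3 * L)
    (hsec : ∀ y, ‖y - x0‖ ≤ ‖a • esingle i‖ + ‖h2‖ + ‖h3‖ → ∀ b' : V3,
      Tendsto (fun s : ℝ => (f (y + s • b') + f (y - s • b') - 2 * f y) / s ^ 2) (𝓝[>] 0)
      (𝓝 (quadForm (Hf y) b')))
    (hx : ∀ᶠ x in 𝓝 x0, D3 f x (a • esingle i) h2 h3 - bar β K1 S r x1 x a b c ≤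
        D3 f x0 (a • esingle i) h2 h3 - bar β K1 S r x1 x0 a b c)
    (hxa : ∀ᶠ s in 𝓝 a, D3 f x0 (s • esingle i) h2 h3 - bar β K1 S r x1 x0 s b c ≤
        D3 f x0 (a • esingle i) h2 h3 - bar β K1 S r x1 x0 a b c)
    (hF : |D3 (fun y => matDot (A y - A x0) (Hf y) + g y) x0 (a • esingle i) h2 h3| ≤ Gm * a ^ α) :
    D3 (fun y => matDot (A y) (Hf y) + g y) x0 (a • esingle i) h2 h3 ≤ 0 := by
  have hb : 0 < b := by linarith
  have hc : 0 < c := by linarith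
  obtain ⟨n, v, hv, hvt⟩ := psd_decomp (A x0) hsym l0 i hl0.le hell
  have e : (fun y => matDot (A y) (Hf y) + g y) = fun y =>
      (l0 * quadForm (Hf y) (esingle i) + ∑ m, quadForm (Hf y) (v m)) +
        (matDot (A y - A x0) (Hf y) + g y) := by
    funext y
    rw [matDot_split (A y) (A x0), hv, quad_es]; ring
  rw [e, D3_add, D3_add, D3_smul, D3_sum]
  have k1 := corea f Hf x0 x1 β K1 S r a b c i h2 h3 ha hb hc hsec (ev_pm1 hxa)
  have k2 : ∀ m, _ := fun m => corex f Hf x0 x1 β K1 S r a b c i h2 h3 (v m) hsec (ev_pm hx (v m))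
  have k3 : ∑ m, D3 (fun y => quadForm (Hf y) (v m)) x0 (a • esingle i) h2 h3 ≤
      (a * b * c) ^ β * (2 * S / r ^ 2) * ((A x0).trace - l0) := by
    rw [← hvt, Finset.mul_sum]
    exact Finset.sum_le_sum fun m _ => k2 m
  have k4 := final_real (K' := K1 + S * (‖x0 - x1‖ ^ 2 + b ^ 2 + c ^ 2) / r ^ 2) hβ hα0 hα1 ha hab hac hκ hr
    hS hK1 (by have : 0 ≤ S * (‖x0 - x1‖ ^ 2 + b ^ 2 + c ^ 2) / r ^ 2 := by positivity
               linarith) hl0 hL htr hGm c1 c2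
  have k5 := mul_le_mul_of_nonneg_left k1 hl0.le
  have k6 := (abs_le.1 hF).2
  linarith

lemma D3_z1 (f : V3 → ℝ) (x k l : V3) : D3 f x 0 k l = 0 := by
  unfold D3; simp only [add_zero, sub_zero]; ring

lemma D3_z2 (f : V3 → ℝ) (x k l : V3) : D3 f x k 0 l = 0 := by
  rw [D3_swap12, D3_z1]

lemma D3_z3 (f : V3 → ℝ) (x k l : V3) : D3 f x k l 0 = 0 := by
  rw [D3_swap23, D3_z2]

lemma D3_cont {T r : ℝ} {u : ℝ → V3 → ℝ} {x1 : V3} (i j k : Fin 3)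
    (hu : ContinuousOn (fun q : ℝ × V3 => u q.1 q.2) (Set.Icc 0 T ×ˢ Metric.closedBall x1 (4 * r))) :
    ContinuousOn (fun p : ℝ × V3 × ℝ × ℝ × ℝ => D3 (u p.1) p.2.1 (p.2.2.1 • esingle i)
      (p.2.2.2.1 • esingle j) (p.2.2.2.2 • esingle k))
      (Set.Icc 0 T ×ˢ Metric.closedBall x1 r ×ˢ Set.Icc 0 r ×ˢ Set.Icc 0 r ×ˢ Set.Icc 0 r) := by
  have key : ∀ s1 s2 s3 : ℝ, |s1| = 1 → |s2| = 1 → |s3| = 1 →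
      ContinuousOn (fun p : ℝ × V3 × ℝ × ℝ × ℝ => u p.1 (p.2.1 + (s1 * p.2.2.1) • esingle i
      + (s2 * p.2.2.2.1) • esingle j + (s3 * p.2.2.2.2) • esingle k))
      (Set.Icc 0 T ×ˢ Metric.closedBall x1 r ×ˢ Set.Icc 0 r ×ˢ Set.Icc 0 r ×ˢ Set.Icc 0 r) := by
    intro s1 s2 s3 hs1 hs2 hs3
    refine hu.comp (f := fun p : ℝ × V3 × ℝ × ℝ × ℝ => (p.1, (p.2.1 + (s1 * p.2.2.1) • esingle i
      + (s2 * p.2.2.2.1) • esingle j + (s3 * p.2.2.2.2) • esingle k))) ?_ ?_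
    · apply Continuous.continuousOn; fun_prop
    · rintro ⟨t, x, a, b, c⟩ ⟨ht, hx, ha, hb, hc⟩
      refine ⟨ht, ?_⟩
      simp only at ht hx ha hb hc ⊢
      rw [mem_closedBall_iff_norm] at hx ⊢
      have e1 : ‖(s1 * a) • esingle i‖ ≤ r := by
        rw [norm_smul, norm_es, Real.norm_eq_abs, abs_mul, hs1, abs_of_nonneg ha.1]; linarith [ha.2]
      have e2 : ‖(s2 * b) • esingle j‖ ≤ r := by
        rw [norm_smul, norm_es, Real.norm_eq_abs, abs_mul, hs2, abs_of_nonneg hb.1]; linarith [hb.2]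
      have e3 : ‖(s3 * c) • esingle k‖ ≤ r := by
        rw [norm_smul, norm_es, Real.norm_eq_abs, abs_mul, hs3, abs_of_nonneg hc.1]; linarith [hc.2]
      rw [show x + (s1 * a) • esingle i + (s2 * b) • esingle j + (s3 * c) • esingle k - x1
        = (x - x1) + (s1 * a) • esingle i + (s2 * b) • esingle j + (s3 * c) • esingle k by abel]
      have n1 := norm_add_le ((x - x1) + (s1 * a) • esingle i + (s2 * b) • esingle j) ((s3 * c) • esingle k)
      have n2 := norm_add_le ((x - x1) + (s1 * a) • esingle i) ((s2 * b) • esingle j)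
      have n3 := norm_add_le (x - x1) ((s1 * a) • esingle i)
      linarith
  have o1 : |(1:ℝ)| = 1 := by norm_num
  have o2 : |(-1:ℝ)| = 1 := by norm_num
  have h1 := key 1 1 1 o1 o1 o1
  have h2 := key 1 1 (-1) o1 o1 o2
  have h3 := key 1 (-1) 1 o1 o2 o1
  have h4 := key 1 (-1) (-1) o1 o2 o2
  have h5 := key (-1) 1 1 o2 o1 o1
  have h6 := key (-1) 1 (-1) o2 o1 o2
  have h7 := key (-1) (-1) 1 o2 o2 o1
  have h8 := key (-1) (-1) (-1) o2 o2 o2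
  simp only [one_mul, neg_one_mul, neg_smul, ← sub_eq_add_neg] at h1 h2 h3 h4 h5 h6 h7 h8
  unfold D3
  exact ((((((h1.sub h2).sub h3).add h4).sub h5).add h6).add h7).sub h8

lemma slope_ge {φ : ℝ → ℝ} {d η T t0 : ℝ} (ht0 : 0 < t0) (htT : t0 ≤ T)
    (hd : HasDerivWithinAt φ d (Set.Icc 0 T) t0)
    (h : ∀ s ∈ Set.Icc 0 T, φ s - η * s ≤ φ t0 - η * t0) : η ≤ d := by
  have h1 : HasDerivWithinAt φ d (Set.Ico 0 t0) t0 :=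
    hd.mono fun s hs => ⟨hs.1, hs.2.le.trans htT⟩
  rw [hasDerivWithinAt_iff_tendsto_slope' (by simp)] at h1
  have : (𝓝[Set.Ico 0 t0] t0).NeBot := by
    rw [nhdsWithin_Ico_eq_nhdsLT ht0]; infer_instance
  refine ge_of_tendsto h1 ?_
  filter_upwards [self_mem_nhdsWithin] with s hs
  have := h s ⟨hs.1, hs.2.le.trans htT⟩
  rw [slope_def_field, le_div_iff_of_neg (by linarith [hs.2])]
  linarith

set_option maxHeartbeats 4000000 in
lemma maxprin {u g : ℝ → V3 → ℝ} {A H : ℝ → V3 → Mat3} {x1 : V3} {T α β l0 L S K1 κ r Gm : ℝ}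
    {i j k : Fin 3} (hβ : β = (2 + α) / 3) (hα0 : 0 < α) (hα1 : α < 1)
    (hr : 0 < r) (hS : 0 ≤ S) (hK1 : 0 ≤ K1)
    (hl0 : 0 < l0) (hL : 0 ≤ L) (hGm : 0 ≤ Gm)
    (c1 : S * 6 * (l0 + L) * κ ^ 2 ≤ l0 * (β * (1 - β)) * K1 / 2)
    (c2 : Gm ≤ l0 * (β * (1 - β)) * K1 / 2)
    (hcont : ContinuousOn (fun q : ℝ × V3 => u q.1 q.2)
      (Set.Icc 0 T ×ˢ Metric.closedBall x1 (4 * r)))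
    (hder : ∀ t ∈ Set.Icc 0 T, ∀ y ∈ Metric.closedBall x1 (4 * r),
      HasDerivWithinAt (fun s => u s y) (matDot (A t y) (H t y) + g t y) (Set.Icc 0 T) t)
    (hsec : ∀ t ∈ Set.Icc 0 T, ∀ y ∈ Metric.closedBall x1 (4 * r), ∀ b' : V3,
      Tendsto (fun s : ℝ => (u t (y + s • b') + u t (y - s • b') - 2 * u t y) / s ^ 2) (𝓝[>] 0)
      (𝓝 (quadForm (H t y) b')))
    (hsym : ∀ t ∈ Set.Icc 0 T, ∀ x ∈ Metric.closedBall x1 r, (A t x).IsSymm)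
    (hell : ∀ t ∈ Set.Icc 0 T, ∀ x ∈ Metric.closedBall x1 r, ∀ ξ : V3,
      l0 * ‖ξ‖ ^ 2 ≤ quadForm (A t x) ξ)
    (htr : ∀ t ∈ Set.Icc 0 T, ∀ x ∈ Metric.closedBall x1 r, (A t x).trace ≤ 3 * L)
    (hini : ∀ x ∈ Metric.closedBall x1 r, ∀ a b c, 0 < a → a ≤ r → 0 < b → b ≤ r → 0 < c → c ≤ r →
      D3 (u 0) x (a • esingle i) (b • esingle j) (c • esingle k) ≤ K1 * (a * b * c) ^ β)
    (hbd : ∀ t ∈ Set.Icc 0 T, ∀ x ∈ Metric.closedBall x1 r, ∀ a b c,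
      0 < a → a ≤ r → 0 < b → b ≤ r → 0 < c → c ≤ r →
      D3 (u t) x (a • esingle i) (b • esingle j) (c • esingle k) ≤ S * (a * b * c) ^ β)
    (hbig : ∀ t ∈ Set.Icc 0 T, ∀ x ∈ Metric.closedBall x1 r, ∀ a b c,
      0 < a → a ≤ r → 0 < b → b ≤ r → 0 < c → c ≤ r → κ * r ≤ a → κ * r ≤ b → κ * r ≤ c →
      D3 (u t) x (a • esingle i) (b • esingle j) (c • esingle k) ≤ K1 * (a * b * c) ^ β)
    (hF : ∀ t ∈ Set.Icc 0 T, ∀ x ∈ Metric.closedBall x1 r, ∀ h1 h2 h3 : V3,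
      ‖h1‖ ≤ r → ‖h2‖ ≤ r → ‖h3‖ ≤ r →
      |D3 (fun y => matDot (A t y - A t x) (H t y) + g t y) x h1 h2 h3| ≤ Gm * ‖h1‖ ^ α) :
    ∀ t ∈ Set.Icc 0 T, ∀ a b c, 0 < a → a ≤ r → 0 < b → b ≤ r → 0 < c → c ≤ r →
      D3 (u t) x1 (a • esingle i) (b • esingle j) (c • esingle k) ≤
        bar β K1 S r x1 x1 a b c := by
  intro ts hts as bs cs has hasr hbs hbsr hcs hcsr
  by_contra hcon
  push Not at hcon
  have hT : 0 ≤ T := hts.1.trans hts.2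
  have hβ0 : 0 < β := by rw [hβ]; linarith
  set gap := D3 (u ts) x1 (as • esingle i) (bs • esingle j) (cs • esingle k) -
    bar β K1 S r x1 x1 as bs cs with hgap
  have hgap0 : 0 < gap := by linarith
  set η := gap / (2 * (T + 1)) with hη
  have hη0 : 0 < η := by positivity
  set Kc : Set (ℝ × V3 × ℝ × ℝ × ℝ) :=
    Set.Icc 0 T ×ˢ Metric.closedBall x1 r ×ˢ Set.Icc 0 r ×ˢ Set.Icc 0 r ×ˢ Set.Icc 0 r with hKc
  have hcomp : IsCompact Kc :=
    isCompact_Icc.prod ((isCompact_closedBall _ _).prod (isCompact_Icc.prod (isCompact_Icc.prod isCompact_Icc)))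
  set W : ℝ × V3 × ℝ × ℝ × ℝ → ℝ := fun p =>
    D3 (u p.1) p.2.1 (p.2.2.1 • esingle i) (p.2.2.2.1 • esingle j) (p.2.2.2.2 • esingle k)
    - bar β K1 S r x1 p.2.1 p.2.2.1 p.2.2.2.1 p.2.2.2.2 - η * p.1 with hW
  have hWc : ContinuousOn W Kc := by
    refine ((D3_cont i j k hcont).sub ?_).sub (by fun_prop)
    apply Continuous.continuousOn
    unfold bar
    have : Continuous fun p : ℝ × V3 × ℝ × ℝ × ℝ => (p.2.2.1 * p.2.2.2.1 * p.2.2.2.2) ^ β :=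
      Continuous.rpow_const (by fun_prop) fun _ => Or.inr hβ0.le
    fun_prop
  have hps : ((ts, x1, as, bs, cs) : ℝ × V3 × ℝ × ℝ × ℝ) ∈ Kc := by
    refine ⟨hts, ?_, ⟨has.le, hasr⟩, ⟨hbs.le, hbsr⟩, ⟨hcs.le, hcsr⟩⟩
    simp [hr.le]
  obtain ⟨⟨t, x, a, b, c⟩, ⟨ht, hx, ha, hb, hc⟩, hmax⟩ := hcomp.exists_isMaxOn ⟨_, hps⟩ hWc
  simp only at ht hx ha hb hc
  have hWp : 0 < W (ts, x1, as, bs, cs) := by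
    have : η * ts ≤ gap / 2 := by
      calc η * ts ≤ η * (T + 1) := by gcongr; linarith [hts.2]
        _ = gap / 2 := by rw [hη]; field_simp
    simp only [hW]
    linarith
  have hW0 : 0 < W (t, x, a, b, c) := lt_of_lt_of_le hWp (hmax hps)
  have hηt : 0 ≤ η * t := mul_nonneg hη0.le ht.1
  have hD : bar β K1 S r x1 x a b c <
      D3 (u t) x (a • esingle i) (b • esingle j) (c • esingle k) - η * t := by
    simp only [hW] at hW0; linarith
  have hxn : ‖x - x1‖ ≤ r := mem_closedBall_iff_norm.1 hx
  have ha0 : 0 < a := by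
    rcases ha.1.lt_or_eq with h | h
    · exact h
    · exfalso
      rw [← h, zero_smul, D3_z1, bar] at hD
      simp [Real.zero_rpow hβ0.ne'] at hD; linarith
  have hb0 : 0 < b := by
    rcases hb.1.lt_or_eq with h | h
    · exact h
    · exfalso
      rw [← h, zero_smul, D3_z2, bar] at hD
      simp [Real.zero_rpow hβ0.ne'] at hD; linarith
  have hc0 : 0 < c := by
    rcases hc.1.lt_or_eq with h | h
    · exact h
    · exfalso
      rw [← h, zero_smul, D3_z3, bar] at hD
      simp [Real.zero_rpow hβ0.ne'] at hD; linarith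
  set E := (a * b * c) ^ β with hE
  have hE0 : 0 < E := by positivity
  have hbar1 : K1 * E ≤ bar β K1 S r x1 x a b c := by
    unfold bar
    have : 0 ≤ S * (‖x - x1‖ ^ 2 + a ^ 2 + b ^ 2 + c ^ 2) / r ^ 2 := by positivity
    nlinarith
  have hbar2 : ‖x - x1‖ ^ 2 + a ^ 2 + b ^ 2 + c ^ 2 < r ^ 2 := by
    by_contra hge
    push Not at hge
    have h1 : S ≤ S * (‖x - x1‖ ^ 2 + a ^ 2 + b ^ 2 + c ^ 2) / r ^ 2 := by
      rw [le_div_iff₀ (by positivity)]; gcongr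
    have h2 : S * E ≤ bar β K1 S r x1 x a b c := by
      unfold bar; rw [← hE, mul_comm S]; gcongr; linarith
    have h3 := hbd t ht x hx a b c ha0 ha.2 hb0 hb.2 hc0 hc.2
    linarith
  have hxr : ‖x - x1‖ < r := by
    apply lt_of_pow_lt_pow_left₀ 2 hr.le; nlinarith
  have har : a < r := by
    apply lt_of_pow_lt_pow_left₀ 2 hr.le; nlinarith [sq_nonneg ‖x - x1‖]
  have hbr : b < r := by
    apply lt_of_pow_lt_pow_left₀ 2 hr.le; nlinarith [sq_nonneg ‖x - x1‖]
  have hcr : c < r := by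
    apply lt_of_pow_lt_pow_left₀ 2 hr.le; nlinarith [sq_nonneg ‖x - x1‖]
  have ht0 : 0 < t := by
    rcases ht.1.lt_or_eq with h | h
    · exact h
    · exfalso
      have := hini x hx a b c ha0 ha.2 hb0 hb.2 hc0 hc.2
      rw [h] at this; linarith
  have hnot : ¬ (κ * r ≤ a ∧ κ * r ≤ b ∧ κ * r ≤ c) := by
    rintro ⟨q1, q2, q3⟩
    have := hbig t ht x hx a b c ha0 ha.2 hb0 hb.2 hc0 hc.2 q1 q2 q3
    linarith
  -- local maxima
  have mx : ∀ᶠ y in 𝓝 x, D3 (u t) y (a • esingle i) (b • esingle j) (c • esingle k)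
      - bar β K1 S r x1 y a b c ≤ D3 (u t) x (a • esingle i) (b • esingle j) (c • esingle k)
      - bar β K1 S r x1 x a b c := by
    have : Metric.ball x1 r ∈ 𝓝 x := Metric.isOpen_ball.mem_nhds (mem_ball_iff_norm.2 hxr)
    filter_upwards [this] with y hy
    have := hmax (show (t, y, a, b, c) ∈ Kc from ⟨ht, Metric.ball_subset_closedBall hy, ha, hb, hc⟩)
    simp only [Set.mem_ofPred_eq, hW] at this
    linarith
  have ma : ∀ᶠ s in 𝓝 a, D3 (u t) x (s • esingle i) (b • esingle j) (c • esingle k)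
      - bar β K1 S r x1 x s b c ≤ D3 (u t) x (a • esingle i) (b • esingle j) (c • esingle k)
      - bar β K1 S r x1 x a b c := by
    filter_upwards [Icc_mem_nhds ha0 har] with s hs
    have := hmax (show (t, x, s, b, c) ∈ Kc from ⟨ht, hx, hs, hb, hc⟩)
    simp only [Set.mem_ofPred_eq, hW] at this
    linarith
  have mb : ∀ᶠ s in 𝓝 b, D3 (u t) x (a • esingle i) (s • esingle j) (c • esingle k)
      - bar β K1 S r x1 x a s c ≤ D3 (u t) x (a • esingle i) (b • esingle j) (c • esingle k)
      - bar β K1 S r x1 x a b c := by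
    filter_upwards [Icc_mem_nhds hb0 hbr] with s hs
    have := hmax (show (t, x, a, s, c) ∈ Kc from ⟨ht, hx, ha, hs, hc⟩)
    simp only [Set.mem_ofPred_eq, hW] at this
    linarith
  have mc : ∀ᶠ s in 𝓝 c, D3 (u t) x (a • esingle i) (b • esingle j) (s • esingle k)
      - bar β K1 S r x1 x a b s ≤ D3 (u t) x (a • esingle i) (b • esingle j) (c • esingle k)
      - bar β K1 S r x1 x a b c := by
    filter_upwards [Icc_mem_nhds hc0 hcr] with s hs
    have := hmax (show (t, x, a, b, s) ∈ Kc from ⟨ht, hx, ha, hb, hs⟩)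
    simp only [Set.mem_ofPred_eq, hW] at this
    linarith
  have na : ‖a • esingle i‖ = a := by rw [norm_smul, norm_es, Real.norm_of_nonneg ha0.le, mul_one]
  have nb : ‖b • esingle j‖ = b := by rw [norm_smul, norm_es, Real.norm_of_nonneg hb0.le, mul_one]
  have nc : ‖c • esingle k‖ = c := by rw [norm_smul, norm_es, Real.norm_of_nonneg hc0.le, mul_one]
  have hball : ∀ y, ‖y - x‖ ≤ a + b + c → y ∈ Metric.closedBall x1 (4 * r) := by
    intro y hy
    rw [mem_closedBall_iff_norm, show y - x1 = (y - x) + (x - x1) by abel]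
    refine (norm_add_le _ _).trans ?_
    linarith
  have hfin : D3 (fun y => matDot (A t y) (H t y) + g t y) x (a • esingle i) (b • esingle j) (c • esingle k) ≤ 0 := by
    have caseA : ∀ (i' j' k' : Fin 3) (a' b' c' : ℝ), 0 < a' → a' ≤ b' → a' ≤ c' → b' < r → c' < r →
        a' ≤ κ * r → a' + b' + c' = a + b + c →
        (∀ᶠ y in 𝓝 x, D3 (u t) y (a' • esingle i') (b' • esingle j') (c' • esingle k')
          - bar β K1 S r x1 y a' b' c' ≤ D3 (u t) x (a' • esingle i') (b' • esingle j') (c' • esingle k')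
          - bar β K1 S r x1 x a' b' c') →
        (∀ᶠ s in 𝓝 a', D3 (u t) x (s • esingle i') (b' • esingle j') (c' • esingle k')
          - bar β K1 S r x1 x s b' c' ≤ D3 (u t) x (a' • esingle i') (b' • esingle j') (c' • esingle k')
          - bar β K1 S r x1 x a' b' c') →
        D3 (fun y => matDot (A t y) (H t y) + g t y) x (a' • esingle i') (b' • esingle j') (c' • esingle k') ≤ 0 := by
      intro i' j' k' a' b' c' ha' hab hac hb' hc' hak hsum hm1 hm2
      have na : ‖a' • esingle i'‖ = a' := by
        rw [norm_smul, norm_es, Real.norm_of_nonneg ha'.le, mul_one]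
      have nb : ‖b' • esingle j'‖ = b' := by
        rw [norm_smul, norm_es, Real.norm_of_nonneg (by linarith), mul_one]
      have nc : ‖c' • esingle k'‖ = c' := by
        rw [norm_smul, norm_es, Real.norm_of_nonneg (by linarith), mul_one]
      refine finish hβ hα0 hα1 ha' hab hac hak hr hS hK1 hl0 hL hGm c1 c2 (hsym t ht x hx)
        (hell t ht x hx) (htr t ht x hx) ?_ hm1 hm2 ?_
      · intro y hy
        rw [na, nb, nc, hsum] at hy
        exact hsec t ht y (hball y hy)
      · have := hF t ht x hx (a' • esingle i') (b' • esingle j') (c' • esingle k')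
          (by rw [na]; linarith) (by rw [nb]; linarith) (by rw [nc]; linarith)
        rwa [na] at this
    by_cases h1 : a ≤ b
    · by_cases h2 : a ≤ c
      · refine caseA i j k a b c ha0 h1 h2 hbr hcr ?_ rfl mx ma
        by_contra h; push Not at h; exact hnot ⟨h.le, by linarith, by linarith⟩
      · push Not at h2
        rw [D3_swap23, D3_swap12]
        refine caseA k i j c a b hc0 h2.le (by linarith) har hbr ?_ (by ring) ?_ ?_
        · by_contra h; push Not at h; exact hnot ⟨by linarith, by linarith, h.le⟩
        · simpa only [D3_swap23 _ _ (a • esingle i) (b • esingle j), D3_swap12 _ _ (a • esingle i) (c • esingle k),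
            bar_swap23 _ _ _ _ _ _ a b c, bar_swap12 _ _ _ _ _ _ a c b] using mx
        · refine mc.mono fun s hs => ?_
          rw [D3_swap23, D3_swap12, bar_swap23, bar_swap12, D3_swap23 _ _ (a • esingle i) (b • esingle j) (c • esingle k),
            D3_swap12 _ _ (a • esingle i) (c • esingle k), bar_swap23 _ _ _ _ _ _ a b c,
            bar_swap12 _ _ _ _ _ _ a c b] at hs
          exact hs
    · push Not at h1
      by_cases h2 : b ≤ c
      · rw [D3_swap12]
        refine caseA j i k b a c hb0 h1.le h2 har hcr ?_ (by ring) ?_ ?_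
        · by_contra h; push Not at h; exact hnot ⟨by linarith, h.le, by linarith⟩
        · refine mx.mono fun s hs => ?_
          rw [D3_swap12, bar_swap12, D3_swap12 _ x, bar_swap12 _ _ _ _ _ x] at hs
          exact hs
        · refine mb.mono fun s hs => ?_
          rw [D3_swap12, bar_swap12, D3_swap12 _ _ (a • esingle i) (b • esingle j),
            bar_swap12 _ _ _ _ _ _ a b] at hs
          exact hs
      · push Not at h2
        rw [D3_swap23, D3_swap12]
        refine caseA k i j c a b hc0 (by linarith) h2.le har hbr ?_ (by ring) ?_ ?_
        · by_contra h; push Not at h; exact hnot ⟨by linarith, by linarith, h.le⟩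
        · simpa only [D3_swap23 _ _ (a • esingle i) (b • esingle j), D3_swap12 _ _ (a • esingle i) (c • esingle k),
            bar_swap23 _ _ _ _ _ _ a b c, bar_swap12 _ _ _ _ _ _ a c b] using mx
        · refine mc.mono fun s hs => ?_
          rw [D3_swap23, D3_swap12, bar_swap23, bar_swap12, D3_swap23 _ _ (a • esingle i) (b • esingle j) (c • esingle k),
            D3_swap12 _ _ (a • esingle i) (c • esingle k), bar_swap23 _ _ _ _ _ _ a b c,
            bar_swap12 _ _ _ _ _ _ a c b] at hs
          exact hs
  have hdd := D3_hasDeriv u _ x (a • esingle i) (b • esingle j) (c • esingle k) (Set.Icc 0 T) t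
    (fun y hy => hder t ht y (hball y (by rwa [na, nb, nc] at hy)))
  have := slope_ge (η := η) ht0 ht.2 hdd (by
    intro s hs
    have := hmax (show (s, x, a, b, c) ∈ Kc from ⟨hs, hx, ha, hb, hc⟩)
    simp only [Set.mem_ofPred_eq, hW] at this
    linarith)
  linarith

structure Loc (T α l0 L M N A2 C2 D2 U2 ρ : ℝ) (x1 : V3) (Ω : Set V3) (u c : ℝ → V3 → ℝ)
    (A H : ℝ → V3 → Mat3) : Prop where
  hT : 0 ≤ T
  hα0 : 0 < α
  hα1 : α < 1
  hl0 : 0 < l0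
  hL : 0 ≤ L
  hM : 0 ≤ M
  hN : 0 ≤ N
  hA2 : 0 ≤ A2
  hC2 : 0 ≤ C2
  hD2 : 0 ≤ D2
  hU2 : 0 ≤ U2
  hρ : 0 < ρ
  c2 : ∀ t ∈ Set.Icc 0 T, ∃ G1 G2, C2D Ω (u t) G1 G2 (H t)
  sub : ∀ z, ‖z - x1‖ ≤ ρ → z ∈ Ω
  bd : ∀ t ∈ Set.Icc 0 T, ∀ z, ‖z - x1‖ ≤ ρ → |u t z| ≤ M
  hol : ∀ t ∈ Set.Icc 0 T, ∀ y z, ‖y - x1‖ ≤ ρ → ‖z - x1‖ ≤ ρ → ∀ i j,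
    |H t y i j - H t z i j| ≤ N * ‖y - z‖ ^ α
  aH : ∀ t ∈ Set.Icc 0 T, ∀ y z, ‖y - x1‖ ≤ ρ → ‖z - x1‖ ≤ ρ → ∀ i j,
    |A t y i j - A t z i j| ≤ A2 * ‖y - z‖ ^ α
  cH : ∀ t ∈ Set.Icc 0 T, ∀ y z, ‖y - x1‖ ≤ ρ → ‖z - x1‖ ≤ ρ →
    |c t y - c t z| ≤ C2 * ‖y - z‖ ^ α
  cB : ∀ t ∈ Set.Icc 0 T, ∀ y, ‖y - x1‖ ≤ ρ → |c t y| ≤ D2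
  ini : ∀ y z, ‖y - x1‖ ≤ ρ → ‖z - x1‖ ≤ ρ → ∀ i j,
    |H 0 y i j - H 0 z i j| ≤ U2 * ‖y - z‖ ^ α
  sym : ∀ t ∈ Set.Icc 0 T, ∀ y, ‖y - x1‖ ≤ ρ → (A t y).IsSymm
  ell : ∀ t ∈ Set.Icc 0 T, ∀ y, ‖y - x1‖ ≤ ρ → ∀ ξ : V3, l0 * ‖ξ‖ ^ 2 ≤ quadForm (A t y) ξ
  tr : ∀ t ∈ Set.Icc 0 T, ∀ y, ‖y - x1‖ ≤ ρ → (A t y).trace ≤ 3 * L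
  der : ∀ t ∈ Set.Icc 0 T, ∀ y, ‖y - x1‖ ≤ ρ →
    HasDerivWithinAt (fun s => u s y) (matDot (A t y) (H t y) + c t y * u t y) (Set.Icc 0 T) t

lemma C2D.neg {Ω f G1 G2 H} (h : C2D Ω f G1 G2 H) :
    C2D Ω (fun y => - f y) (fun y => - G1 y) (fun y => - G2 y) (fun y => - H y) where
  op := h.op
  d1 := fun y hy => (h.d1 y hy).neg
  d2 := fun y hy => (h.d2 y hy).neg
  eq := fun y hy i j => by simp [h.eq y hy]

lemma matDot_neg (A H : Mat3) : matDot A (-H) = - matDot A H := by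
  unfold matDot; simp

lemma matDot_le (A H : Mat3) (a b : ℝ) (hA : ∀ i j, |A i j| ≤ a) (hH : ∀ i j, |H i j| ≤ b) :
    |matDot A H| ≤ 9 * (a * b) := by
  have ha : 0 ≤ a := (abs_nonneg _).trans (hA 0 0)
  unfold matDot
  calc |∑ i, ∑ j, A i j * H i j| ≤ ∑ i : Fin 3, ∑ j : Fin 3, a * b := by
        refine (Finset.abs_sum_le_sum_abs _ _).trans (Finset.sum_le_sum fun i _ => ?_)
        refine (Finset.abs_sum_le_sum_abs _ _).trans (Finset.sum_le_sum fun j _ => ?_)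
        rw [abs_mul]
        exact mul_le_mul (hA i j) (hH i j) (abs_nonneg _) ha
    _ = 9 * (a * b) := by simp; ring

section
variable {T α l0 L M N A2 C2 D2 U2 ρ : ℝ} {x1 : V3} {Ω : Set V3} {u c : ℝ → V3 → ℝ}
    {A H : ℝ → V3 → Mat3}

lemma Loc.neg (h : Loc T α l0 L M N A2 C2 D2 U2 ρ x1 Ω u c A H) :
    Loc T α l0 L M N A2 C2 D2 U2 ρ x1 Ω (fun t y => - u t y) c A (fun t y => - H t y) :=
  { h with
    c2 := fun t ht => by
      obtain ⟨G1, G2, hh⟩ := h.c2 t ht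
      exact ⟨_, _, hh.neg⟩
    bd := fun t ht z hz => by rw [abs_neg]; exact h.bd t ht z hz
    hol := fun t ht y z hy hz i j => by
      have := h.hol t ht y z hy hz i j
      rw [← abs_neg] at this
      rw [Matrix.neg_apply, Matrix.neg_apply]
      convert this using 2; ring
    ini := fun y z hy hz i j => by
      have := h.ini y z hy hz i j
      rw [← abs_neg] at this
      rw [Matrix.neg_apply, Matrix.neg_apply]
      convert this using 2; ring
    der := fun t ht y hy => by
      have := (h.der t ht y hy).neg
      have e : matDot (A t y) (-H t y) + c t y * -u t y = -(matDot (A t y) (H t y) + c t y * u t y) := by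
        rw [matDot_neg]; ring
      rw [e]
      exact this }

lemma tri {y z x : V3} {a b s : ℝ} (h1 : ‖y - z‖ ≤ a) (h2 : ‖z - x‖ ≤ b) (h : a + b ≤ s) : ‖y - x‖ ≤ s := by
  rw [show y - x = (y - z) + (z - x) by abel]
  exact (norm_add_le _ _).trans (by linarith)

lemma Loc.Hb (h : Loc T α l0 L M N A2 C2 D2 U2 ρ x1 Ω u c A H) {r s : ℝ} (hr : 0 < r)
    (hs : s + 2 * r ≤ ρ) {t : ℝ} (ht : t ∈ Set.Icc 0 T) {y : V3} (hy : ‖y - x1‖ ≤ s) (i j : Fin 3) :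
    |H t y i j| ≤ M / r ^ 2 + N * (2 * r) ^ α := by
  obtain ⟨G1, G2, hh⟩ := h.c2 t ht
  have key : ∀ z, ‖z - y‖ ≤ 2 * r → ‖z - x1‖ ≤ ρ := fun z hz => tri hz hy (by linarith)
  exact hh.interp y r M N α hr h.hα0 h.hN (fun z hz => h.sub z (key z hz))
    (fun z hz => h.bd t ht z (key z hz))
    (fun z hz i j => h.hol t ht y z (hy.trans (by linarith)) (key z hz) i j) i j

lemma Loc.uh (h : Loc T α l0 L M N A2 C2 D2 U2 ρ x1 Ω u c A H) {r e : ℝ} (hr : 0 < r)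
    (hs : 8 * r ≤ ρ) (he : 0 < e) (he8 : 8 * e ≤ ρ) {t : ℝ} (ht : t ∈ Set.Icc 0 T) {y z : V3}
    (hy : ‖y - x1‖ ≤ 4 * r) (hz : ‖z - x1‖ ≤ 4 * r) :
    |u t y - u t z| ≤ (11 * M * e ^ (-α) + 18 * e ^ 2 * N) * ‖y - z‖ ^ α := by
  obtain ⟨G1, G2, hh⟩ := h.c2 t ht
  have hM := h.hM
  have hN := h.hN
  have k := hh.holder x1 (4 * r) e M (M / e ^ 2 + N * (2 * e) ^ α) α he h.hα0 h.hα1 h.hM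
    (by positivity) (fun z hz => h.sub z (hz.trans (by linarith)))
    (fun z hz => h.bd t ht z (hz.trans (by linarith)))
    (fun z hz i j => h.Hb he (by linarith) ht hz i j) y z hy hz
  refine k.trans (mul_le_mul_of_nonneg_right ?_ (by positivity))
  have e1 : e ^ (2 - α) = e ^ (-α) * e ^ 2 := by
    rw [← Real.rpow_natCast, ← Real.rpow_add he]; congr 1; push_cast; ring
  have e2 : e ^ (-α) * e ^ α = 1 := by rw [← Real.rpow_add he]; simp
  have e3 : (2:ℝ) ^ α ≤ 2 := by
    calc (2:ℝ) ^ α ≤ 2 ^ (1:ℝ) := Real.rpow_le_rpow_of_exponent_le (by norm_num) h.hα1.le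
      _ = 2 := by simp
  rw [e1, Real.mul_rpow (by norm_num) he.le]
  have e4 : 2 * M * e ^ (-α) + 9 * (e ^ (-α) * e ^ 2) * (M / e ^ 2 + N * (2 ^ α * e ^ α))
      = 11 * M * e ^ (-α) + 9 * e ^ 2 * N * 2 ^ α * (e ^ (-α) * e ^ α) := by
    field_simp; ring
  rw [e4, e2]
  have : 9 * e ^ 2 * N * 2 ^ α ≤ 9 * e ^ 2 * N * 2 := by gcongr
  linarith

lemma Loc.cont (h : Loc T α l0 L M N A2 C2 D2 U2 ρ x1 Ω u c A H) {r : ℝ} (hr : 0 < r)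
    (hs : 8 * r ≤ ρ) : ContinuousOn (fun q : ℝ × V3 => u q.1 q.2)
      (Set.Icc 0 T ×ˢ Metric.closedBall x1 (4 * r)) := by
  set B := 11 * M * r ^ (-α) + 18 * r ^ 2 * N with hB
  rintro ⟨t0, y0⟩ ⟨ht0, hy0⟩
  simp only at ht0 hy0
  rw [mem_closedBall_iff_norm] at hy0
  have h1 : Tendsto (fun q : ℝ × V3 => u q.1 y0)
      (𝓝[Set.Icc 0 T ×ˢ Metric.closedBall x1 (4 * r)] (t0, y0)) (𝓝 (u t0 y0)) := by
    have hc : ContinuousWithinAt (fun s => u s y0) (Set.Icc 0 T) t0 :=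
      (h.der t0 ht0 y0 (hy0.trans (by linarith))).continuousWithinAt
    refine hc.tendsto.comp ?_
    refine tendsto_nhdsWithin_of_tendsto_nhds_of_eventually_within _ ?_ ?_
    · exact (continuous_fst.tendsto (t0, y0)).mono_left nhdsWithin_le_nhds
    · filter_upwards [self_mem_nhdsWithin] with q hq using hq.1
  have h2 : Tendsto (fun q : ℝ × V3 => B * ‖q.2 - y0‖ ^ α)
      (𝓝[Set.Icc 0 T ×ˢ Metric.closedBall x1 (4 * r)] (t0, y0)) (𝓝 0) := by
    have hc : Continuous fun q : ℝ × V3 => B * ‖q.2 - y0‖ ^ α := by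
      refine continuous_const.mul (Continuous.rpow_const (by fun_prop) fun _ => Or.inr h.hα0.le)
    have := hc.tendsto (t0, y0)
    simp only [sub_self, norm_zero, Real.zero_rpow h.hα0.ne', mul_zero] at this
    exact this.mono_left nhdsWithin_le_nhds
  have h3 : Tendsto (fun q : ℝ × V3 => u q.1 q.2 - u q.1 y0)
      (𝓝[Set.Icc 0 T ×ˢ Metric.closedBall x1 (4 * r)] (t0, y0)) (𝓝 0) := by
    refine squeeze_zero_norm' ?_ h2
    filter_upwards [self_mem_nhdsWithin] with q hq
    exact h.uh hr hs hr hs hq.1 (mem_closedBall_iff_norm.1 hq.2) hy0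
  have := h3.add h1
  simpa [ContinuousWithinAt] using this

lemma Loc.Fb (h : Loc T α l0 L M N A2 C2 D2 U2 ρ x1 Ω u c A H) {r e G : ℝ} (hr : 0 < r)
    (hs : 8 * r ≤ ρ) (he : 0 < e) (he8 : 8 * e ≤ ρ)
    (hG : G = 9 * A2 * (M / r ^ 2 + N * (2 * r) ^ α) + 9 * A2 * (4 * r) ^ α * N + C2 * M
      + D2 * (11 * M * e ^ (-α) + 18 * e ^ 2 * N)) {t : ℝ} (ht : t ∈ Set.Icc 0 T) {x : V3}
    (hx : x ∈ Metric.closedBall x1 r) (h1 h2 h3 : V3) (hh1 : ‖h1‖ ≤ r) (hh2 : ‖h2‖ ≤ r) (hh3 : ‖h3‖ ≤ r) :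
    |D3 (fun y => matDot (A t y - A t x) (H t y) + c t y * u t y) x h1 h2 h3| ≤ 8 * G * ‖h1‖ ^ α := by
  rw [mem_closedBall_iff_norm] at hx
  have hM := h.hM
  have hN := h.hN
  have hA2 := h.hA2
  have hD2 := h.hD2
  have hC2 := h.hC2
  have hα0 := h.hα0
  have hG0 : 0 ≤ G := by rw [hG]; positivity
  have key := D3_diff_le (fun y => matDot (A t y - A t x) (H t y) + c t y * u t y) x h1 h2 h3
    (G * (2 * ‖h1‖) ^ α) ?_
  · have e3 : (2:ℝ) ^ α ≤ 2 := by
      calc (2:ℝ) ^ α ≤ 2 ^ (1:ℝ) := Real.rpow_le_rpow_of_exponent_le (by norm_num) h.hα1.le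
        _ = 2 := by simp
    refine key.trans ?_
    rw [Real.mul_rpow (by norm_num) (norm_nonneg _)]
    have : G * ‖h1‖ ^ α * 2 ^ α ≤ G * ‖h1‖ ^ α * 2 := by gcongr
    linarith
  · intro y z hy hz hyz
    have hy4 : ‖y - x1‖ ≤ 4 * r := tri hy hx (by linarith)
    have hz4 : ‖z - x1‖ ≤ 4 * r := tri hz hx (by linarith)
    have hyρ : ‖y - x1‖ ≤ ρ := by linarith
    have hzρ : ‖z - x1‖ ≤ ρ := by linarith
    have hxρ : ‖x - x1‖ ≤ ρ := by linarith
    rw [← hyz]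
    set w := ‖y - z‖ ^ α with hw
    have hw0 : 0 ≤ w := by positivity
    have m1 : |matDot (A t y - A t z) (H t y)| ≤ 9 * (A2 * w * (M / r ^ 2 + N * (2 * r) ^ α)) :=
      matDot_le _ _ _ _ (fun i j => h.aH t ht y z hyρ hzρ i j) (fun i j => h.Hb hr (by linarith) ht hy4 i j)
    have m2 : |matDot (A t z - A t x) (H t y - H t z)| ≤ 9 * (A2 * (4 * r) ^ α * (N * w)) := by
      refine matDot_le _ _ _ _ (fun i j => (h.aH t ht z x hzρ hxρ i j).trans ?_)
        (fun i j => h.hol t ht y z hyρ hzρ i j)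
      have : ‖z - x‖ ≤ 4 * r := by linarith
      gcongr
    have m3 : |c t y - c t z| * |u t y| ≤ C2 * w * M :=
      mul_le_mul (h.cH t ht y z hyρ hzρ) (h.bd t ht y hyρ) (abs_nonneg _) (by positivity)
    have m4 : |c t z| * |u t y - u t z| ≤ D2 * ((11 * M * e ^ (-α) + 18 * e ^ 2 * N) * w) :=
      mul_le_mul (h.cB t ht z hzρ) (h.uh hr hs he he8 ht hy4 hz4) (abs_nonneg _) hD2
    rw [← abs_mul] at m3 m4
    have ee : matDot (A t y - A t x) (H t y) + c t y * u t y -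
        (matDot (A t z - A t x) (H t z) + c t z * u t z) =
        matDot (A t y - A t z) (H t y) + matDot (A t z - A t x) (H t y - H t z) +
        (c t y - c t z) * u t y + c t z * (u t y - u t z) := by
      unfold matDot
      simp only [Matrix.sub_apply, Fin.sum_univ_three]
      ring
    rw [ee]
    refine (abs_add_le _ _).trans ?_
    have t1 := abs_add_le (matDot (A t y - A t z) (H t y) + matDot (A t z - A t x) (H t y - H t z))
      ((c t y - c t z) * u t y)
    have t2 := abs_add_le (matDot (A t y - A t z) (H t y)) (matDot (A t z - A t x) (H t y - H t z))
    have : G * w = 9 * (A2 * w * (M / r ^ 2 + N * (2 * r) ^ α)) + 9 * (A2 * (4 * r) ^ α * (N * w)) +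
      C2 * w * M + D2 * ((11 * M * e ^ (-α) + 18 * e ^ 2 * N) * w) := by rw [hG]; ring
    linarith

lemma Loc.D3one (h : Loc T α l0 L M N A2 C2 D2 U2 ρ x1 Ω u c A H) {β r e G K1 κ : ℝ}
    (hβ : β = (2 + α) / 3) (hr : 0 < r)
    (hs : 8 * r ≤ ρ) (he : 0 < e) (he8 : 8 * e ≤ ρ) (hκ : 0 < κ)
    (hG : G = 9 * A2 * (M / r ^ 2 + N * (2 * r) ^ α) + 9 * A2 * (4 * r) ^ α * N + C2 * M
      + D2 * (11 * M * e ^ (-α) + 18 * e ^ 2 * N))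
    (k1 : 8 * U2 ≤ K1) (k2 : 8 * M * (κ * r) ^ (-(2 + α)) ≤ K1)
    (c1 : (8 * N) * 6 * (l0 + L) * κ ^ 2 ≤ l0 * (β * (1 - β)) * K1 / 2)
    (c2 : 8 * G ≤ l0 * (β * (1 - β)) * K1 / 2) {t : ℝ} (ht : t ∈ Set.Icc 0 T) (i j k : Fin 3)
    {a b d : ℝ} (ha : 0 < a) (har : a ≤ r) (hb : 0 < b) (hbr : b ≤ r) (hd : 0 < d) (hdr : d ≤ r) :
    D3 (u t) x1 (a • esingle i) (b • esingle j) (d • esingle k) ≤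
      (a * b * d) ^ β * (K1 + 8 * N * (a ^ 2 + b ^ 2 + d ^ 2) / r ^ 2) := by
  have hM := h.hM
  have hN := h.hN
  have hA2 := h.hA2
  have hD2 := h.hD2
  have hC2 := h.hC2
  have hα0 := h.hα0
  have hU2 := h.hU2
  have hG0 : 0 ≤ G := by rw [hG]; positivity
  have hK1 : 0 ≤ K1 := by linarith
  have hb4 : ∀ {y : V3}, y ∈ Metric.closedBall x1 (4 * r) → ‖y - x1‖ ≤ ρ := by
    intro y hy; rw [mem_closedBall_iff_norm] at hy; linarith
  have hb1 : ∀ {y : V3}, y ∈ Metric.closedBall x1 r → ‖y - x1‖ ≤ ρ := by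
    intro y hy; rw [mem_closedBall_iff_norm] at hy; linarith
  have key := maxprin (u := u) (g := fun t y => c t y * u t y) (A := A) (H := H) (x1 := x1) (T := T)
    (S := 8 * N) (K1 := K1) (κ := κ) (r := r) (Gm := 8 * G) (i := i) (j := j) (k := k)
    hβ hα0 h.hα1 hr (by positivity) hK1 h.hl0 h.hL (by positivity) c1 c2 (h.cont hr hs)
    (fun t ht y hy => h.der t ht y (hb4 hy))
    (fun t ht y hy b' => by
      obtain ⟨G1, G2, hh⟩ := h.c2 t ht
      exact hh.sec (h.sub y (hb4 hy)) b')
    (fun t ht y hy => h.sym t ht y (hb1 hy))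
    (fun t ht y hy => h.ell t ht y (hb1 hy))
    (fun t ht y hy => h.tr t ht y (hb1 hy)) ?_ ?_ ?_
    (fun t ht x hx h1 h2 h3 q1 q2 q3 => h.Fb hr hs he he8 hG ht hx h1 h2 h3 q1 q2 q3)
    t ht a b d ha har hb hbr hd hdr
  · unfold bar at key
    simpa using key
  · intro x hx a b c ha har hb hbr hc hcr
    obtain ⟨G1, G2, hh⟩ := h.c2 0 ⟨le_rfl, h.hT⟩
    rw [mem_closedBall_iff_norm] at hx
    have := hh.D3le x a b c U2 α (3 * r) ha hb hc hα0 h.hα1 i j k (by linarith) hU2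
      (fun z hz => h.sub z (tri hz hx (by linarith)))
      (fun y z hy hz => h.ini y z (tri hy hx (by linarith)) (tri hz hx (by linarith)))
    rw [← hβ] at this
    refine (le_abs_self _).trans (this.trans ?_)
    gcongr
  · intro t ht x hx a b c ha har hb hbr hc hcr
    obtain ⟨G1, G2, hh⟩ := h.c2 t ht
    rw [mem_closedBall_iff_norm] at hx
    have := hh.D3le x a b c N α (3 * r) ha hb hc hα0 h.hα1 i j k (by linarith) hN
      (fun z hz => h.sub z (tri hz hx (by linarith)))
      (fun y z hy hz => h.hol t ht y z (tri hy hx (by linarith)) (tri hz hx (by linarith)))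
    rw [← hβ] at this
    exact (le_abs_self _).trans this
  · intro t ht x hx a b c ha har hb hbr hc hcr qa qb qc
    rw [mem_closedBall_iff_norm] at hx
    have := D3_abs_le (u t) x (a • esingle i) (b • esingle j) (c • esingle k) M (by
      intro y hy
      simp only [norm_smul_es, abs_of_pos ha, abs_of_pos hb, abs_of_pos hc] at hy
      exact h.bd t ht y (tri hy hx (by linarith)))
    refine (le_abs_self _).trans (this.trans ?_)
    have p1 : (κ * r) ^ (2 + α) ≤ (a * b * c) ^ β := by
      have : (κ * r) ^ (2 + α) = (κ * r * (κ * r) * (κ * r)) ^ β := by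
        rw [show κ * r * (κ * r) * (κ * r) = (κ * r) ^ (3:ℝ) by
          rw [show (3:ℝ) = ((3:ℕ):ℝ) by norm_num, Real.rpow_natCast]; ring,
          ← Real.rpow_mul (by positivity)]
        congr 1; rw [hβ]; ring
      rw [this]
      have : 0 ≤ β := by rw [hβ]; linarith
      gcongr
    calc 8 * M = 8 * M * (κ * r) ^ (-(2 + α)) * (κ * r) ^ (2 + α) := by
          rw [mul_assoc, ← Real.rpow_add (by positivity)]; simp
      _ ≤ K1 * (a * b * c) ^ β := by gcongr

lemma Loc.D3abs (h : Loc T α l0 L M N A2 C2 D2 U2 ρ x1 Ω u c A H) {β r e G K1 κ : ℝ}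
    (hβ : β = (2 + α) / 3) (hr : 0 < r)
    (hs : 8 * r ≤ ρ) (he : 0 < e) (he8 : 8 * e ≤ ρ) (hκ : 0 < κ)
    (hG : G = 9 * A2 * (M / r ^ 2 + N * (2 * r) ^ α) + 9 * A2 * (4 * r) ^ α * N + C2 * M
      + D2 * (11 * M * e ^ (-α) + 18 * e ^ 2 * N))
    (k1 : 8 * U2 ≤ K1) (k2 : 8 * M * (κ * r) ^ (-(2 + α)) ≤ K1)
    (c1 : (8 * N) * 6 * (l0 + L) * κ ^ 2 ≤ l0 * (β * (1 - β)) * K1 / 2)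
    (c2 : 8 * G ≤ l0 * (β * (1 - β)) * K1 / 2) {t : ℝ} (ht : t ∈ Set.Icc 0 T) (i j k : Fin 3)
    {a b d : ℝ} (ha : 0 < a) (har : a ≤ r) (hb : 0 < b) (hbr : b ≤ r) (hd : 0 < d) (hdr : d ≤ r) :
    |D3 (u t) x1 (a • esingle i) (b • esingle j) (d • esingle k)| ≤
      (a * b * d) ^ β * (K1 + 8 * N * (a ^ 2 + b ^ 2 + d ^ 2) / r ^ 2) := by
  have p := h.D3one hβ hr hs he he8 hκ hG k1 k2 c1 c2 ht i j k ha har hb hbr hd hdr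
  have q := h.neg.D3one hβ hr hs he he8 hκ hG k1 k2 c1 c2 ht i j k ha har hb hbr hd hdr
  rw [D3_neg] at q
  rw [abs_le]
  constructor <;> linarith
end

section
variable {T α l0 L M N A2 C2 D2 U2 ρ : ℝ} {x1 : V3} {Ω : Set V3} {u c : ℝ → V3 → ℝ}
    {A H : ℝ → V3 → Mat3}

lemma Loc.small (h : Loc T α l0 L M N A2 C2 D2 U2 ρ x1 Ω u c A H) {β r e G K1 κ : ℝ}
    (hβ : β = (2 + α) / 3) (hr : 0 < r)
    (hs : 8 * r ≤ ρ) (he : 0 < e) (he8 : 8 * e ≤ ρ) (hκ : 0 < κ)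
    (hG : G = 9 * A2 * (M / r ^ 2 + N * (2 * r) ^ α) + 9 * A2 * (4 * r) ^ α * N + C2 * M
      + D2 * (11 * M * e ^ (-α) + 18 * e ^ 2 * N))
    (k1 : 8 * U2 ≤ K1) (k2 : 8 * M * (κ * r) ^ (-(2 + α)) ≤ K1)
    (c1 : (8 * N) * 6 * (l0 + L) * κ ^ 2 ≤ l0 * (β * (1 - β)) * K1 / 2)
    (c2 : 8 * G ≤ l0 * (β * (1 - β)) * K1 / 2) {t : ℝ} (ht : t ∈ Set.Icc 0 T) (i j k : Fin 3)
    {ε w : ℝ} (hε : 0 < ε) (hε1 : ε ≤ 1) (hw : 0 < w) (hwr : w ≤ r) :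
    |H t (x1 + w • esingle k) i j - H t (x1 - w • esingle k) i j| ≤
      w ^ α * (2 * N * (2 * ε) ^ α + ε ^ (2 * β - 2) / 4 * (K1 + 24 * N * (w / r) ^ 2)) := by
  have hN := h.hN
  have hα0 := h.hα0
  have ha : 0 < ε * w := by positivity
  have haw : ε * w ≤ w := by nlinarith
  have hD := h.D3abs hβ hr hs he he8 hκ hG k1 k2 c1 c2 ht i j k ha (haw.trans hwr) ha (haw.trans hwr) hw hwr
  obtain ⟨G1, G2, hh⟩ := h.c2 t ht
  have nw : ‖w • esingle k‖ = w := by rw [norm_smul_es, abs_of_pos hw]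
  obtain ⟨z, hz, hzD⟩ := hh.D3eq x1 (ε * w) (ε * w) ha ha (w • esingle k) i j
    (fun z hz => h.sub z (by rw [nw] at hz; linarith))
  have q1 : |H t (x1 + w • esingle k) i j - H t (z + w • esingle k) i j| ≤ N * (2 * ε * w) ^ α := by
    refine (h.hol t ht _ _ ?_ ?_ i j).trans ?_
    · rw [add_sub_cancel_left, nw]; linarith
    · rw [show z + w • esingle k - x1 = (z - x1) + w • esingle k by abel]
      refine (norm_add_le _ _).trans ?_
      rw [nw]; linarith
    · rw [add_sub_add_right_eq_sub, norm_sub_rev]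
      have : ‖z - x1‖ ≤ 2 * ε * w := by linarith
      gcongr
  have q2 : |H t (x1 - w • esingle k) i j - H t (z - w • esingle k) i j| ≤ N * (2 * ε * w) ^ α := by
    refine (h.hol t ht _ _ ?_ ?_ i j).trans ?_
    · rw [show x1 - w • esingle k - x1 = - (w • esingle k) by abel, norm_neg, nw]; linarith
    · rw [show z - w • esingle k - x1 = (z - x1) - w • esingle k by abel]
      refine (norm_sub_le _ _).trans ?_
      rw [nw]; linarith
    · rw [sub_sub_sub_cancel_right, norm_sub_rev]
      have : ‖z - x1‖ ≤ 2 * ε * w := by linarith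
      gcongr
  have e1 : (2 * ε * w) ^ α = (2 * ε) ^ α * w ^ α := Real.mul_rpow (by positivity) hw.le
  have e2 : (ε * w * (ε * w) * w) ^ β = 4 * (ε * w) * (ε * w) * (ε ^ (2 * β - 2) / 4 * w ^ α) := by
    have : ε * w * (ε * w) * w = ε ^ (2:ℝ) * w ^ (3:ℝ) := by
      rw [show (3:ℝ) = ((3:ℕ):ℝ) by norm_num, show (2:ℝ) = ((2:ℕ):ℝ) by norm_num, Real.rpow_natCast,
        Real.rpow_natCast]; ring
    rw [this, Real.mul_rpow (by positivity) (by positivity), ← Real.rpow_mul hε.le, ← Real.rpow_mul hw.le,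
      show 3 * β = α + 2 by rw [hβ]; ring, Real.rpow_add hw, show 2 * β = (2 * β - 2) + 2 by ring,
      Real.rpow_add hε, show (2:ℝ) = ((2:ℕ):ℝ) by norm_num, Real.rpow_natCast, Real.rpow_natCast]
    push_cast
    ring_nf
  have q3 : |H t (z + w • esingle k) i j - H t (z - w • esingle k) i j| ≤
      ε ^ (2 * β - 2) / 4 * w ^ α * (K1 + 24 * N * (w / r) ^ 2) := by
    rw [hzD, abs_mul, abs_of_pos (by positivity : 0 < 4 * (ε * w) * (ε * w)), e2,
      mul_assoc (4 * (ε * w) * (ε * w)) (ε ^ (2 * β - 2) / 4 * w ^ α)] at hD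
    have := le_of_mul_le_mul_left hD (by positivity : 0 < 4 * (ε * w) * (ε * w))
    refine this.trans ?_
    have : 8 * N * ((ε * w) ^ 2 + (ε * w) ^ 2 + w ^ 2) / r ^ 2 ≤ 24 * N * (w / r) ^ 2 := by
      rw [div_pow, ← mul_div_assoc]
      have : (ε * w) ^ 2 ≤ w ^ 2 := by gcongr
      have : N * (ε * w) ^ 2 ≤ N * w ^ 2 := by gcongr
      refine div_le_div_of_nonneg_right ?_ (by positivity)
      linarith
    gcongr
  rw [e1] at q1 q2
  rw [abs_le] at q1 q2 q3 ⊢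
  have e3 : w ^ α * (2 * N * (2 * ε) ^ α + ε ^ (2 * β - 2) / 4 * (K1 + 24 * N * (w / r) ^ 2)) =
    N * ((2 * ε) ^ α * w ^ α) + N * ((2 * ε) ^ α * w ^ α) +
      ε ^ (2 * β - 2) / 4 * w ^ α * (K1 + 24 * N * (w / r) ^ 2) := by ring
  rw [e3]
  constructor <;> linarith [q1.1, q1.2, q2.1, q2.2, q3.1, q3.2]
end

def ep (α : ℝ) : ℝ := (1 / 1024 : ℝ) ^ (1 / α) / 2
def Ce (α : ℝ) : ℝ := ep α ^ (2 * ((2 + α) / 3) - 2) / 4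
def d1 (α : ℝ) : ℝ := 1 / (64 * Ce α)
def dp (α : ℝ) : ℝ := min 1 (1 / (12288 * Ce α))
def be (α : ℝ) : ℝ := (2 + α) / 3 * (1 - (2 + α) / 3)
def d2 (α : ℝ) : ℝ := min (d1 α / 1728) (1 / 16)
def d3 (α : ℝ) : ℝ := min (d1 α / 1152) (1 / 256)

lemma ep_pos (α : ℝ) : 0 < ep α := by unfold ep; positivity
lemma ep_le {α : ℝ} (h : 0 < α) : ep α ≤ 1 := by
  unfold ep
  have : (1 / 1024 : ℝ) ^ (1 / α) ≤ 1 := Real.rpow_le_one (by norm_num) (by norm_num) (by positivity)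
  linarith
lemma ep_pow {α : ℝ} (h : 0 < α) : (2 * ep α) ^ α = 1 / 1024 := by
  unfold ep
  rw [mul_div_cancel₀ _ (by norm_num), ← Real.rpow_mul (by norm_num), one_div_mul_cancel h.ne', Real.rpow_one]
lemma Ce_pos (α : ℝ) : 0 < Ce α := by unfold Ce; have := ep_pos α; positivity
lemma d1_pos (α : ℝ) : 0 < d1 α := by unfold d1; have := Ce_pos α; positivity
lemma dp_pos (α : ℝ) : 0 < dp α := by unfold dp; have := Ce_pos α; positivity
lemma d2_pos (α : ℝ) : 0 < d2 α := by unfold d2; have := d1_pos α; positivity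
lemma d3_pos (α : ℝ) : 0 < d3 α := by unfold d3; have := d1_pos α; positivity
lemma be_pos {α : ℝ} (h : 0 < α) (h1 : α < 1) : 0 < be α := by
  unfold be; apply mul_pos <;> linarith
lemma d1_Ce (α : ℝ) : Ce α * d1 α = 1 / 64 := by
  unfold d1; have := Ce_pos α; field_simp
lemma dp_Ce (α : ℝ) : Ce α * (192 * dp α ^ 2) ≤ 1 / 64 := by
  have h0 := dp_pos α
  have h1 : dp α ≤ 1 := min_le_left _ _
  have h2 : dp α ≤ 1 / (12288 * Ce α) := min_le_right _ _
  have hc := Ce_pos α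
  have h3 : dp α ^ 2 ≤ dp α := by nlinarith
  calc Ce α * (192 * dp α ^ 2) ≤ Ce α * (192 * (1 / (12288 * Ce α))) := by gcongr; linarith
    _ = 1 / 64 := by field_simp; norm_num

/-- Combination of the small and the large scales along a coordinate direction. -/
lemma axis {T α l0 L M s A2 C2 D2 U2 ρ : ℝ} {x1 : V3} {Ω : Set V3} {u c : ℝ → V3 → ℝ}
    {A H : ℝ → V3 → Mat3} {r e G K2 κ w : ℝ} (k : Fin 3) (hs0 : 0 ≤ s)
    (h : Loc T α l0 L M (8 * s) A2 C2 D2 U2 ρ x1 Ω u c A H)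
    (hp : Loc T α l0 L M (8 * s) A2 C2 D2 U2 ρ (x1 + w • esingle k) Ω u c A H)
    (hm : Loc T α l0 L M (8 * s) A2 C2 D2 U2 ρ (x1 - w • esingle k) Ω u c A H)
    (hr : 0 < r)
    (hs : 8 * r ≤ ρ) (he : 0 < e) (he8 : 8 * e ≤ ρ) (hκ : 0 < κ)
    (hG : G = 9 * A2 * (M / r ^ 2 + 8 * s * (2 * r) ^ α) + 9 * A2 * (4 * r) ^ α * (8 * s) + C2 * M
      + D2 * (11 * M * e ^ (-α) + 18 * e ^ 2 * (8 * s)))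
    (k1 : 8 * U2 ≤ K2) (k2 : 8 * M * (κ * r) ^ (-(2 + α)) ≤ K2)
    (c1 : 768 * (l0 + L) * κ ^ 2 ≤ l0 * be α * d1 α)
    (c2 : 16 * G ≤ l0 * be α * (d1 α * s + K2)) {t : ℝ} (ht : t ∈ Set.Icc 0 T) (i j : Fin 3)
    (hw : 0 < w) :
    |H t (x1 + w • esingle k) i j - H t (x1 - w • esingle k) i j| ≤
      w ^ α * (3 / 64 * s + Ce α * K2 + 2 * M * ep α ^ (-(2:ℝ)) * (dp α * r) ^ (-(2 + α))) := by
  have hα0 := h.hα0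
  have hM := h.hM
  have hε := ep_pos α
  have hCe := Ce_pos α
  have hdp := dp_pos α
  have hd1 := d1_pos α
  have hdp1 : dp α ≤ 1 := min_le_left _ _
  have hU2 := h.hU2
  have hK2 : 0 ≤ K2 := by linarith
  have hbe := be_pos h.hα0 h.hα1
  have hl0 := h.hl0
  have hε1 := ep_le hα0
  by_cases hc : w ≤ dp α * r
  · have hwr : w ≤ r := by nlinarith
    have key := h.small (K1 := d1 α * s + K2) rfl hr hs he he8 hκ hG (by nlinarith) (by nlinarith)
      (by
        have := mul_le_mul_of_nonneg_left c1 hs0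
        have h2 : 0 ≤ l0 * be α * K2 := by positivity
        unfold be at this h2
        nlinarith) (by unfold be at c2; linarith) ht i j k hε (ep_le hα0) hw hwr
    refine key.trans ?_
    have hwd : (w / r) ^ 2 ≤ dp α ^ 2 := by
      have : w / r ≤ dp α := by rwa [div_le_iff₀ hr]
      gcongr
    rw [ep_pow hα0]
    have hCe' : ep α ^ (2 * ((2 + α) / 3) - 2) / 4 = Ce α := rfl
    rw [hCe']
    refine mul_le_mul_of_nonneg_left ?_ (by positivity)
    have f1 := d1_Ce α
    have f2 := dp_Ce α
    have f3 : Ce α * (24 * (8 * s) * (w / r) ^ 2) ≤ s * (Ce α * (192 * dp α ^ 2)) := by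
      calc Ce α * (24 * (8 * s) * (w / r) ^ 2) = s * (Ce α * (192 * (w / r) ^ 2)) := by ring
        _ ≤ _ := by gcongr
    have f4 : s * (Ce α * (192 * dp α ^ 2)) ≤ s * (1 / 64) := by gcongr
    have f5 : Ce α * (d1 α * s + K2 + 24 * (8 * s) * (w / r) ^ 2) =
      (Ce α * d1 α) * s + Ce α * K2 + Ce α * (24 * (8 * s) * (w / r) ^ 2) := by ring
    rw [f5, f1]
    have f6 : 0 ≤ 2 * M * ep α ^ (-(2:ℝ)) * (dp α * r) ^ (-(2 + α)) := by positivity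
    linarith
  · push Not at hc
    set h0 := dp α * r with hh0
    have hh00 : 0 < h0 := by positivity
    have hh0r : h0 ≤ r := by nlinarith
    have hεh : ep α * h0 ≤ r := by nlinarith
    have b1 := hp.Hb (r := ep α * h0) (s := 0) (by positivity) (by linarith) ht (y := x1 + w • esingle k) (by simp) i j
    have b2 := hm.Hb (r := ep α * h0) (s := 0) (by positivity) (by linarith) ht (y := x1 - w • esingle k) (by simp) i j
    have e1 : M / (ep α * h0) ^ 2 = M * ep α ^ (-(2:ℝ)) * h0 ^ (-(2 + α)) * h0 ^ α := by
      rw [mul_assoc _ (h0 ^ _), ← Real.rpow_add hh00, show -(2 + α) + α = -(2:ℝ) by ring,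
        Real.rpow_neg hε.le, Real.rpow_neg hh00.le, show (2:ℝ) = ((2:ℕ):ℝ) by norm_num, Real.rpow_natCast,
        Real.rpow_natCast]
      field_simp
    have e2 : (2 * (ep α * h0)) ^ α = 1 / 1024 * h0 ^ α := by
      rw [← mul_assoc, Real.mul_rpow (by positivity) hh00.le, ep_pow hα0]
    rw [e1, e2] at b1 b2
    have e3 : h0 ^ α ≤ w ^ α := by gcongr
    set X := M * ep α ^ (-(2:ℝ)) * h0 ^ (-(2 + α)) with hX
    have hX0 : 0 ≤ X := by positivity
    have e4 : 2 * (X * h0 ^ α + 8 * s * (1 / 1024 * h0 ^ α)) ≤ w ^ α * (1 / 64 * s + 2 * X) := by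
      calc 2 * (X * h0 ^ α + 8 * s * (1 / 1024 * h0 ^ α)) = h0 ^ α * (1 / 64 * s + 2 * X) := by ring
        _ ≤ _ := by gcongr
    have e5 : w ^ α * (1 / 64 * s + 2 * X) ≤ w ^ α * (3 / 64 * s + Ce α * K2 + 2 * M * ep α ^ (-(2:ℝ)) * h0 ^ (-(2 + α))) := by
      refine mul_le_mul_of_nonneg_left ?_ (by positivity)
      have : 0 ≤ Ce α * K2 := by positivity
      have : 2 * X = 2 * M * ep α ^ (-(2:ℝ)) * h0 ^ (-(2 + α)) := by rw [hX]; ring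
      linarith
    have := abs_sub (H t (x1 + w • esingle k) i j) (H t (x1 - w • esingle k) i j)
    linarith

set_option maxHeartbeats 4000000 in
lemma params (α lam Lam : ℝ) (h0 : 0 < α) (h1 : α < 1) (hl : 0 < lam) (hL : 0 < Lam) :
    ∃ C0 : ℝ, 0 < C0 ∧ ∀ (γ J Ab Cb Db U M l0 : ℝ), γ ∈ Set.Icc (-3 : ℝ) (-2) → 1 ≤ J → 0 ≤ Ab → 0 ≤ Cb →
      0 ≤ Db → 0 ≤ U → 0 ≤ M → l0 = lam * J ^ γ / 8 →
      ∃ θ τ κ K : ℝ, 0 < θ ∧ θ ≤ 1 / 16 ∧ 0 < τ ∧ τ ≤ 1 / 16 ∧ 0 < κ ∧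
        768 * (l0 + Lam) * κ ^ 2 ≤ l0 * be α * d1 α ∧ 64 * U ≤ K ∧
        8 * M * (κ * θ) ^ (-(2 + α)) ≤ K ∧
        (∀ S, 0 ≤ S → 16 * (S * (864 * Ab * θ ^ α + 576 * Db * τ ^ 2) +
          M * (18 * Ab * (θ ^ 2)⁻¹ + 8 * Cb + 44 * Db * τ ^ (-α))) ≤ l0 * be α * (d1 α * S + K)) ∧
        3 * (Ce α * K + 2 * M * ep α ^ (-(2:ℝ)) * (dp α * θ) ^ (-(2 + α))) ≤ C0 * (U +
           ((1 + Ab) ^ (1 + 2 / α) * J ^ ((2 - γ) * (1 + 2 / α)) + Cb * J ^ (-γ) +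
                  (1 + Db) ^ (1 + α / 2) * J ^ (-γ * (1 + α / 2))) * M) := by
  have hbe := be_pos h0 h1
  have hd1 := d1_pos α
  have hd2 := d2_pos α
  have hd3 := d3_pos α
  have hCe := Ce_pos α
  have hep := ep_pos α
  have hdp := dp_pos α
  have d2a : d2 α ≤ d1 α / 1728 := min_le_left _ _
  have d2b : d2 α ≤ 1 / 16 := min_le_right _ _
  have d3a : d3 α ≤ d1 α / 1152 := min_le_left _ _
  have d3b : d3 α ≤ 1 / 256 := min_le_right _ _
  obtain ⟨a, ha⟩ : ∃ x : ℝ, x = 1 + 2 / α := ⟨_, rfl⟩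
  obtain ⟨b, hb⟩ : ∃ x : ℝ, x = 1 + α / 2 := ⟨_, rfl⟩
  have ha3 : 3 ≤ a := by
    have : 2 ≤ 2 / α := by rw [le_div_iff₀ h0]; linarith
    linarith
  have haα : a * α = 2 + α := by rw [ha]; field_simp; ring
  obtain ⟨p0, hp0⟩ : ∃ x : ℝ, x = 128 / (lam * be α) + 1 := ⟨_, rfl⟩
  have hp00 : 1 ≤ p0 := by
    have : 0 < 128 / (lam * be α) := by positivity
    linarith
  obtain ⟨k0, hk0⟩ : ∃ x : ℝ, x = 768 * (lam + Lam) * 8 / (lam * be α * d1 α) := ⟨_, rfl⟩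
  have hk00 : 0 < k0 := by rw [hk0]; positivity
  obtain ⟨q2, hq2⟩ : ∃ x : ℝ, x = (p0 / d2 α) ^ a := ⟨_, rfl⟩
  obtain ⟨q3, hq3⟩ : ∃ x : ℝ, x = (p0 / d3 α) ^ b := ⟨_, rfl⟩
  have hq20 : 0 < q2 := by rw [hq2]; positivity
  have hq30 : 0 < q3 := by rw [hq3]; positivity
  obtain ⟨E, hE⟩ : ∃ x : ℝ, x = 2 * ep α ^ (-(2:ℝ)) * dp α ^ (-(2 + α)) := ⟨_, rfl⟩
  have hE0 : 0 < E := by rw [hE]; positivity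
  refine ⟨3 * (Ce α * (64 + 8 * (k0 ^ b * q2) + 18 * q2 + 8 * p0 + 44 * q3) + E * q2), by positivity, ?_⟩
  intro γ J Ab Cb Db U M l0 hγ hJ hA hC hD hU hM hl0
  have hJ0 : 0 < J := by linarith
  obtain ⟨Z, hZ⟩ : ∃ x : ℝ, x = J ^ (-γ) := ⟨_, rfl⟩
  have hZ1 : 1 ≤ Z := hZ ▸ Real.one_le_rpow hJ (by linarith [hγ.2])
  have hZ0 : 0 < Z := by linarith
  have hJγ : J ^ γ = Z⁻¹ := by rw [hZ, ← Real.rpow_neg hJ0.le, neg_neg]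
  rw [hJγ] at hl0
  have hl00 : 0 < l0 := by rw [hl0]; positivity
  have hll : l0 ≤ lam := by
    rw [hl0]
    have : Z⁻¹ ≤ 1 := inv_le_one_of_one_le₀ hZ1
    have := mul_le_mul_of_nonneg_left this hl.le
    linarith
  obtain ⟨Q, hQ⟩ : ∃ x : ℝ, x = p0 * Z := ⟨_, rfl⟩
  have hQ1 : 1 ≤ Q := by rw [hQ]; exact one_le_mul_of_one_le_of_one_le hp00 hZ1
  have hQ0 : 0 < Q := by linarith
  have hQl : 16 ≤ l0 * be α * Q := by
    rw [hl0, hQ, hp0]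
    have : lam * Z⁻¹ / 8 * be α * ((128 / (lam * be α) + 1) * Z) = 16 + lam * be α / 8 := by
      field_simp
      ring
    rw [this]
    have : 0 < lam * be α / 8 := by positivity
    linarith
  obtain ⟨X, hX⟩ : ∃ x : ℝ, x = 1 + Ab := ⟨_, rfl⟩
  have hX1 : 1 ≤ X := by linarith
  obtain ⟨W, hW⟩ : ∃ x : ℝ, x = 1 + Db := ⟨_, rfl⟩
  have hW1 : 1 ≤ W := by linarith
  have hQX : 1 ≤ Q * X := one_le_mul_of_one_le_of_one_le hQ1 hX1
  have hQW : 1 ≤ Q * W := one_le_mul_of_one_le_of_one_le hQ1 hW1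
  obtain ⟨θ, hθ⟩ : ∃ θ, θ = (d2 α / (Q * X)) ^ (1 / α) := ⟨_, rfl⟩
  obtain ⟨τ, hτ⟩ : ∃ τ, τ = (d3 α / (Q * W)) ^ (1 / 2 : ℝ) := ⟨_, rfl⟩
  obtain ⟨κ, hκ⟩ : ∃ κ, κ = (l0 * be α * d1 α / (768 * (l0 + Lam))) ^ (1 / 2 : ℝ) := ⟨_, rfl⟩
  have hθ0 : 0 < θ := by rw [hθ]; positivity
  have hτ0 : 0 < τ := by rw [hτ]; positivity
  have hκ0 : 0 < κ := by rw [hκ]; positivity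
  have hθα : θ ^ α = d2 α / (Q * X) := by
    rw [hθ, ← Real.rpow_mul (by positivity), one_div_mul_cancel h0.ne', Real.rpow_one]
  have hτ2 : τ ^ 2 = d3 α / (Q * W) := by
    rw [hτ, ← Real.rpow_natCast, ← Real.rpow_mul (by positivity)]; norm_num
  have hκ2 : κ ^ 2 = l0 * be α * d1 α / (768 * (l0 + Lam)) := by
    rw [hκ, ← Real.rpow_natCast, ← Real.rpow_mul (by positivity)]; norm_num
  have hθn : θ ^ (-(2 + α)) = q2 * Z ^ a * X ^ a := by
    rw [← haα, neg_mul_eq_mul_neg, mul_comm, Real.rpow_mul hθ0.le, Real.rpow_neg hθ0.le, hθα, inv_div, hq2,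
      ← Real.mul_rpow (by positivity) (by positivity), ← Real.mul_rpow (by positivity) (by positivity), hQ]
    congr 1; ring
  have hsq : ∀ x : ℝ, 0 < x → x ^ (-(2 + α)) = ((x ^ 2)⁻¹) ^ b := by
    intro x hx
    rw [← Real.rpow_natCast, ← Real.rpow_neg hx.le, ← Real.rpow_mul hx.le, hb]
    congr 1; push_cast; ring
  have hτn : τ ^ (-(2 + α)) = q3 * Z ^ b * W ^ b := by
    rw [hsq τ hτ0, hτ2, inv_div, hq3,
      ← Real.mul_rpow (by positivity) (by positivity), ← Real.mul_rpow (by positivity) (by positivity), hQ]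
    congr 1; ring
  have hb0 : 0 ≤ b := by rw [hb]; linarith
  have hκn : κ ^ (-(2 + α)) ≤ k0 ^ b * Z ^ b := by
    rw [hsq κ hκ0, hκ2, inv_div, ← Real.mul_rpow (by positivity) (by positivity)]
    have : 768 * (l0 + Lam) / (l0 * be α * d1 α) ≤ k0 * Z := by
      calc 768 * (l0 + Lam) / (l0 * be α * d1 α) ≤ 768 * (lam + Lam) / (l0 * be α * d1 α) := by gcongr
        _ = k0 * Z := by rw [hk0, hl0]; field_simp
    gcongr
  have hZb : Z ^ b = J ^ (-γ * b) := by rw [hZ, ← Real.rpow_mul hJ0.le]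
  have hZa : Z ^ a ≤ J ^ ((2 - γ) * a) := by
    rw [hZ, ← Real.rpow_mul hJ0.le]
    apply Real.rpow_le_rpow_of_exponent_le hJ
    linarith
  have hZab : Z ^ b * Z ^ a ≤ J ^ ((2 - γ) * a) := by
    rw [hZ, ← Real.rpow_mul hJ0.le, ← Real.rpow_mul hJ0.le, ← Real.rpow_add hJ0]
    apply Real.rpow_le_rpow_of_exponent_le hJ
    have : -γ * b ≤ 3 * (3 / 2) := by
      apply mul_le_mul <;> linarith [hγ.1]
    linarith
  obtain ⟨T1, hT1⟩ : ∃ x : ℝ, x = X ^ a * J ^ ((2 - γ) * a) := ⟨_, rfl⟩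
  obtain ⟨T3, hT3⟩ : ∃ x : ℝ, x = W ^ b * J ^ (-γ * b) := ⟨_, rfl⟩
  have hT10 : 0 ≤ T1 := by rw [hT1]; positivity
  have hT30 : 0 ≤ T3 := by rw [hT3]; positivity
  have B1 : θ ^ (-(2 + α)) ≤ q2 * T1 := by
    rw [hθn, hT1, mul_assoc, mul_comm (Z ^ a)]; gcongr
  have B2 : (κ * θ) ^ (-(2 + α)) ≤ k0 ^ b * q2 * T1 := by
    rw [Real.mul_rpow hκ0.le hθ0.le]
    calc κ ^ (-(2 + α)) * θ ^ (-(2 + α)) ≤ (k0 ^ b * Z ^ b) * (q2 * Z ^ a * X ^ a) := by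
          rw [hθn]; exact mul_le_mul_of_nonneg_right hκn (by positivity)
      _ = k0 ^ b * q2 * (X ^ a * (Z ^ b * Z ^ a)) := by ring
      _ ≤ _ := by rw [hT1]; gcongr
  have B3 : Q * Ab * (θ ^ 2)⁻¹ ≤ q2 * T1 := by
    refine le_trans ?_ B1
    have e : θ ^ (-(2 + α)) = (Q * X / d2 α) * (θ ^ 2)⁻¹ := by
      rw [neg_add, Real.rpow_add hθ0, Real.rpow_neg hθ0.le α, hθα, inv_div, Real.rpow_neg hθ0.le 2]
      rw [mul_comm]; norm_num
    rw [e]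
    refine mul_le_mul_of_nonneg_right ?_ (by positivity)
    rw [le_div_iff₀ hd2]
    have : Q * Ab * d2 α ≤ Q * X * 1 := by
      apply mul_le_mul _ (by linarith) hd2.le (by positivity)
      apply mul_le_mul_of_nonneg_left _ hQ0.le; linarith
    linarith
  have B4 : Q * Db * τ ^ (-α) ≤ q3 * T3 := by
    have e0 : τ ^ (-(2 + α)) = q3 * T3 := by rw [hτn, hT3, hZb]; ring
    rw [← e0]
    have e : τ ^ (-(2 + α)) = (Q * W / d3 α) * τ ^ (-α) := by
      rw [neg_add, Real.rpow_add hτ0, Real.rpow_neg hτ0.le 2]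
      rw [show (2:ℝ) = ((2:ℕ):ℝ) by norm_num, Real.rpow_natCast, hτ2, inv_div]
    rw [e]
    refine mul_le_mul_of_nonneg_right ?_ (by positivity)
    rw [le_div_iff₀ hd3]
    have : Q * Db * d3 α ≤ Q * W * 1 := by
      apply mul_le_mul _ (by linarith) hd3.le (by positivity)
      apply mul_le_mul_of_nonneg_left _ hQ0.le; linarith
    linarith
  have B5 : (dp α * θ) ^ (-(2 + α)) ≤ dp α ^ (-(2 + α)) * (q2 * T1) := by
    rw [Real.mul_rpow hdp.le hθ0.le]; gcongr
  rw [← ha, ← hb, ← hX, ← hW, ← hT1, ← hT3, ← hZ]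
  refine ⟨θ, τ, κ, 64 * U + 8 * M * (κ * θ) ^ (-(2 + α)) +
    Q * M * (18 * Ab * (θ ^ 2)⁻¹ + 8 * Cb + 44 * Db * τ ^ (-α)), hθ0, ?_, hτ0, ?_, hκ0, ?_, ?_, ?_, ?_, ?_⟩
  · by_contra hc
    push Not at hc
    have q1 : (1 / 16 : ℝ) ^ α < θ ^ α := Real.rpow_lt_rpow (by norm_num) hc h0
    have q2 : θ ^ α ≤ 1 / 16 := by
      rw [hθα, div_le_iff₀ (by positivity)]; linarith
    have q3 : (1 / 16 : ℝ) ^ (1:ℝ) ≤ (1 / 16 : ℝ) ^ α :=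
      Real.rpow_le_rpow_of_exponent_ge (by norm_num) (by norm_num) h1.le
    rw [Real.rpow_one] at q3
    linarith
  · by_contra hc
    push Not at hc
    have q2 : τ ^ 2 ≤ 1 / 256 := by
      rw [hτ2, div_le_iff₀ (by positivity)]; linarith
    have q4 : (1 / 16) * (1 / 16) < τ * τ := mul_lt_mul'' hc hc (by norm_num) (by norm_num)
    linarith
  · rw [hκ2]; apply le_of_eq; field_simp
  · have : 0 ≤ 8 * M * (κ * θ) ^ (-(2 + α)) := by positivity
    have : 0 ≤ Q * M * (18 * Ab * (θ ^ 2)⁻¹ + 8 * Cb + 44 * Db * τ ^ (-α)) := by positivity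
    linarith
  · have : 0 ≤ Q * M * (18 * Ab * (θ ^ 2)⁻¹ + 8 * Cb + 44 * Db * τ ^ (-α)) := by positivity
    linarith
  · intro S hS
    have m0 : 0 ≤ l0 * be α * (64 * U + 8 * M * (κ * θ) ^ (-(2 + α))) := by positivity
    have m1 : 16 * (864 * Ab * θ ^ α + 576 * Db * τ ^ 2) ≤ l0 * be α * d1 α := by
      have n1 : Ab * θ ^ α ≤ d2 α / Q := by
        rw [hθα, mul_div_assoc', div_le_div_iff₀ (by positivity) hQ0]
        have := mul_le_mul_of_nonneg_left (show Ab ≤ X by linarith) (by positivity : 0 ≤ d2 α * Q)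
        linarith
      have n2 : Db * τ ^ 2 ≤ d3 α / Q := by
        rw [hτ2, mul_div_assoc', div_le_div_iff₀ (by positivity) hQ0]
        have := mul_le_mul_of_nonneg_left (show Db ≤ W by linarith) (by positivity : 0 ≤ d3 α * Q)
        linarith
      have n3 : d2 α / Q ≤ d1 α / 1728 / Q := by gcongr
      have n4 : d3 α / Q ≤ d1 α / 1152 / Q := by gcongr
      have n5 : 16 * d1 α / Q ≤ l0 * be α * d1 α := by
        rw [div_le_iff₀ hQ0]; have := mul_le_mul_of_nonneg_right hQl hd1.le; linarith
      have n6 : 16 * (864 * (d1 α / 1728 / Q) + 576 * (d1 α / 1152 / Q)) = 16 * d1 α / Q := by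
        field_simp; norm_num
      linarith
    have m2 := mul_le_mul_of_nonneg_right m1 hS
    have m3 : 0 ≤ M * (18 * Ab * (θ ^ 2)⁻¹ + 8 * Cb + 44 * Db * τ ^ (-α)) := by positivity
    have m4 := mul_le_mul_of_nonneg_right hQl m3
    linarith
  · have f1 : Ce α * (64 * U + 8 * M * (κ * θ) ^ (-(2 + α)) +
        Q * M * (18 * Ab * (θ ^ 2)⁻¹ + 8 * Cb + 44 * Db * τ ^ (-α))) ≤
        Ce α * (64 * U + M * (8 * (k0 ^ b * q2 * T1) + 18 * (q2 * T1) + 8 * p0 * (Cb * Z) + 44 * (q3 * T3))) := by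
      refine mul_le_mul_of_nonneg_left ?_ hCe.le
      have := mul_le_mul_of_nonneg_left B2 hM
      have := mul_le_mul_of_nonneg_left B3 hM
      have := mul_le_mul_of_nonneg_left B4 hM
      have : Q * M * (8 * Cb) = M * (8 * p0 * (Cb * Z)) := by rw [hQ]; ring
      linarith
    have f2 : 2 * M * ep α ^ (-(2:ℝ)) * (dp α * θ) ^ (-(2 + α)) ≤ M * (E * (q2 * T1)) := by
      calc 2 * M * ep α ^ (-(2:ℝ)) * (dp α * θ) ^ (-(2 + α))
          ≤ 2 * M * ep α ^ (-(2:ℝ)) * (dp α ^ (-(2 + α)) * (q2 * T1)) := mul_le_mul_of_nonneg_left B5 (by positivity)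
        _ = _ := by rw [hE]; ring
    have f3 : Ce α * (64 * U + M * (8 * (k0 ^ b * q2 * T1) + 18 * (q2 * T1) + 8 * p0 * (Cb * Z) + 44 * (q3 * T3)))
       + M * (E * (q2 * T1)) ≤ (Ce α * (64 + 8 * (k0 ^ b * q2) + 18 * q2 + 8 * p0 + 44 * q3) + E * q2) * (U + (T1 + Cb * Z + T3) * M) := by
      obtain ⟨g1, hg1⟩ : ∃ g, g = k0 ^ b * q2 := ⟨_, rfl⟩
      have hg10 : 0 ≤ g1 := by rw [hg1]; positivity
      rw [← hg1]
      obtain ⟨T2, hT2⟩ : ∃ g, g = Cb * Z := ⟨_, rfl⟩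
      have hT20 : 0 ≤ T2 := by rw [hT2]; positivity
      rw [← hT2]
      have h2 : 64 * U + M * (8 * (g1 * T1) + 18 * (q2 * T1) + 8 * p0 * T2 + 44 * (q3 * T3)) ≤
          (64 + 8 * g1 + 18 * q2 + 8 * p0 + 44 * q3) * (U + (T1 + T2 + T3) * M) := by
        have : 0 ≤ (8 * g1 + 18 * q2 + 8 * p0 + 44 * q3) * U + 64 * ((T1 + T2 + T3) * M) + (8 * g1 + 18 * q2) * ((T2 + T3) * M)
          + 8 * p0 * ((T1 + T3) * M) + 44 * q3 * ((T1 + T2) * M) := by positivity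
        linarith
      have h3 := mul_le_mul_of_nonneg_left h2 hCe.le
      have h4 : M * (E * (q2 * T1)) ≤ E * q2 * (U + (T1 + T2 + T3) * M) := by
        have : 0 ≤ E * q2 * U + E * q2 * ((T2 + T3) * M) := by positivity
        linarith
      linarith
    rw [mul_assoc 3]
    refine mul_le_mul_of_nonneg_left ?_ (by norm_num)
    linarith

lemma le_dCube {v₀ : V3} {R d : ℝ} {v : V3} : d ≤ dCube v₀ R v ↔ ∀ i, |v i - v₀ i| ≤ R - d := by
  unfold dCube
  rw [Finset.le_inf'_iff]
  simp only [Finset.mem_univ, true_implies]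
  exact forall_congr' fun i => ⟨fun h => by linarith, fun h => by linarith⟩

lemma cube_of_dCube {v₀ : V3} {R d : ℝ} {v : V3} (hd : 0 < d) (h : d ≤ dCube v₀ R v) : v ∈ cube v₀ R := by
  intro i
  have := le_dCube.1 h i
  linarith

lemma dCube_pos {v₀ : V3} {R : ℝ} {v : V3} (h : v ∈ cube v₀ R) : 0 < dCube v₀ R v := by
  unfold dCube
  rw [Finset.lt_inf'_iff]
  intro i _
  have := h i
  linarith

lemma dCube_ball {v₀ : V3} {R d : ℝ} {p z : V3} (h : d ≤ dCube v₀ R p) (hz : ‖z - p‖ ≤ d / 2) :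
    d / 2 ≤ dCube v₀ R z := by
  rw [le_dCube] at *
  intro i
  have h1 := h i
  have h2 := (abs_coord_le (z - p) i).trans hz
  have h3 : z i - v₀ i = (z - p) i + (p i - v₀ i) := by simp
  rw [h3]
  have := abs_add_le ((z - p) i) (p i - v₀ i)
  linarith

lemma isOpen_cube (v₀ : V3) (R : ℝ) : IsOpen (cube v₀ R) := by
  have : cube v₀ R = ⋂ i : Fin 3, {v : V3 | |v i - v₀ i| < R} := by
    ext v; simp [cube]
  rw [this]
  apply isOpen_iInter_of_finite
  intro i
  apply isOpen_lt <;> fun_prop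

lemma wt {d m p x B y q : ℝ} (hd : 0 < d) (hm : d / 2 ≤ m) (hp : 0 ≤ p) (hq : (2:ℝ) ^ p ≤ q) (hx : 0 ≤ x)
    (hB : 0 ≤ B) (hy : 0 ≤ y) (h : m ^ p * x ≤ B * y) : x ≤ q * (B / d ^ p) * y := by
  have h1 : (d / 2) ^ p ≤ m ^ p := Real.rpow_le_rpow (by positivity) hm hp
  have h2 : (d / 2) ^ p * x ≤ B * y := (mul_le_mul_of_nonneg_right h1 hx).trans h
  rw [Real.div_rpow hd.le (by norm_num), div_mul_eq_mul_div, div_le_iff₀ (by positivity)] at h2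
  have hdp : 0 < d ^ p := by positivity
  have h3 : d ^ p * x ≤ B * y * q := h2.trans (mul_le_mul_of_nonneg_left hq (by positivity))
  have : q * (B / d ^ p) * y = B * y * q / d ^ p := by field_simp
  rw [this, le_div_iff₀ hdp]
  linarith

/-- Global hypotheses. -/
structure Glob (T α l0 L M Ab Cb Db U R : ℝ) (v₀ : V3) (u c : ℝ → V3 → ℝ)
    (A H : ℝ → V3 → Mat3) : Prop where
  hT : 0 ≤ T
  hα0 : 0 < α
  hα1 : α < 1
  hl0 : 0 < l0
  hL : 0 ≤ L
  hM : 0 ≤ M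
  hA : 0 ≤ Ab
  hC : 0 ≤ Cb
  hD : 0 ≤ Db
  hU : 0 ≤ U
  c2 : ∀ t ∈ Set.Icc 0 T, ∃ G1 G2, C2D (cube v₀ R) (u t) G1 G2 (H t)
  bd : ∀ t ∈ Set.Icc 0 T, ∀ z ∈ cube v₀ R, |u t z| ≤ M
  aH : ∀ t ∈ Set.Icc 0 T, ∀ v ∈ cube v₀ R, ∀ w ∈ cube v₀ R, ∀ i j,
    min (dCube v₀ R v) (dCube v₀ R w) ^ α * |A t v i j - A t w i j| ≤ Ab * ‖v - w‖ ^ α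
  cH : ∀ t ∈ Set.Icc 0 T, ∀ v ∈ cube v₀ R, ∀ w ∈ cube v₀ R,
    min (dCube v₀ R v) (dCube v₀ R w) ^ (2 + α) * |c t v - c t w| ≤ Cb * ‖v - w‖ ^ α
  cB : ∀ t ∈ Set.Icc 0 T, ∀ v ∈ cube v₀ R, dCube v₀ R v ^ 2 * |c t v| ≤ Db
  ini : ∀ v ∈ cube v₀ R, ∀ w ∈ cube v₀ R, ∀ i j,
    min (dCube v₀ R v) (dCube v₀ R w) ^ (2 + α) * |H 0 v i j - H 0 w i j| ≤ U * ‖v - w‖ ^ α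
  sym : ∀ t ∈ Set.Icc 0 T, ∀ y ∈ cube v₀ R, (A t y).IsSymm
  ell : ∀ t ∈ Set.Icc 0 T, ∀ y ∈ cube v₀ R, ∀ ξ : V3, l0 * ‖ξ‖ ^ 2 ≤ quadForm (A t y) ξ
  tr : ∀ t ∈ Set.Icc 0 T, ∀ y ∈ cube v₀ R, (A t y).trace ≤ 3 * L
  der : ∀ t ∈ Set.Icc 0 T, ∀ y ∈ cube v₀ R,
    HasDerivWithinAt (fun s => u s y) (matDot (A t y) (H t y) + c t y * u t y) (Set.Icc 0 T) t

def Valid (T α R : ℝ) (v₀ : V3) (H : ℝ → V3 → Mat3) (S : ℝ) : Prop :=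
  ∀ t ∈ Set.Icc 0 T, ∀ v ∈ cube v₀ R, ∀ w ∈ cube v₀ R, ∀ i j,
    min (dCube v₀ R v) (dCube v₀ R w) ^ (2 + α) * |H t v i j - H t w i j| ≤ S * ‖v - w‖ ^ α

section
variable {T α l0 L M Ab Cb Db U R : ℝ} {v₀ : V3} {u c : ℝ → V3 → ℝ} {A H : ℝ → V3 → Mat3}

lemma Glob.loc (g : Glob T α l0 L M Ab Cb Db U R v₀ u c A H) {S d : ℝ} (hS : 0 ≤ S)
    (hV : Valid T α R v₀ H S) (hd : 0 < d) {p : V3} (hp : d ≤ dCube v₀ R p) :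
    Loc T α l0 L M (8 * (S / d ^ (2 + α))) (2 * (Ab / d ^ α)) (8 * (Cb / d ^ (2 + α)))
      (4 * (Db / d ^ 2)) (8 * (U / d ^ (2 + α))) (d / 2) p (cube v₀ R) u c A H := by
  have hb : ∀ z, ‖z - p‖ ≤ d / 2 → z ∈ cube v₀ R := fun z hz =>
    cube_of_dCube (half_pos hd) (dCube_ball hp hz)
  have hmin : ∀ y z, ‖y - p‖ ≤ d / 2 → ‖z - p‖ ≤ d / 2 → d / 2 ≤ min (dCube v₀ R y) (dCube v₀ R z) :=
    fun y z hy hz => le_min (dCube_ball hp hy) (dCube_ball hp hz)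
  have hα0 := g.hα0
  have hα1 := g.hα1
  have hA := g.hA
  have hC := g.hC
  have hD := g.hD
  have hU := g.hU
  have p1 : (2:ℝ) ^ α ≤ 2 := by
    calc (2:ℝ) ^ α ≤ (2:ℝ) ^ (1:ℝ) := Real.rpow_le_rpow_of_exponent_le (by norm_num) hα1.le
      _ = 2 := by norm_num
  have p2 : (2:ℝ) ^ (2 + α) ≤ 8 := by
    calc (2:ℝ) ^ (2 + α) ≤ (2:ℝ) ^ (3:ℝ) := Real.rpow_le_rpow_of_exponent_le (by norm_num) (by linarith)
      _ = 8 := by norm_num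
  exact
  { hT := g.hT, hα0 := g.hα0, hα1 := g.hα1, hl0 := g.hl0, hL := g.hL, hM := g.hM
    hN := by positivity
    hA2 := by positivity
    hC2 := by positivity
    hD2 := by positivity
    hU2 := by positivity
    hρ := by positivity
    c2 := g.c2
    sub := hb
    bd := fun t ht z hz => g.bd t ht z (hb z hz)
    hol := fun t ht y z hy hz i j => wt hd (hmin y z hy hz) (by positivity) p2 (abs_nonneg _) hS (by positivity)
      (hV t ht y (hb y hy) z (hb z hz) i j)
    aH := fun t ht y z hy hz i j => wt hd (hmin y z hy hz) (by positivity) p1 (abs_nonneg _) hA (by positivity)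
      (g.aH t ht y (hb y hy) z (hb z hz) i j)
    cH := fun t ht y z hy hz => wt hd (hmin y z hy hz) (by positivity) p2 (abs_nonneg _) hC (by positivity)
      (g.cH t ht y (hb y hy) z (hb z hz))
    cB := fun t ht y hy => by
      have h1 := g.cB t ht y (hb y hy)
      have h2 := dCube_ball hp hy
      have h3 : (d / 2) ^ 2 ≤ dCube v₀ R y ^ 2 := by gcongr
      have h4 := (mul_le_mul_of_nonneg_right h3 (abs_nonneg (c t y))).trans h1
      rw [← mul_div_assoc, le_div_iff₀ (by positivity)]
      linarith
    ini := fun y z hy hz i j => wt hd (hmin y z hy hz) (by positivity) p2 (abs_nonneg _) hU (by positivity)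
      (g.ini y (hb y hy) z (hb z hz) i j)
    sym := fun t ht y hy => g.sym t ht y (hb y hy)
    ell := fun t ht y hy => g.ell t ht y (hb y hy)
    tr := fun t ht y hy => g.tr t ht y (hb y hy)
    der := fun t ht y hy => g.der t ht y (hb y hy) }

lemma Gbound {S d θ τ : ℝ} (hα0 : 0 < α) (hα1 : α < 1) (hd : 0 < d) (hθ : 0 < θ) (hτ : 0 < τ) (hS : 0 ≤ S) (hA : 0 ≤ Ab) :
    9 * (2 * (Ab / d ^ α)) * (M / (θ * d) ^ 2 + 8 * (S / d ^ (2 + α)) * (2 * (θ * d)) ^ α) +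
      9 * (2 * (Ab / d ^ α)) * (4 * (θ * d)) ^ α * (8 * (S / d ^ (2 + α))) + 8 * (Cb / d ^ (2 + α)) * M
      + 4 * (Db / d ^ 2) * (11 * M * (τ * d) ^ (-α) + 18 * (τ * d) ^ 2 * (8 * (S / d ^ (2 + α)))) ≤
    (S * (864 * Ab * θ ^ α + 576 * Db * τ ^ 2) +
          M * (18 * Ab * (θ ^ 2)⁻¹ + 8 * Cb + 44 * Db * τ ^ (-α))) / d ^ (2 + α) := by
  have e1 : d ^ (2 + α) = d ^ 2 * d ^ α := by
    rw [Real.rpow_add hd]; norm_num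
  have hP : 0 < d ^ α := by positivity
  have hθd : 0 ≤ θ * d := by positivity
  rw [Real.mul_rpow (x := 2) (by norm_num) hθd, Real.mul_rpow (x := 4) (by norm_num) hθd,
    Real.mul_rpow hθ.le hd.le, Real.mul_rpow hτ.le hd.le, Real.rpow_neg hd.le, e1]
  have p1 : (2:ℝ) ^ α ≤ 2 := by
    calc (2:ℝ) ^ α ≤ (2:ℝ) ^ (1:ℝ) := Real.rpow_le_rpow_of_exponent_le (by norm_num) hα1.le
      _ = 2 := by norm_num
  have p2 : (4:ℝ) ^ α ≤ 4 := by
    calc (4:ℝ) ^ α ≤ (4:ℝ) ^ (1:ℝ) := Real.rpow_le_rpow_of_exponent_le (by norm_num) hα1.le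
      _ = 4 := by norm_num
  generalize (2:ℝ) ^ α = a2 at *
  generalize (4:ℝ) ^ α = a4 at *
  generalize d ^ α = P at *
  have hθα : 0 < θ ^ α := by positivity
  generalize θ ^ α = Θ at *
  generalize τ ^ (-α) = t at *
  have key : S * (144 * Ab * Θ * a2 + 144 * Ab * Θ * a4) ≤ S * (864 * Ab * Θ) := by
    refine mul_le_mul_of_nonneg_left ?_ hS
    have : 0 ≤ Ab * Θ := by positivity
    nlinarith
  rw [le_div_iff₀ (by positivity)]
  have : (9 * (2 * (Ab / P)) * (M / (θ * d) ^ 2 + 8 * (S / (d ^ 2 * P)) * (a2 * (Θ * P))) +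
      9 * (2 * (Ab / P)) * (a4 * (Θ * P)) * (8 * (S / (d ^ 2 * P))) + 8 * (Cb / (d ^ 2 * P)) * M
      + 4 * (Db / d ^ 2) * (11 * M * (t * P⁻¹) + 18 * (τ * d) ^ 2 * (8 * (S / (d ^ 2 * P))))) * (d ^ 2 * P) =
      S * (144 * Ab * Θ * a2 + 144 * Ab * Θ * a4) + S * (576 * Db * τ ^ 2) + M * (18 * Ab * (θ ^ 2)⁻¹ + 8 * Cb + 44 * Db * t) := by
    field_simp
    ring
  rw [this]
  linarith

lemma Glob.axis (g : Glob T α l0 L M Ab Cb Db U R v₀ u c A H) {S d θ τ κ K : ℝ} (hS : 0 ≤ S)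
    (hV : Valid T α R v₀ H S) (hd : 0 < d) (hθ : 0 < θ) (hθ1 : θ ≤ 1 / 16) (hτ : 0 < τ) (hτ1 : τ ≤ 1 / 16)
    (hκ : 0 < κ) (c1 : 768 * (l0 + L) * κ ^ 2 ≤ l0 * be α * d1 α) (k1 : 64 * U ≤ K)
    (k2 : 8 * M * (κ * θ) ^ (-(2 + α)) ≤ K)
    (c2 : 16 * (S * (864 * Ab * θ ^ α + 576 * Db * τ ^ 2) +
          M * (18 * Ab * (θ ^ 2)⁻¹ + 8 * Cb + 44 * Db * τ ^ (-α))) ≤ l0 * be α * (d1 α * S + K))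
    {x1 : V3} {w : ℝ} (hw : 0 < w) (k : Fin 3) (h1 : d ≤ dCube v₀ R x1)
    (h2 : d ≤ dCube v₀ R (x1 + w • esingle k)) (h3 : d ≤ dCube v₀ R (x1 - w • esingle k))
    {t : ℝ} (ht : t ∈ Set.Icc 0 T) (i j : Fin 3) :
    d ^ (2 + α) * |H t (x1 + w • esingle k) i j - H t (x1 - w • esingle k) i j| ≤
      w ^ α * (3 / 64 * S + (Ce α * K + 2 * M * ep α ^ (-(2:ℝ)) * (dp α * θ) ^ (-(2 + α)))) := by
  have hD : 0 < d ^ (2 + α) := by positivity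
  have hdi : d ^ (-(2 + α)) = (d ^ (2 + α))⁻¹ := Real.rpow_neg hd.le _
  have key := _root_.axis (r := θ * d) (e := τ * d) (K2 := K / d ^ (2 + α)) (κ := κ) k (by positivity)
    (g.loc hS hV hd h1) (g.loc hS hV hd h2) (g.loc hS hV hd h3) (by positivity)
    (by nlinarith) (by positivity) (by nlinarith) hκ rfl
    (by rw [← mul_assoc, ← mul_div_assoc]; gcongr; linarith)
    (by
      rw [← mul_assoc, Real.mul_rpow (by positivity) hd.le, hdi, ← mul_assoc, div_eq_mul_inv]
      exact mul_le_mul_of_nonneg_right k2 (by positivity)) c1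
    (by
      have := Gbound (M := M) (Cb := Cb) (Db := Db) g.hα0 g.hα1 hd hθ hτ hS g.hA
      refine (mul_le_mul_of_nonneg_left this (by norm_num)).trans ?_
      rw [← mul_div_assoc, div_le_iff₀ hD]
      refine c2.trans (le_of_eq ?_)
      field_simp) ht i j hw
  refine (mul_le_mul_of_nonneg_left key hD.le).trans (le_of_eq ?_)
  rw [← mul_assoc (dp α), Real.mul_rpow (mul_pos (dp_pos α) hθ).le hd.le, hdi]
  field_simp
  ring

lemma Glob.step1 (g : Glob T α l0 L M Ab Cb Db U R v₀ u c A H) {S d θ τ κ K : ℝ} (hS : 0 ≤ S)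
    (hV : Valid T α R v₀ H S) (hd : 0 < d) (hθ : 0 < θ) (hθ1 : θ ≤ 1 / 16) (hτ : 0 < τ) (hτ1 : τ ≤ 1 / 16)
    (hκ : 0 < κ) (c1 : 768 * (l0 + L) * κ ^ 2 ≤ l0 * be α * d1 α) (k1 : 64 * U ≤ K)
    (k2 : 8 * M * (κ * θ) ^ (-(2 + α)) ≤ K)
    (c2 : 16 * (S * (864 * Ab * θ ^ α + 576 * Db * τ ^ 2) +
          M * (18 * Ab * (θ ^ 2)⁻¹ + 8 * Cb + 44 * Db * τ ^ (-α))) ≤ l0 * be α * (d1 α * S + K))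
    {p : V3} {a ℓ : ℝ} (k : Fin 3) (h1 : d ≤ dCube v₀ R p)
    (h2 : d ≤ dCube v₀ R (p + a • esingle k)) (ha : |a| ≤ ℓ)
    {t : ℝ} (ht : t ∈ Set.Icc 0 T) (i j : Fin 3) :
    d ^ (2 + α) * |H t (p + a • esingle k) i j - H t p i j| ≤
      ℓ ^ α * (3 / 64 * S + (Ce α * K + 2 * M * ep α ^ (-(2:ℝ)) * (dp α * θ) ^ (-(2 + α)))) := by
  have hK : 0 ≤ K := by have := g.hU; linarith
  have hM := g.hM
  have hα0 := g.hα0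
  have hCe := Ce_pos α
  have hep := ep_pos α
  have hdp := dp_pos α
  have hB : 0 ≤ 3 / 64 * S + (Ce α * K + 2 * M * ep α ^ (-(2:ℝ)) * (dp α * θ) ^ (-(2 + α))) := by positivity
  have hℓ : 0 ≤ ℓ := (abs_nonneg a).trans ha
  have hx : d ≤ dCube v₀ R (p + (a / 2) • esingle k) := by
    rw [le_dCube] at *
    intro n
    have m1 := h1 n
    have m2 := h2 n
    simp only [PiLp.add_apply, PiLp.smul_apply, smul_eq_mul] at m2 ⊢
    rw [abs_le] at *
    constructor <;> linarith [m1.1, m1.2, m2.1, m2.2]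
  rcases lt_trichotomy a 0 with hneg | h0 | hpos
  · have e1 : p + (a / 2) • esingle k + (-a / 2) • esingle k = p := by module
    have e2 : p + (a / 2) • esingle k - (-a / 2) • esingle k = p + a • esingle k := by module
    have := g.axis hS hV hd hθ hθ1 hτ hτ1 hκ c1 k1 k2 c2 (x1 := p + (a / 2) • esingle k) (w := -a / 2)
      (by linarith) k hx (by rwa [e1]) (by rwa [e2]) ht i j
    rw [e1, e2, abs_sub_comm] at this
    refine this.trans (mul_le_mul_of_nonneg_right ?_ hB)
    rw [abs_of_neg hneg] at ha
    exact Real.rpow_le_rpow (by linarith) (by linarith) hα0.le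
  · subst h0
    simp only [zero_smul, add_zero, sub_self, abs_zero, mul_zero]
    positivity
  · have e1 : p + (a / 2) • esingle k + (a / 2) • esingle k = p + a • esingle k := by module
    have e2 : p + (a / 2) • esingle k - (a / 2) • esingle k = p := by module
    have := g.axis hS hV hd hθ hθ1 hτ hτ1 hκ c1 k1 k2 c2 (x1 := p + (a / 2) • esingle k) (w := a / 2)
      (by linarith) k hx (by rwa [e1]) (by rwa [e2]) ht i j
    rw [e1, e2] at this
    refine this.trans (mul_le_mul_of_nonneg_right ?_ hB)
    rw [abs_of_pos hpos] at ha
    exact Real.rpow_le_rpow (by linarith) (by linarith) hα0.le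

lemma coord_upd (p : V3) (a : ℝ) (k n : Fin 3) :
    (p + a • esingle k) n = if n = k then p n + a else p n := by
  simp only [PiLp.add_apply, PiLp.smul_apply, smul_eq_mul, esingle, EuclideanSpace.single_apply]
  split_ifs <;> simp

lemma dCube_upd {d : ℝ} {v w : V3} (hv : d ≤ dCube v₀ R v) (hw : d ≤ dCube v₀ R w) (k : Fin 3) :
    d ≤ dCube v₀ R (v + (w k - v k) • esingle k) := by
  rw [le_dCube] at *
  intro n
  rw [coord_upd]
  split_ifs with h
  · subst h
    rw [add_sub_cancel]; exact hw n
  · exact hv n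

lemma Glob.step (g : Glob T α l0 L M Ab Cb Db U R v₀ u c A H) {S θ τ κ K : ℝ} (hS : 0 ≤ S)
    (hV : Valid T α R v₀ H S) (hθ : 0 < θ) (hθ1 : θ ≤ 1 / 16) (hτ : 0 < τ) (hτ1 : τ ≤ 1 / 16)
    (hκ : 0 < κ) (c1 : 768 * (l0 + L) * κ ^ 2 ≤ l0 * be α * d1 α) (k1 : 64 * U ≤ K)
    (k2 : 8 * M * (κ * θ) ^ (-(2 + α)) ≤ K)
    (c2 : 16 * (S * (864 * Ab * θ ^ α + 576 * Db * τ ^ 2) +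
          M * (18 * Ab * (θ ^ 2)⁻¹ + 8 * Cb + 44 * Db * τ ^ (-α))) ≤ l0 * be α * (d1 α * S + K))
    {Y : ℝ} (hY : 3 * (Ce α * K + 2 * M * ep α ^ (-(2:ℝ)) * (dp α * θ) ^ (-(2 + α))) ≤ Y) :
    Valid T α R v₀ H (S / 2 + Y) := by
  intro t ht v hv w hw i j
  obtain ⟨d, hd⟩ : ∃ d, d = min (dCube v₀ R v) (dCube v₀ R w) := ⟨_, rfl⟩
  have hd0 : 0 < d := by rw [hd]; exact lt_min (dCube_pos hv) (dCube_pos hw)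
  have dv : d ≤ dCube v₀ R v := hd ▸ min_le_left _ _
  have dw : d ≤ dCube v₀ R w := hd ▸ min_le_right _ _
  rw [← hd]
  obtain ⟨p1, hp1⟩ : ∃ p, p = v + (w 0 - v 0) • esingle 0 := ⟨_, rfl⟩
  have dp1 : d ≤ dCube v₀ R p1 := hp1 ▸ dCube_upd dv dw 0
  obtain ⟨p2, hp2⟩ : ∃ p, p = p1 + (w 1 - p1 1) • esingle 1 := ⟨_, rfl⟩
  have dp2 : d ≤ dCube v₀ R p2 := hp2 ▸ dCube_upd dp1 dw 1
  have hp3 : w = p2 + (w 2 - p2 2) • esingle 2 := by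
    ext n
    rw [coord_upd, hp2, coord_upd, hp1, coord_upd]
    fin_cases n <;> simp [esingle]
  have c0 : ∀ n, |w n - v n| ≤ ‖v - w‖ := by
    intro n
    have := abs_coord_le (w - v) n
    rwa [norm_sub_rev] at this
  have s1 := g.step1 hS hV hd0 hθ hθ1 hτ hτ1 hκ c1 k1 k2 c2 (p := v) 0 dv (hp1 ▸ dp1) (c0 0) ht i j
  have s2 := g.step1 hS hV hd0 hθ hθ1 hτ hτ1 hκ c1 k1 k2 c2 (p := p1) (a := w 1 - p1 1) (ℓ := ‖v - w‖) 1 dp1 (hp2 ▸ dp2)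
    (by rw [hp1, coord_upd]; simpa using c0 1) ht i j
  have s3 := g.step1 hS hV hd0 hθ hθ1 hτ hτ1 hκ c1 k1 k2 c2 (p := p2) (a := w 2 - p2 2) (ℓ := ‖v - w‖) 2 dp2 (hp3 ▸ dw)
    (by rw [hp2, coord_upd, hp1, coord_upd]; simpa using c0 2) ht i j
  rw [← hp1] at s1
  rw [← hp2] at s2
  rw [← hp3] at s3
  have hD : 0 < d ^ (2 + α) := by positivity
  have tri3 : |H t v i j - H t w i j| ≤ |H t p1 i j - H t v i j| + |H t p2 i j - H t p1 i j| + |H t w i j - H t p2 i j| := by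
    rw [abs_sub_comm (H t v i j)]
    have := abs_sub_le (H t w i j) (H t p2 i j) (H t v i j)
    have := abs_sub_le (H t p2 i j) (H t p1 i j) (H t v i j)
    linarith
  have := mul_le_mul_of_nonneg_left tri3 hD.le
  have hl : 0 ≤ ‖v - w‖ ^ α := by positivity
  have f1 := mul_le_mul_of_nonneg_left hY hl
  have f2 : 0 ≤ ‖v - w‖ ^ α * S := by positivity
  linarith

lemma Glob.final (g : Glob T α l0 L M Ab Cb Db U R v₀ u c A H) {S0 θ τ κ K : ℝ} (hS0 : 0 ≤ S0)
    (hV : Valid T α R v₀ H S0) (hθ : 0 < θ) (hθ1 : θ ≤ 1 / 16) (hτ : 0 < τ) (hτ1 : τ ≤ 1 / 16)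
    (hκ : 0 < κ) (c1 : 768 * (l0 + L) * κ ^ 2 ≤ l0 * be α * d1 α) (k1 : 64 * U ≤ K)
    (k2 : 8 * M * (κ * θ) ^ (-(2 + α)) ≤ K)
    (c2 : ∀ S, 0 ≤ S → 16 * (S * (864 * Ab * θ ^ α + 576 * Db * τ ^ 2) +
          M * (18 * Ab * (θ ^ 2)⁻¹ + 8 * Cb + 44 * Db * τ ^ (-α))) ≤ l0 * be α * (d1 α * S + K))
    {Y : ℝ} (hY0 : 0 ≤ Y)
    (hY : 3 * (Ce α * K + 2 * M * ep α ^ (-(2:ℝ)) * (dp α * θ) ^ (-(2 + α))) ≤ Y) :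
    Valid T α R v₀ H (2 * Y) := by
  have it : ∀ n : ℕ, Valid T α R v₀ H (S0 * (1 / 2) ^ n + 2 * Y) := by
    intro n
    induction n with
    | zero =>
      intro t ht v hv w hw i j
      refine (hV t ht v hv w hw i j).trans (mul_le_mul_of_nonneg_right ?_ (by positivity))
      simp; exact hY0
    | succ n ih =>
      have h0 : 0 ≤ S0 * (1 / 2) ^ n + 2 * Y := by positivity
      have := g.step h0 ih hθ hθ1 hτ hτ1 hκ c1 k1 k2 (c2 _ h0) hY
      convert this using 1
      rw [pow_succ]; ring
  intro t ht v hv w hw i j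
  have lim : Tendsto (fun n : ℕ => (S0 * (1 / 2) ^ n + 2 * Y) * ‖v - w‖ ^ α) atTop
      (𝓝 ((S0 * 0 + 2 * Y) * ‖v - w‖ ^ α)) := by
    refine Tendsto.mul_const _ (Tendsto.add_const _ (Tendsto.const_mul _ ?_))
    exact tendsto_pow_atTop_nhds_zero_of_lt_one (by norm_num) (by norm_num)
  rw [mul_zero, zero_add] at lim
  exact ge_of_tendsto' lim fun n => it n t ht v hv w hw i j
end

lemma jap_bd {v₀ v : V3} {R : ℝ} (hR : R ≤ (1 / 2) * jap v₀) (hv : v ∈ cube v₀ R) : jap v ≤ 2 * jap v₀ := by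
  have hJ0 : 0 ≤ jap v₀ := Real.sqrt_nonneg _
  have hJ : jap v₀ ^ 2 = 1 + ‖v₀‖ ^ 2 := Real.sq_sqrt (by positivity)
  have hn : ‖v - v₀‖ ^ 2 ≤ 3 / 4 * jap v₀ ^ 2 := by
    rw [EuclideanSpace.norm_sq_eq, Fin.sum_univ_three]
    have : ∀ i, ‖(v - v₀) i‖ ^ 2 ≤ 1 / 4 * jap v₀ ^ 2 := by
      intro i
      have h1 : ‖(v - v₀) i‖ ≤ 1 / 2 * jap v₀ := by
        have := hv i
        rw [Real.norm_eq_abs, PiLp.sub_apply]; linarith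
      have h2 := mul_self_le_mul_self (norm_nonneg _) h1
      nlinarith
    linarith [this 0, this 1, this 2]
  have h3 : ‖v‖ ≤ ‖v₀‖ + ‖v - v₀‖ := by
    have := norm_add_le v₀ (v - v₀)
    rwa [add_sub_cancel] at this
  have h4 : ‖v‖ ^ 2 ≤ (‖v₀‖ + ‖v - v₀‖) ^ 2 := by gcongr
  have h5 : 2 * ‖v₀‖ * ‖v - v₀‖ ≤ ‖v₀‖ ^ 2 + ‖v - v₀‖ ^ 2 := by nlinarith [sq_nonneg (‖v₀‖ - ‖v - v₀‖)]
  unfold jap at *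
  rw [Real.sqrt_le_left (by positivity), mul_pow, hJ]
  nlinarith

end

/-- Schauder estimate for the parabolic Landau equation
(Proposition 4 of the paper), stated with weighted Hölder seminorm bounds. -/
theorem schauder_parabolic_landau :
    ∃ C : ℝ → ℝ → ℝ → ℝ,
      ∀ (α lam Lam : ℝ), α ∈ Set.Ioo (0 : ℝ) 1 → 0 < lam → 0 < Lam →
      0 < C α lam Lam ∧
      ∀ (γ T : ℝ), γ ∈ Set.Icc (-3 : ℝ) (-2) → 0 < T →
      ∀ (v₀ : V3) (R : ℝ), 0 < R → R ≤ (1 / 2) * jap v₀ →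
      ∀ (A : ℝ → V3 → Mat3) (c : ℝ → V3 → ℝ),
        (∀ t ∈ Set.Icc (0 : ℝ) T, ∀ v ∈ cube v₀ R, (A t v).IsSymm) →
        -- ellipticity: λ⟨v⟩^γ|ξ|² ≤ ⟨A ξ, ξ⟩ ≤ Λ⟨v⟩^{γ+2}|ξ|²
        (∀ t ∈ Set.Icc (0 : ℝ) T, ∀ v ∈ cube v₀ R, ∀ ξ : V3,
          lam * jap v ^ γ * ‖ξ‖ ^ 2 ≤ quadForm (A t v) ξ ∧
          quadForm (A t v) ξ ≤ Lam * jap v ^ (γ + 2) * ‖ξ‖ ^ 2) →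
      ∀ u : ℝ → V3 → ℝ,
        -- u is C¹ in time and C² in velocity and solves ∂_t u = A : ∇²u + c u on Q_R(v₀)
        (∀ v ∈ cube v₀ R, ContDiffOn ℝ 1 (fun t => u t v) (Set.Icc (0 : ℝ) T)) →
        (∀ t ∈ Set.Icc (0 : ℝ) T, ContDiffOn ℝ 2 (u t) (cube v₀ R)) →
        (∀ t ∈ Set.Icc (0 : ℝ) T, ∀ v ∈ cube v₀ R,
          derivWithin (fun s => u s v) (Set.Icc (0 : ℝ) T) t =
            matDot (A t v) (hessW (u t) (cube v₀ R) v) + c t v * u t v) →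
        -- u is C^{2+α} on Q_R(v₀)
        (∃ N : ℝ, ∀ t ∈ Set.Icc (0 : ℝ) T, ∀ v ∈ cube v₀ R, ∀ w ∈ cube v₀ R,
          ∀ i j : Fin 3,
            |hessW (u t) (cube v₀ R) v i j - hessW (u t) (cube v₀ R) w i j| ≤
              N * ‖v - w‖ ^ α) →
      -- given bounds on the coefficients and on u
      ∀ Ab Cb Db U₀ M : ℝ, 0 ≤ Ab → 0 ≤ Cb → 0 ≤ Db → 0 ≤ U₀ → 0 ≤ M →
        -- [ā]*_{α,Q_R(v₀)} ≤ Ab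
        (∀ t ∈ Set.Icc (0 : ℝ) T, ∀ v ∈ cube v₀ R, ∀ w ∈ cube v₀ R, ∀ i j : Fin 3,
          min (dCube v₀ R v) (dCube v₀ R w) ^ α * |A t v i j - A t w i j| ≤
            Ab * ‖v - w‖ ^ α) →
        -- [c̄]^★_α ≤ Cb
        (∀ t ∈ Set.Icc (0 : ℝ) T, ∀ v ∈ cube v₀ R, ∀ w ∈ cube v₀ R,
          min (dCube v₀ R v) (dCube v₀ R w) ^ (2 + α) * |c t v - c t w| ≤
            Cb * ‖v - w‖ ^ α) →
        -- ‖d² c̄‖_{L^∞(Q_R(v₀))} ≤ Db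
        (∀ t ∈ Set.Icc (0 : ℝ) T, ∀ v ∈ cube v₀ R,
          dCube v₀ R v ^ 2 * |c t v| ≤ Db) →
        -- [u₀]*_{2+α,Σ_R(v₀)} ≤ U₀
        (∀ v ∈ cube v₀ R, ∀ w ∈ cube v₀ R, ∀ i j : Fin 3,
          min (dCube v₀ R v) (dCube v₀ R w) ^ (2 + α) *
              |hessW (u 0) (cube v₀ R) v i j - hessW (u 0) (cube v₀ R) w i j| ≤
            U₀ * ‖v - w‖ ^ α) →
        -- ‖u‖_{L^∞(Q_R(v₀))} ≤ M
        (∀ t ∈ Set.Icc (0 : ℝ) T, ∀ v ∈ cube v₀ R, |u t v| ≤ M) →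
        -- conclusion: [u]*_{2+α,Q_R(v₀)} ≤ C(α,λ,Λ)([u₀]* + 𝒱(v₀)‖u‖_∞)
        ∀ t ∈ Set.Icc (0 : ℝ) T, ∀ v ∈ cube v₀ R, ∀ w ∈ cube v₀ R, ∀ i j : Fin 3,
          min (dCube v₀ R v) (dCube v₀ R w) ^ (2 + α) *
              |hessW (u t) (cube v₀ R) v i j - hessW (u t) (cube v₀ R) w i j| ≤
            C α lam Lam *
              (U₀ +
                ((1 + Ab) ^ (1 + 2 / α) * jap v₀ ^ ((2 - γ) * (1 + 2 / α)) +
                  Cb * jap v₀ ^ (-γ) +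
                  (1 + Db) ^ (1 + α / 2) * jap v₀ ^ (-γ * (1 + α / 2))) * M) *
              ‖v - w‖ ^ α := by
  classical
  have ex : ∀ α lam Lam : ℝ, ∃ C0 : ℝ, 0 < C0 ∧ (α ∈ Set.Ioo (0 : ℝ) 1 → 0 < lam → 0 < Lam →
      ∀ (γ J Ab Cb Db U M l0 : ℝ), γ ∈ Set.Icc (-3 : ℝ) (-2) → 1 ≤ J → 0 ≤ Ab → 0 ≤ Cb →
      0 ≤ Db → 0 ≤ U → 0 ≤ M → l0 = lam * J ^ γ / 8 →
      ∃ θ τ κ K : ℝ, 0 < θ ∧ θ ≤ 1 / 16 ∧ 0 < τ ∧ τ ≤ 1 / 16 ∧ 0 < κ ∧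
        768 * (l0 + Lam) * κ ^ 2 ≤ l0 * be α * d1 α ∧ 64 * U ≤ K ∧
        8 * M * (κ * θ) ^ (-(2 + α)) ≤ K ∧
        (∀ S, 0 ≤ S → 16 * (S * (864 * Ab * θ ^ α + 576 * Db * τ ^ 2) +
          M * (18 * Ab * (θ ^ 2)⁻¹ + 8 * Cb + 44 * Db * τ ^ (-α))) ≤ l0 * be α * (d1 α * S + K)) ∧
        3 * (Ce α * K + 2 * M * ep α ^ (-(2:ℝ)) * (dp α * θ) ^ (-(2 + α))) ≤ C0 * (U +
           ((1 + Ab) ^ (1 + 2 / α) * J ^ ((2 - γ) * (1 + 2 / α)) + Cb * J ^ (-γ) +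
                  (1 + Db) ^ (1 + α / 2) * J ^ (-γ * (1 + α / 2))) * M)) := by
    intro α lam Lam
    by_cases h : α ∈ Set.Ioo (0 : ℝ) 1 ∧ 0 < lam ∧ 0 < Lam
    · obtain ⟨C0, hC, hh⟩ := params α lam Lam h.1.1 h.1.2 h.2.1 h.2.2
      exact ⟨C0, hC, fun _ _ _ => hh⟩
    · exact ⟨1, one_pos, fun a b c => absurd ⟨a, b, c⟩ h⟩
  choose C0 hC0 hpar using ex
  refine ⟨fun a l L => 2 * C0 a l L, ?_⟩
  intro α lam Lam hα hlam hLam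
  refine ⟨mul_pos two_pos (hC0 _ _ _), ?_⟩
  intro γ T hγ hT v₀ R hR hRJ A c hsym hell u hut hu2 heq hN Ab Cb Db U₀ M hAb hCb hDb hU₀ hM hA hc hcB hU hbd
  have hJ1 : ∀ v : V3, 1 ≤ jap v := by
    intro v
    unfold jap
    rw [Real.one_le_sqrt]
    nlinarith [sq_nonneg ‖v‖]
  have hJ0 : 0 < jap v₀ := lt_of_lt_of_le one_pos (hJ1 v₀)
  obtain ⟨θ, τ, κ, K, t1, t2, t3, t4, t5, t6, t7, t8, t9, t10⟩ :=
    hpar α lam Lam hα hlam hLam γ (jap v₀) Ab Cb Db U₀ M (lam * jap v₀ ^ γ / 8) hγ (hJ1 v₀) hAb hCb hDb hU₀ hM rfl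
  have g : Glob T α (lam * jap v₀ ^ γ / 8) Lam M Ab Cb Db U₀ R v₀ u c A (fun t => hessW (u t) (cube v₀ R)) :=
    { hT := hT.le
      hα0 := hα.1
      hα1 := hα.2
      hl0 := by positivity
      hL := hLam.le
      hM := hM
      hA := hAb
      hC := hCb
      hD := hDb
      hU := hU₀
      c2 := fun t ht => ⟨_, _, C2D_of (isOpen_cube v₀ R) (hu2 t ht)⟩
      bd := hbd
      aH := hA
      cH := hc
      cB := hcB
      ini := hU
      sym := hsym
      ell := by
        intro t ht y hy ξ
        refine le_trans ?_ (hell t ht y hy ξ).1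
        refine mul_le_mul_of_nonneg_right ?_ (by positivity)
        have h1 : (2 * jap v₀) ^ γ ≤ jap y ^ γ :=
          Real.rpow_le_rpow_of_nonpos (by linarith [hJ1 y]) (jap_bd hRJ hy) (by linarith [hγ.2])
        rw [Real.mul_rpow (by norm_num) hJ0.le] at h1
        have h2 : (1 / 8 : ℝ) ≤ 2 ^ γ := by
          calc (1 / 8 : ℝ) = 2 ^ (-3 : ℝ) := by
                rw [Real.rpow_neg (by norm_num)]; norm_num
            _ ≤ 2 ^ γ := Real.rpow_le_rpow_of_exponent_le (by norm_num) hγ.1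
        have h3 : 0 < jap v₀ ^ γ := by positivity
        have h4 := mul_le_mul_of_nonneg_right h2 h3.le
        have h5 := mul_le_mul_of_nonneg_left (h4.trans h1) hlam.le
        linarith
      tr := by
        intro t ht y hy
        have h1 : jap y ^ (γ + 2) ≤ 1 :=
          Real.rpow_le_one_of_one_le_of_nonpos (hJ1 y) (by linarith [hγ.2])
        have h2 : ∀ i, A t y i i ≤ Lam := by
          intro i
          have h3 := (hell t ht y hy (esingle i)).2
          rw [quad_es, norm_es] at h3
          have := mul_le_mul_of_nonneg_left h1 hLam.le
          linarith
        rw [Matrix.trace_fin_three]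
        linarith [h2 0, h2 1, h2 2]
      der := by
        intro t ht y hy
        have h1 : DifferentiableWithinAt ℝ (fun s => u s y) (Set.Icc 0 T) t :=
          ((hut y hy).differentiableOn (by norm_num)) t ht
        have h2 := h1.hasDerivWithinAt
        rwa [heq t ht y hy] at h2 }
  obtain ⟨N, hN⟩ := hN
  have hV : Valid T α R v₀ (fun t => hessW (u t) (cube v₀ R)) (R ^ (2 + α) * max N 0) := by
    intro t ht v hv w hw i j
    have h1 := hN t ht v hv w hw i j
    have h2 : 0 < min (dCube v₀ R v) (dCube v₀ R w) := lt_min (dCube_pos hv) (dCube_pos hw)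
    have h3 : dCube v₀ R v ≤ R := by
      have := (le_dCube.1 (le_refl (dCube v₀ R v))) 0
      linarith [abs_nonneg (v 0 - v₀ 0)]
    have h4 : min (dCube v₀ R v) (dCube v₀ R w) ≤ R := (min_le_left _ _).trans h3
    have hα0 := hα.1
    rw [mul_assoc]
    refine mul_le_mul (Real.rpow_le_rpow h2.le h4 (by linarith)) ?_ (abs_nonneg _) (by positivity)
    exact h1.trans (mul_le_mul_of_nonneg_right (le_max_left _ _) (by positivity))
  have hY0 : 0 ≤ C0 α lam Lam * (U₀ +
                ((1 + Ab) ^ (1 + 2 / α) * jap v₀ ^ ((2 - γ) * (1 + 2 / α)) +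
                  Cb * jap v₀ ^ (-γ) +
                  (1 + Db) ^ (1 + α / 2) * jap v₀ ^ (-γ * (1 + α / 2))) * M) := by
    have := hC0 α lam Lam
    positivity
  have fin := g.final (by positivity) hV t1 t2 t3 t4 t5 t6 t7 t8 t9 hY0 t10
  rw [← mul_assoc] at fin
  exact fin

end
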